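/- Let α, β : ℝ³∖{0} → ℝ be C² and homogeneous of degree 0 (i.e. C² functions on the unit sphere S²), and let q ∈ (1/2,1). Then there exist a C² Riemannian metric ḡ and a C¹ symmetric 2-tensor π̄ on ℝ³ satisfying the vacuum constraint equations R_ḡ − |π̄|_ḡ² + (1/2)(tr_ḡ π̄)² = 0 and div_ḡ π̄ = 0 everywhere on ℝ³, together with constants A, B₁, B₂, B₃, such that outside a compact set ḡ_ij = (1 + A/r)δ_ij + (α/r)(x_i x_j/r² − δ_ij/2) + O₂(r^{−1−q}) and π̄_ij = β x_i x_j/r⁴ + r^{−3}(−B_i x_j − B_j x_i + (Σ_l B_l x_l)δ_ij) + O₁(r^{−2−q}). -/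

import Mathlib

noncomputable section

/-- Points of `ℝ³`. -/
abbrev E3 := EuclideanSpace ℝ (Fin 3)

/-- Partial derivative of `f` in the `i`-th coordinate direction. -/
def pd (f : E3 → ℝ) (i : Fin 3) (x : E3) : ℝ :=
  fderiv ℝ f x (EuclideanSpace.single i 1)

/-- Christoffel symbols `Γ^k_{ij} = (1/2) Σ_l g^{kl} (∂_j g_{il} + ∂_i g_{jl} − ∂_l g_{ij})`. -/
def Gamma (g : E3 → Matrix (Fin 3) (Fin 3) ℝ) (k i j : Fin 3) (x : E3) : ℝ :=
  (1 / 2) * ∑ l, (g x)⁻¹ k l *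
    (pd (fun y => g y i l) j x + pd (fun y => g y j l) i x - pd (fun y => g y i j) l x)

/-- Scalar curvature
`R_g = Σ_{i,k} g^{ik} (Σ_j (∂_j Γ^j_{ik} − ∂_i Γ^j_{jk}) + Σ_{j,m} (Γ^m_{ik}Γ^j_{jm} − Γ^m_{jk}Γ^j_{im}))`. -/
def scalarCurvature (g : E3 → Matrix (Fin 3) (Fin 3) ℝ) (x : E3) : ℝ :=
  ∑ i, ∑ k, (g x)⁻¹ i k *
    ((∑ j, (pd (fun y => Gamma g j i k y) j x - pd (fun y => Gamma g j j k y) i x))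
      + ∑ j, ∑ m, (Gamma g m i k x * Gamma g j j m x - Gamma g m j k x * Gamma g j i m x))

/-- `|π|_g² = Σ g^{ij} g^{kl} π_{ik} π_{jl}`. -/
def normSq (g π : E3 → Matrix (Fin 3) (Fin 3) ℝ) (x : E3) : ℝ :=
  ∑ i, ∑ j, ∑ k, ∑ l, (g x)⁻¹ i j * (g x)⁻¹ k l * π x i k * π x j l

/-- `tr_g π = Σ g^{ij} π_{ij}`. -/
def traceT (g π : E3 → Matrix (Fin 3) (Fin 3) ℝ) (x : E3) : ℝ :=
  ∑ i, ∑ j, (g x)⁻¹ i j * π x i j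

/-- `(div_g π)_j = Σ_{i,k} g^{ik} (∂_i π_{kj} − Σ_l Γ^l_{ik} π_{lj} − Σ_l Γ^l_{ij} π_{kl})`. -/
def divT (g π : E3 → Matrix (Fin 3) (Fin 3) ℝ) (j : Fin 3) (x : E3) : ℝ :=
  ∑ i, ∑ k, (g x)⁻¹ i k *
    (pd (fun y => π y k j) i x - (∑ l, Gamma g l i k x * π x l j)
      - ∑ l, Gamma g l i j x * π x k l)

/-- The Hamiltonian constraint operator `R_g − |π|_g² + (1/2)(tr_g π)²`. -/
def hamiltonian (g π : E3 → Matrix (Fin 3) (Fin 3) ℝ) (x : E3) : ℝ :=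
  scalarCurvature g x - normSq g π x + (1 / 2) * (traceT g π x) ^ 2

/-- `f = O₁(r^{−s})` on the region `{‖x‖ ≥ ρ₀}`. -/
def IsO1 (f : E3 → ℝ) (s ρ₀ : ℝ) : Prop :=
  ∃ C : ℝ, ∀ x : E3, ρ₀ ≤ ‖x‖ →
    |f x| ≤ C * ‖x‖ ^ (-s) ∧ ∀ i, |pd f i x| ≤ C * ‖x‖ ^ (-s - 1)

/-- `f = O₂(r^{−s})` on the region `{‖x‖ ≥ ρ₀}`. -/
def IsO2 (f : E3 → ℝ) (s ρ₀ : ℝ) : Prop :=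
  ∃ C : ℝ, ∀ x : E3, ρ₀ ≤ ‖x‖ →
    |f x| ≤ C * ‖x‖ ^ (-s) ∧ (∀ i, |pd f i x| ≤ C * ‖x‖ ^ (-s - 1)) ∧
      ∀ i k, |pd (pd f i) k x| ≤ C * ‖x‖ ^ (-s - 2)

/-- The Kronecker delta. -/
def kron (i j : Fin 3) : ℝ := if i = j then 1 else 0

open MeasureTheory Set Filter Topology Metric
open scoped ContDiff BoundedContinuousFunction

namespace VacuumData

/-! ### Partial derivatives -/

/-- The `i`-th standard basis vector of `ℝ³`. -/
abbrev e (i : Fin 3) : E3 := EuclideanSpace.single i 1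

lemma sum_smul_e (x : E3) : ∑ i, x i • e i = x := by
  ext j
  fin_cases j <;> simp [Fin.sum_univ_three, e]

lemma clm_apply_eq_sum (L : E3 →L[ℝ] ℝ) (x : E3) : L x = ∑ i, L (e i) * x i := by
  conv_lhs => rw [← sum_smul_e x]
  simp [map_sum, mul_comm]

lemma abs_coord_le (x : E3) (i : Fin 3) : |x i| ≤ ‖x‖ := by
  simpa using PiLp.norm_apply_le x i

lemma clm_norm_le (L : E3 →L[ℝ] ℝ) : ‖L‖ ≤ ∑ i, |L (e i)| := by
  refine L.opNorm_le_bound (Finset.sum_nonneg fun i _ => abs_nonneg _) fun x => ?_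
  rw [clm_apply_eq_sum, Finset.sum_mul]
  refine (Finset.abs_sum_le_sum_abs _ _).trans (Finset.sum_le_sum fun i _ => ?_)
  rw [abs_mul]
  exact mul_le_mul_of_nonneg_left (abs_coord_le x i) (abs_nonneg _)

lemma abs_pd_le (f : E3 → ℝ) (i : Fin 3) (x : E3) : |pd f i x| ≤ ‖fderiv ℝ f x‖ := by
  simpa [pd] using (fderiv ℝ f x).le_opNorm (e i)

lemma norm_fderiv_le (f : E3 → ℝ) (x : E3) : ‖fderiv ℝ f x‖ ≤ ∑ i, |pd f i x| :=
  clm_norm_le _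

lemma norm_fderiv_le_of_pd {f : E3 → ℝ} {x : E3} {C : ℝ} (h : ∀ i, |pd f i x| ≤ C) :
    ‖fderiv ℝ f x‖ ≤ 3 * C := by
  refine (norm_fderiv_le f x).trans ((Finset.sum_le_sum fun i _ => h i).trans ?_)
  simp

lemma fderiv_eq_sum_pd (f : E3 → ℝ) (x : E3) :
    fderiv ℝ f x = ∑ i, pd f i x • (EuclideanSpace.proj i : E3 →L[ℝ] ℝ) := by
  ext y
  rw [clm_apply_eq_sum]
  simp [pd, e]

lemma _root_.ContDiff.pd {f : E3 → ℝ} {n : WithTop ℕ∞} (hf : ContDiff ℝ (n + 1) f) (i : Fin 3) :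
    ContDiff ℝ n (pd f i) :=
  (hf.fderiv_right le_rfl).clm_apply contDiff_const

lemma continuous_pd {f : E3 → ℝ} (hf : ContDiff ℝ 1 f) (i : Fin 3) : Continuous (pd f i) :=
  (ContDiff.pd (n := 0) (by simpa using hf) i).continuous

lemma contDiff_succ_of_pd {f : E3 → ℝ} {n : ℕ} (hd : Differentiable ℝ f)
    (h : ∀ i, ContDiff ℝ n (pd f i)) : ContDiff ℝ (n + 1) f := by
  rw [contDiff_succ_iff_fderiv]
  refine ⟨hd, by simp, ?_⟩
  have : fderiv ℝ f = fun x => ∑ i, pd f i x • (EuclideanSpace.proj i : E3 →L[ℝ] ℝ) :=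
    funext (fderiv_eq_sum_pd f)
  rw [this]
  exact ContDiff.sum fun i _ => (h i).smul contDiff_const

section rules

variable {f g : E3 → ℝ} {x : E3}

lemma pd_congr (h : f =ᶠ[𝓝 x] g) (i : Fin 3) : pd f i x = pd g i x := by
  simp only [pd, h.fderiv_eq]

lemma pd_const (c : ℝ) (i : Fin 3) (x : E3) : pd (fun _ => c) i x = 0 := by
  simp [pd]

lemma pd_add (hf : DifferentiableAt ℝ f x) (hg : DifferentiableAt ℝ g x) (i : Fin 3) :
    pd (fun y => f y + g y) i x = pd f i x + pd g i x := by
  simp only [pd]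
  rw [fderiv_fun_add hf hg]; rfl

lemma pd_sub (hf : DifferentiableAt ℝ f x) (hg : DifferentiableAt ℝ g x) (i : Fin 3) :
    pd (fun y => f y - g y) i x = pd f i x - pd g i x := by
  simp only [pd]
  rw [fderiv_fun_sub hf hg]; rfl

lemma pd_neg (f : E3 → ℝ) (x : E3) (i : Fin 3) : pd (fun y => - f y) i x = - pd f i x := by
  simp only [pd]
  rw [fderiv_fun_neg]; rfl

lemma pd_mul (hf : DifferentiableAt ℝ f x) (hg : DifferentiableAt ℝ g x) (i : Fin 3) :
    pd (fun y => f y * g y) i x = pd f i x * g x + f x * pd g i x := by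
  simp only [pd]
  rw [fderiv_fun_mul hf hg]
  simp; ring

lemma pd_const_mul (hf : DifferentiableAt ℝ f x) (c : ℝ) (i : Fin 3) :
    pd (fun y => c * f y) i x = c * pd f i x := by
  rw [pd_mul (differentiableAt_const c) hf, pd_const]; ring

lemma pd_sum {ι : Type*} {s : Finset ι} {F : ι → E3 → ℝ}
    (h : ∀ a ∈ s, DifferentiableAt ℝ (F a) x) (i : Fin 3) :
    pd (fun y => ∑ a ∈ s, F a y) i x = ∑ a ∈ s, pd (F a) i x := by
  simp only [pd]
  rw [fderiv_fun_sum h]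
  simp

lemma pd_comp {φ : ℝ → ℝ} {d : ℝ} (hφ : HasDerivAt φ d (f x)) (hf : DifferentiableAt ℝ f x)
    (i : Fin 3) : pd (fun y => φ (f y)) i x = d * pd f i x := by
  have h := (hφ.comp_hasFDerivAt x hf.hasFDerivAt).fderiv
  simp only [Function.comp_def] at h
  simp [pd, h]

lemma pd_coord (j i : Fin 3) (x : E3) : pd (fun y : E3 => y j) i x = if i = j then 1 else 0 := by
  have : HasFDerivAt (fun y : E3 => y j) (EuclideanSpace.proj j : E3 →L[ℝ] ℝ) x :=
    (EuclideanSpace.proj j : E3 →L[ℝ] ℝ).hasFDerivAt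
  simp only [pd, this.fderiv]
  simp [eq_comm]

lemma pd_comm (hf : ContDiff ℝ 2 f) (i j : Fin 3) (x : E3) :
    pd (pd f i) j x = pd (pd f j) i x := by
  have hs : IsSymmSndFDerivAt ℝ f x := hf.contDiffAt.isSymmSndFDerivAt (by simp)
  have hd : DifferentiableAt ℝ (fderiv ℝ f) x :=
    ((hf.fderiv_right (m := 1) (by norm_num)).differentiable (by norm_num)) x
  have key : ∀ a b : Fin 3, pd (pd f a) b x = fderiv ℝ (fderiv ℝ f) x (e b) (e a) := by
    intro a b
    have := (hd.hasFDerivAt.clm_apply (hasFDerivAt_const (e a) x)).fderiv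
    change fderiv ℝ (fun y => fderiv ℝ f y (e a)) x (e b) = _
    rw [this]
    simp
  rw [key, key]
  exact hs.eq _ _

end rules

/-! ### The weight `⟨x⟩ = √(1 + |x|²)` -/

/-- The Japanese bracket. -/
def wt (x : E3) : ℝ := Real.sqrt (1 + ‖x‖ ^ 2)

lemma wt_sq (x : E3) : wt x ^ 2 = 1 + ‖x‖ ^ 2 := Real.sq_sqrt (by positivity)

lemma one_le_wt (x : E3) : 1 ≤ wt x := by
  rw [wt, Real.one_le_sqrt]; nlinarith [sq_nonneg ‖x‖]

lemma wt_pos (x : E3) : 0 < wt x := zero_lt_one.trans_le (one_le_wt x)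

lemma norm_le_wt (x : E3) : ‖x‖ ≤ wt x := Real.le_sqrt_of_sq_le (by linarith)

lemma wt_le_two_mul {x : E3} (hx : 1 ≤ ‖x‖) : wt x ≤ 2 * ‖x‖ := by
  rw [wt, Real.sqrt_le_left (by positivity)]; nlinarith

lemma wt_le_two {x : E3} (hx : ‖x‖ ≤ 1) : wt x ≤ 2 := by
  rw [wt, Real.sqrt_le_left (by positivity)]; nlinarith [norm_nonneg x]

lemma contDiff_wt {n : WithTop ℕ∞} : ContDiff ℝ n wt := by
  refine ContDiff.sqrt (contDiff_const.add (contDiff_norm_sq ℝ)) fun x => ?_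
  positivity

lemma pd_wt (i : Fin 3) (x : E3) : pd wt i x = x i / wt x := by
  have h1 : pd (fun y => wt y * wt y) i x = 2 * x i := by
    have : (fun y : E3 => wt y * wt y) = fun y => 1 + ‖y‖ ^ 2 := by
      ext y; rw [← wt_sq]; ring
    rw [this]
    have h := ((hasStrictFDerivAt_norm_sq x).hasFDerivAt.const_add 1).fderiv
    simp only [pd, h]
    simp [PiLp.inner_apply]
  have hd : DifferentiableAt ℝ wt x := (contDiff_wt (n := 1)).differentiable (by norm_num) x
  rw [pd_mul hd hd] at h1
  rw [eq_div_iff (wt_pos x).ne']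
  linarith

lemma contDiff_wt_rpow {n : WithTop ℕ∞} (s : ℝ) : ContDiff ℝ n fun x => wt x ^ s :=
  contDiff_wt.rpow_const_of_ne fun x => (wt_pos x).ne'

lemma pd_wt_rpow (s : ℝ) (i : Fin 3) (x : E3) :
    pd (fun y => wt y ^ s) i x = s * wt x ^ (s - 1) * (x i / wt x) := by
  have hd : DifferentiableAt ℝ wt x := (contDiff_wt (n := 1)).differentiable (by norm_num) x
  rw [pd_comp (Real.hasDerivAt_rpow_const (Or.inl (wt_pos x).ne')) hd, pd_wt]

lemma abs_pd_wt_rpow_le (s : ℝ) (i : Fin 3) (x : E3) :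
    |pd (fun y => wt y ^ s) i x| ≤ |s| * wt x ^ (s - 1) := by
  have h := wt_pos x
  rw [pd_wt_rpow, abs_mul, abs_mul, abs_of_nonneg (Real.rpow_nonneg h.le (s - 1)), abs_div,
    abs_of_pos h]
  refine mul_le_of_le_one_right (by positivity) ?_
  rw [div_le_one h]
  exact (abs_coord_le x i).trans (norm_le_wt x)

lemma wt_rpow_le {s t : ℝ} (h : s ≤ t) (x : E3) : wt x ^ s ≤ wt x ^ t :=
  Real.rpow_le_rpow_of_exponent_le (one_le_wt x) h

lemma wt_rpow_pos (s : ℝ) (x : E3) : 0 < wt x ^ s := Real.rpow_pos_of_pos (wt_pos x) s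

lemma wt_le_mul (x z : E3) : wt z ≤ 2 * wt x * wt (x - z) := by
  have h : ‖z‖ ≤ ‖x‖ + ‖x - z‖ := by
    have := norm_sub_le x (x - z); simpa using this
  have h1 := wt_sq x
  have h2 := wt_sq (x - z)
  rw [wt, Real.sqrt_le_left (by have := wt_pos x; have := wt_pos (x - z); positivity)]
  have : (2 * wt x * wt (x - z)) ^ 2 = 4 * (1 + ‖x‖ ^ 2) * (1 + ‖x - z‖ ^ 2) := by
    rw [← h1, ← h2]; ring
  rw [this]
  have := pow_le_pow_left₀ (norm_nonneg z) h 2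
  nlinarith [sq_nonneg (‖x‖ - ‖x - z‖), norm_nonneg x, norm_nonneg (x - z),
    mul_nonneg (sq_nonneg ‖x‖) (sq_nonneg ‖x - z‖)]

lemma wt_sub_rpow_le {s : ℝ} (hs : 0 ≤ s) (x z : E3) :
    wt (x - z) ^ (-s) ≤ (2 * wt x) ^ s * wt z ^ (-s) := by
  have hx := wt_pos x
  have hz := wt_pos z
  have hxz := wt_pos (x - z)
  rw [Real.rpow_neg hxz.le, Real.rpow_neg hz.le, ← div_eq_mul_inv,
    inv_le_comm₀ (by positivity) (by positivity), inv_div, div_le_iff₀ (by positivity), mul_comm,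
    ← Real.mul_rpow (by positivity) hxz.le]
  exact Real.rpow_le_rpow hz.le (wt_le_mul x z) hs

lemma integrable_wt_rpow {s : ℝ} (hs : 3 < s) : Integrable fun x : E3 => wt x ^ (-s) := by
  have := integrable_rpow_neg_one_add_norm_sq (E := E3) (μ := volume) (r := s) (by simpa using hs)
  refine this.congr (Eventually.of_forall fun x => ?_)
  simp only [wt, Real.sqrt_eq_rpow]
  rw [← Real.rpow_mul (by positivity)]
  congr 1; ring

end VacuumData

namespace VacuumData

/-! ### Weakly singular integrals -/

/-- A radial profile with an integrable singularity at the origin and integrable decay. -/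
def profile (a s t : ℝ) : ℝ := t ^ (-a) * max t (1 / 2) ^ (-s)

lemma profile_nonneg {a s t : ℝ} (ht : 0 ≤ t) : 0 ≤ profile a s t := by
  unfold profile; positivity

lemma measurable_profile (a s : ℝ) : Measurable (profile a s) := by
  unfold profile; fun_prop

lemma integrable_profile {a s : ℝ} (ha : a < 3) (has : 3 < a + s) :
    Integrable fun z : E3 => profile a s ‖z‖ := by
  rw [integrable_fun_norm_addHaar (volume : Measure E3)]
  simp only [finrank_euclideanSpace, Fintype.card_fin, smul_eq_mul]
  have hm : AEStronglyMeasurable (fun y : ℝ => y ^ (3 - 1) * profile a s y) volume :=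
    ((measurable_id.pow_const _).mul (measurable_profile a s)).aestronglyMeasurable
  have hu : Ioi (0 : ℝ) = Ioc 0 1 ∪ Ioi 1 := by simp [Ioc_union_Ioi_eq_Ioi]
  rw [hu]
  refine IntegrableOn.union ?_ ?_
  · have h1 : IntegrableOn (fun t : ℝ => (1 / 2 : ℝ) ^ (-s) * t ^ (2 - a)) (Ioc 0 1) := by
      have := (intervalIntegral.intervalIntegrable_rpow' (a := 0) (b := 1) (r := 2 - a)
        (by linarith)).1
      exact this.const_mul _
    refine h1.mono' hm.restrict ?_
    filter_upwards [ae_restrict_mem measurableSet_Ioc] with t ht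
    have ht0 : 0 < t := ht.1
    have hp := profile_nonneg (a := a) (s := s) ht0.le
    rw [Real.norm_of_nonneg (by positivity), profile]
    have e1 : t ^ (3 - 1) * t ^ (-a) = t ^ (2 - a) := by
      rw [← Real.rpow_natCast, ← Real.rpow_add ht0]; norm_num; ring_nf
    rw [← mul_assoc, e1, mul_comm]
    gcongr ?_ * _
    exact Real.rpow_le_rpow_of_nonpos (by norm_num) (le_max_right _ _) (by linarith)
  · have h1 : IntegrableOn (fun t : ℝ => t ^ (2 - a - s)) (Ioi 1) :=
      integrableOn_Ioi_rpow_of_lt (by linarith) one_pos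
    refine h1.congr_fun (fun t ht => ?_) measurableSet_Ioi
    have ht0 : 0 < t := one_pos.trans ht
    have : max t (1 / 2) = t := max_eq_left (by have : 1 < t := ht; linarith)
    simp only [profile, this]
    rw [← Real.rpow_natCast, ← Real.rpow_add ht0, ← Real.rpow_add ht0]
    norm_num; ring_nf

lemma inv_pow_eq_rpow (a : ℕ) (t : ℝ) (ht : 0 ≤ t) : (t ^ a)⁻¹ = t ^ (-(a : ℝ)) := by
  rw [Real.rpow_neg ht, Real.rpow_natCast]

lemma inv_pow_mul_wt_le (a : ℕ) {s : ℝ} (hs : 0 ≤ s) (x z : E3) :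
    (‖z‖ ^ a)⁻¹ * wt (x - z) ^ (-s) ≤ profile a 3 ‖z‖ + wt (x - z) ^ (-s) := by
  have hw := wt_rpow_pos (-s) (x - z)
  have hw1 : wt (x - z) ^ (-s) ≤ 1 :=
    Real.rpow_le_one_of_one_le_of_nonpos (one_le_wt _) (by linarith)
  have hp := profile_nonneg (a := a) (s := 3) (norm_nonneg z)
  rcases le_total ‖z‖ 1 with h | h
  · have : (‖z‖ ^ a)⁻¹ ≤ profile a 3 ‖z‖ := by
      rw [profile, inv_pow_eq_rpow a _ (norm_nonneg z)]
      refine le_mul_of_one_le_right (by positivity) ?_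
      rw [Real.rpow_neg (by positivity)]
      refine (one_le_inv₀ (by positivity)).2 ?_
      exact Real.rpow_le_one (by positivity) (max_le h (by norm_num)) (by norm_num)
    calc _ ≤ (‖z‖ ^ a)⁻¹ * 1 := by gcongr
      _ ≤ _ := by linarith
  · have : (‖z‖ ^ a)⁻¹ ≤ 1 := inv_le_one_of_one_le₀ (one_le_pow₀ h)
    calc _ ≤ 1 * wt (x - z) ^ (-s) := by gcongr
      _ ≤ _ := by linarith

lemma measurable_inv_pow (a : ℕ) : Measurable fun z : E3 => (‖z‖ ^ a)⁻¹ := by fun_prop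

lemma continuous_wt_rpow (s : ℝ) : Continuous fun x => wt x ^ s :=
  (contDiff_wt_rpow (n := 0) s).continuous

lemma integrable_inv_pow_mul_wt {a : ℕ} (ha0 : 0 < a) (ha : a ≤ 2) {s : ℝ} (hs : 3 < s) (x : E3) :
    Integrable fun z : E3 => (‖z‖ ^ a)⁻¹ * wt (x - z) ^ (-s) := by
  have h1 : Integrable fun z : E3 => profile a 3 ‖z‖ + wt (x - z) ^ (-s) := by
    refine (integrable_profile (by norm_cast; omega) (by simpa using ha0)).add ?_
    exact (integrable_wt_rpow hs).comp_sub_left x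
  refine h1.mono' ?_ (Eventually.of_forall fun z => ?_)
  · exact ((measurable_inv_pow a).mul ((continuous_wt_rpow (-s)).comp
      (by fun_prop : Continuous fun z : E3 => x - z)).measurable).aestronglyMeasurable
  · rw [Real.norm_of_nonneg (mul_nonneg (by positivity) (wt_rpow_pos _ _).le)]
    exact inv_pow_mul_wt_le a (by linarith) x z

lemma exists_integral_inv_pow_mul_wt_le {s : ℝ} (hs : 3 < s) :
    ∃ C : ℝ, 0 ≤ C ∧ ∀ a : ℕ, 0 < a → a ≤ 2 → ∀ x : E3,
      ∫ z : E3, (‖z‖ ^ a)⁻¹ * wt (x - z) ^ (-s) ≤ C := by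
  have hI : ∀ a : ℕ, 0 ≤ ∫ z : E3, profile a 3 ‖z‖ := fun a =>
    integral_nonneg fun z => profile_nonneg (norm_nonneg z)
  have hW : 0 ≤ ∫ z : E3, wt z ^ (-s) := integral_nonneg fun z => (wt_rpow_pos _ _).le
  refine ⟨(∫ z : E3, profile (1 : ℕ) 3 ‖z‖) + (∫ z : E3, profile (2 : ℕ) 3 ‖z‖)
    + ∫ z : E3, wt z ^ (-s), ?_, ?_⟩
  · have := hI 1; have := hI 2; positivity
  intro a ha0 ha x
  have hp : Integrable fun z : E3 => profile a 3 ‖z‖ :=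
    integrable_profile (by norm_cast; omega) (by simpa using ha0)
  have hw : Integrable fun z : E3 => wt (x - z) ^ (-s) := (integrable_wt_rpow hs).comp_sub_left x
  have h1 : ∫ z : E3, (‖z‖ ^ a)⁻¹ * wt (x - z) ^ (-s) ≤
      ∫ z : E3, (profile a 3 ‖z‖ + wt (x - z) ^ (-s)) :=
    integral_mono (integrable_inv_pow_mul_wt ha0 ha hs x) (hp.add hw)
      fun z => inv_pow_mul_wt_le a (by linarith) x z
  rw [integral_add hp hw, integral_sub_left_eq_self (fun z => wt z ^ (-s)) volume x] at h1
  have h2 := hI 1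
  have h3 := hI 2
  simp only [Nat.cast_one, Nat.cast_ofNat] at *
  obtain rfl | rfl : a = 1 ∨ a = 2 := by omega
  · simp only [Nat.cast_one] at *; linarith
  · simp only [Nat.cast_ofNat] at *; linarith

lemma inv_pow_mul_wt_le_profile {a : ℕ} (ha : 0 < a) {s : ℝ} (hs : 0 < s) {x : E3} (hx : x ≠ 0)
    {y : E3} (hy : y ≠ 0) : (‖x - y‖ ^ a)⁻¹ * wt y ^ (-s) ≤
      ‖x‖ ^ (-(a : ℝ) - s) * (profile a s (‖‖x‖⁻¹ • (x - y)‖) + profile s a (‖‖x‖⁻¹ • y‖)) := by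
  set R := ‖x‖ with hR
  have hR0 : 0 < R := norm_pos_iff.2 hx
  have htri : R ≤ ‖x - y‖ + ‖y‖ := by
    have := norm_add_le (x - y) y; simpa using this
  set u := ‖x - y‖ with hu
  set v := ‖y‖ with hv
  have hu0 : 0 ≤ u := norm_nonneg _
  have hv0 : 0 ≤ v := norm_nonneg _
  have ha' : (0 : ℝ) < a := by exact_mod_cast ha
  rw [norm_smul, norm_smul, norm_inv, Real.norm_of_nonneg hR0.le, ← hu, ← hv]
  have hpu := profile_nonneg (a := a) (s := s) (t := R⁻¹ * u) (by positivity)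
  have hpv := profile_nonneg (a := s) (s := a) (t := R⁻¹ * v) (by positivity)
  have key : ∀ b c p m : ℝ, 0 ≤ p → p ≤ m → R ≤ 2 * m → 0 < c →
      p ^ (-b) * m ^ (-c) ≤ R ^ (-b - c) * profile b c (R⁻¹ * p) := by
    intro b c p m hp hpm hm hc
    have hm0 : 0 < m := by linarith
    have hmax : max (R⁻¹ * p) (1 / 2) ≤ R⁻¹ * m := by
      refine max_le (by gcongr) ?_
      rw [inv_mul_eq_div, le_div_iff₀ hR0]; linarith
    have h1 : (R⁻¹ * m) ^ (-c) ≤ max (R⁻¹ * p) (1 / 2) ^ (-c) :=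
      Real.rpow_le_rpow_of_nonpos (by positivity) hmax (by linarith)
    have hRi : ∀ d : ℝ, R⁻¹ ^ (-d) = R ^ d := fun d => by
      rw [Real.inv_rpow hR0.le, Real.rpow_neg hR0.le, inv_inv]
    calc p ^ (-b) * m ^ (-c)
        = R ^ (-b - c) * ((R⁻¹ * p) ^ (-b) * (R⁻¹ * m) ^ (-c)) := by
          rw [Real.mul_rpow (by positivity) hp, Real.mul_rpow (by positivity) hm0.le, hRi, hRi]
          have : R ^ (-b - c) * (R ^ b * R ^ c) = 1 := by
            rw [← Real.rpow_add hR0, ← Real.rpow_add hR0]; ring_nf; simp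
          linear_combination (-(p ^ (-b) * m ^ (-c))) * this
      _ ≤ _ := by unfold profile; gcongr
  have hR' : 0 < R ^ (-(a : ℝ) - s) := Real.rpow_pos_of_pos hR0 _
  have hv1 : 0 < v := norm_pos_iff.2 hy
  have hw : wt y ^ (-s) ≤ v ^ (-s) :=
    Real.rpow_le_rpow_of_nonpos hv1 (norm_le_wt y) (by linarith)
  rw [inv_pow_eq_rpow a u hu0]
  refine (mul_le_mul_of_nonneg_left hw (by positivity)).trans ?_
  rw [mul_add]
  rcases le_total u v with h | h
  · have := key a s u v hu0 h (by linarith) hs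
    have h2 : 0 ≤ R ^ (-(a : ℝ) - s) * profile s a (R⁻¹ * v) := by positivity
    linarith
  · have := key s a v u hv0 h (by linarith) ha'
    rw [mul_comm (v ^ (-s))] at this
    have h2 : 0 ≤ R ^ (-(a : ℝ) - s) * profile a s (R⁻¹ * u) := by positivity
    rw [show -s - (a : ℝ) = -(a : ℝ) - s by ring] at this
    linarith



lemma exists_integral_inv_pow_mul_wt_le_norm {s : ℝ} (hs : 2 < s) (hs' : s < 3) :
    ∃ C : ℝ, 0 ≤ C ∧ ∀ a : ℕ, 0 < a → a ≤ 2 → ∀ x : E3, x ≠ 0 →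
      Integrable (fun y : E3 => (‖x - y‖ ^ a)⁻¹ * wt y ^ (-s)) ∧
      ∫ y : E3, (‖x - y‖ ^ a)⁻¹ * wt y ^ (-s) ≤ C * ‖x‖ ^ (3 - (a : ℝ) - s) := by
  set F : ℕ → ℝ := fun a => (∫ z : E3, profile a s ‖z‖) + ∫ z : E3, profile s a ‖z‖ with hF
  have hF0 : ∀ a, 0 ≤ F a := fun a =>
    add_nonneg (integral_nonneg fun z => profile_nonneg (norm_nonneg z))
      (integral_nonneg fun z => profile_nonneg (norm_nonneg z))
  refine ⟨F 1 + F 2, add_nonneg (hF0 1) (hF0 2), fun a ha0 ha x hx => ?_⟩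
  have hR : 0 < ‖x‖ := norm_pos_iff.2 hx
  have ha' : (0 : ℝ) < a := by exact_mod_cast ha0
  have ha1 : (1 : ℝ) ≤ a := by exact_mod_cast ha0
  have ha2 : (a : ℝ) ≤ 2 := by exact_mod_cast ha
  have hp1 : Integrable fun z : E3 => profile a s ‖z‖ := integrable_profile (by linarith) (by linarith)
  have hp2 : Integrable fun z : E3 => profile s a ‖z‖ := integrable_profile (by linarith) (by linarith)
  have hs1 : Integrable fun y : E3 => profile a s ‖‖x‖⁻¹ • y‖ :=
    hp1.comp_smul (inv_ne_zero hR.ne')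
  have hi1 : Integrable fun y : E3 => profile a s ‖‖x‖⁻¹ • (x - y)‖ := hs1.comp_sub_left x
  have hi2 : Integrable fun y : E3 => profile s a ‖‖x‖⁻¹ • y‖ :=
    hp2.comp_smul (inv_ne_zero hR.ne')
  have hdom := (hi1.add hi2).const_mul (‖x‖ ^ (-(a : ℝ) - s))
  have hae : ∀ᵐ y : E3, (‖x - y‖ ^ a)⁻¹ * wt y ^ (-s) ≤
      ‖x‖ ^ (-(a : ℝ) - s) * (profile a s (‖‖x‖⁻¹ • (x - y)‖) + profile s a (‖‖x‖⁻¹ • y‖)) := by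
    have : ∀ᵐ y : E3, y ≠ 0 := by simp [ae_iff]
    filter_upwards [this] with y hy
    exact inv_pow_mul_wt_le_profile ha0 (by linarith) hx hy
  have hInt : Integrable (fun y : E3 => (‖x - y‖ ^ a)⁻¹ * wt y ^ (-s)) := by
    refine hdom.mono' ?_ ?_
    · exact (((measurable_inv_pow a).comp (measurable_const.sub measurable_id)).mul
        (continuous_wt_rpow (-s)).measurable).aestronglyMeasurable
    · filter_upwards [hae] with y hy
      rw [Real.norm_of_nonneg (mul_nonneg (by positivity) (wt_rpow_pos _ _).le)]
      exact hy
  refine ⟨hInt, (integral_mono_ae hInt hdom hae).trans ?_⟩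
  have e1 : ∫ y : E3, profile a s ‖‖x‖⁻¹ • (x - y)‖ = ‖x‖ ^ 3 * ∫ z : E3, profile a s ‖z‖ := by
    rw [integral_sub_left_eq_self (fun y : E3 => profile a s ‖‖x‖⁻¹ • y‖) volume x,
      Measure.integral_comp_inv_smul volume (fun y : E3 => profile a s ‖y‖)]
    simp
  have e2 : ∫ y : E3, profile s a ‖‖x‖⁻¹ • y‖ = ‖x‖ ^ 3 * ∫ z : E3, profile s a ‖z‖ := by
    rw [Measure.integral_comp_inv_smul volume (fun y : E3 => profile s a ‖y‖)]
    simp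
  simp only [Pi.add_apply]
  rw [integral_const_mul, integral_add hi1 hi2, e1, e2, ← mul_add, ← mul_assoc]
  have e3 : ‖x‖ ^ (-(a : ℝ) - s) * ‖x‖ ^ 3 = ‖x‖ ^ (3 - (a : ℝ) - s) := by
    rw [← Real.rpow_natCast, ← Real.rpow_add hR]; congr 1; push_cast; ring
  rw [e3, mul_comm]
  refine mul_le_mul_of_nonneg_right ?_ (by positivity)
  have h1 := hF0 1
  have h2 := hF0 2
  change F a ≤ _
  obtain rfl | rfl : a = 1 ∨ a = 2 := by omega
  · linarith
  · linarith

end VacuumData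

namespace VacuumData

/-! ### Convolution with weakly singular kernels -/

/-- The convolution of `k` and `f`. -/
def conv (k f : E3 → ℝ) (x : E3) : ℝ := ∫ z, k z * f (x - z)

/-- `k` is measurable and bounded by a multiple of `‖z‖ ^ (-a)`. -/
structure IsKernel (a : ℕ) (C : ℝ) (k : E3 → ℝ) : Prop where
  meas : Measurable k
  bound : ∀ z, |k z| ≤ C * (‖z‖ ^ a)⁻¹
  nonneg : 0 ≤ C

/-- `f` is continuous and bounded by a multiple of `wt ^ (-s)`. -/
structure Decays (s M : ℝ) (f : E3 → ℝ) : Prop where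
  cont : Continuous f
  bound : ∀ x, |f x| ≤ M * wt x ^ (-s)

variable {a : ℕ} {C s M q : ℝ} {k f : E3 → ℝ}

lemma Decays.nonneg (hf : Decays s M f) : 0 ≤ M := by
  have h := (abs_nonneg _).trans (hf.bound 0)
  exact nonneg_of_mul_nonneg_left h (wt_rpow_pos _ _)

lemma Decays.mono {t : ℝ} (hf : Decays s M f) (h : t ≤ s) : Decays t M f :=
  ⟨hf.cont, fun x => (hf.bound x).trans
    (mul_le_mul_of_nonneg_left (wt_rpow_le (by linarith) x) hf.nonneg)⟩

lemma Decays.integrable (hf : Decays s M f) (hs : 3 < s) : Integrable f :=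
  ((integrable_wt_rpow hs).const_mul M).mono' hf.cont.aestronglyMeasurable
    (Eventually.of_forall fun x => by simpa using hf.bound x)

lemma Decays.abs_integral_le (hf : Decays s M f) (hs : 3 < s) :
    |∫ x, f x| ≤ M * ∫ x : E3, wt x ^ (-s) := by
  rw [← integral_const_mul]
  exact norm_integral_le_of_norm_le (f := f) ((integrable_wt_rpow hs).const_mul M)
    (Eventually.of_forall fun x => by simpa using hf.bound x)

lemma abs_kernel_mul_le (hk : IsKernel a C k) (hf : Decays s M f) (x z : E3) :
    |k z * f (x - z)| ≤ C * M * ((‖z‖ ^ a)⁻¹ * wt (x - z) ^ (-s)) := by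
  rw [abs_mul]
  calc _ ≤ (C * (‖z‖ ^ a)⁻¹) * (M * wt (x - z) ^ (-s)) := by
        gcongr
        · exact mul_nonneg hk.nonneg (by positivity)
        · exact hk.bound z
        · exact hf.bound _
    _ = _ := by ring

lemma measurable_kernel_mul (hk : IsKernel a C k) (hf : Continuous f) (x : E3) :
    AEStronglyMeasurable fun z => k z * f (x - z) :=
  (hk.meas.mul (hf.comp (continuous_const.sub continuous_id)).measurable).aestronglyMeasurable

lemma integrable_kernel_mul (hk : IsKernel a C k) (ha0 : 0 < a) (ha : a ≤ 2) (hf : Decays s M f)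
    (hs : 3 < s) (x : E3) : Integrable fun z => k z * f (x - z) :=
  ((integrable_inv_pow_mul_wt ha0 ha hs x).const_mul (C * M)).mono'
    (measurable_kernel_mul hk hf.cont x)
    (Eventually.of_forall fun z => abs_kernel_mul_le hk hf x z)

lemma abs_conv_le {D : ℝ}
    (hD : ∀ a : ℕ, 0 < a → a ≤ 2 → ∀ x : E3, ∫ z : E3, (‖z‖ ^ a)⁻¹ * wt (x - z) ^ (-s) ≤ D)
    (hk : IsKernel a C k) (ha0 : 0 < a) (ha : a ≤ 2) (hf : Decays s M f)
    (hs : 3 < s) (x : E3) : |conv k f x| ≤ C * M * D := by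
  have h := norm_integral_le_of_norm_le (f := fun z => k z * f (x - z)) 
    ((integrable_inv_pow_mul_wt ha0 ha hs x).const_mul (C * M))
    (Eventually.of_forall fun z => abs_kernel_mul_le hk hf x z)
  rw [integral_const_mul] at h
  exact h.trans (mul_le_mul_of_nonneg_left (hD a ha0 ha x) (mul_nonneg hk.nonneg hf.nonneg))

lemma wt_neg (x : E3) : wt (-x) = wt x := by simp [wt]

lemma wt_sub_rpow_le_of_mem_ball (hs : 0 ≤ s) {x₀ x : E3} (hx : x ∈ ball x₀ 1) (z : E3) :
    wt (x - z) ^ (-s) ≤ (8 * wt x₀) ^ s * wt (0 - z) ^ (-s) := by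
  have h1 : wt x ≤ 4 * wt x₀ := by
    have := wt_le_mul x₀ x
    have h2 : wt (x₀ - x) ≤ 2 := wt_le_two (by
      rw [← dist_eq_norm, dist_comm]; exact (mem_ball.1 hx).le)
    nlinarith [wt_pos x₀]
  refine (wt_sub_rpow_le hs x z).trans ?_
  rw [zero_sub, wt_neg]
  refine mul_le_mul_of_nonneg_right ?_ (wt_rpow_pos _ _).le
  exact Real.rpow_le_rpow (by have := wt_pos x; positivity) (by linarith) hs

lemma continuous_conv (hk : IsKernel a C k) (ha0 : 0 < a) (ha : a ≤ 2) (hf : Decays s M f)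
    (hs : 3 < s) : Continuous (conv k f) := by
  rw [continuous_iff_continuousAt]
  intro x₀
  refine continuousAt_of_dominated
    (bound := fun z => C * M * (8 * wt x₀) ^ s * ((‖z‖ ^ a)⁻¹ * wt (0 - z) ^ (-s)))
    (Eventually.of_forall fun x => measurable_kernel_mul hk hf.cont x) ?_
    ((integrable_inv_pow_mul_wt ha0 ha hs 0).const_mul _) ?_
  · filter_upwards [ball_mem_nhds x₀ one_pos] with x hx
    refine Eventually.of_forall fun z => (abs_kernel_mul_le hk hf x z).trans ?_
    have h := wt_sub_rpow_le_of_mem_ball (s := s) (by linarith) hx z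
    have hCM := mul_nonneg hk.nonneg hf.nonneg
    calc _ ≤ C * M * ((‖z‖ ^ a)⁻¹ * ((8 * wt x₀) ^ s * wt (0 - z) ^ (-s))) := by gcongr
      _ = _ := by ring
  · refine Eventually.of_forall fun z => ?_
    exact (continuous_const.mul (hf.cont.comp (continuous_id.sub continuous_const))).continuousAt

lemma hasFDerivAt_conv (hk : IsKernel a C k) (ha0 : 0 < a) (ha : a ≤ 2) (hf : Decays s M f)
    (hs : 3 < s) (hf1 : ContDiff ℝ 1 f) (hd : ∀ i, Decays s M (pd f i)) (x₀ : E3) :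
    HasFDerivAt (conv k f) (∫ z, k z • fderiv ℝ f (x₀ - z)) x₀ ∧
      Integrable fun z => k z • fderiv ℝ f (x₀ - z) := by
  have hfd : Continuous (fderiv ℝ f) := hf1.continuous_fderiv (by norm_num)
  have hM := hf.nonneg
  have hb : ∀ x ∈ ball x₀ 1, ∀ z, ‖k z • fderiv ℝ f (x - z)‖ ≤
      C * (3 * M) * (8 * wt x₀) ^ s * ((‖z‖ ^ a)⁻¹ * wt (0 - z) ^ (-s)) := by
    intro x hx z
    have h := wt_sub_rpow_le_of_mem_ball (s := s) (by linarith) hx z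
    have h2 := norm_fderiv_le_of_pd (f := f) (x := x - z) fun i => (hd i).bound (x - z)
    rw [norm_smul]
    calc _ ≤ (C * (‖z‖ ^ a)⁻¹) * (3 * (M * ((8 * wt x₀) ^ s * wt (0 - z) ^ (-s)))) := by
          gcongr
          · exact mul_nonneg hk.nonneg (by positivity)
          · exact hk.bound z
          · exact h2.trans (by gcongr)
      _ = _ := by ring
  have hmeas : AEStronglyMeasurable fun z => k z • fderiv ℝ f (x₀ - z) :=
    hk.meas.aestronglyMeasurable.smul
      (hfd.comp (continuous_const.sub continuous_id)).aestronglyMeasurable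
  have hbi := (integrable_inv_pow_mul_wt ha0 ha hs 0).const_mul (C * (3 * M) * (8 * wt x₀) ^ s)
  refine ⟨hasFDerivAt_integral_of_dominated_of_fderiv_le
    (F := fun x z => k z * f (x - z)) (F' := fun x z => k z • fderiv ℝ f (x - z))
    (ball_mem_nhds x₀ one_pos)
    (Eventually.of_forall fun x => measurable_kernel_mul hk hf.cont x)
    (integrable_kernel_mul hk ha0 ha hf hs x₀) hmeas
    (Eventually.of_forall fun z x hx => hb x hx z) hbi
    (Eventually.of_forall fun z x _ => ?_),
    hbi.mono' hmeas (Eventually.of_forall fun z => hb x₀ (mem_ball_self one_pos) z)⟩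
  have h1 : HasFDerivAt f (fderiv ℝ f (x - z)) (x - z) :=
    (hf1.differentiable (by norm_num) _).hasFDerivAt
  have h2 : HasFDerivAt (fun x => f (x - z)) (fderiv ℝ f (x - z)) x := by
    have := h1.comp x ((hasFDerivAt_id x).sub_const z)
    rwa [ContinuousLinearMap.comp_id] at this
  exact h2.const_mul (k z)

lemma pd_conv (hk : IsKernel a C k) (ha0 : 0 < a) (ha : a ≤ 2) (hf : Decays s M f)
    (hs : 3 < s) (hf1 : ContDiff ℝ 1 f) (hd : ∀ i, Decays s M (pd f i)) (i : Fin 3) :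
    pd (conv k f) i = conv k (pd f i) := by
  ext x
  have h := hasFDerivAt_conv hk ha0 ha hf hs hf1 hd x
  rw [pd, h.1.fderiv, ContinuousLinearMap.integral_apply h.2]
  rfl

lemma contDiff_conv (hk : IsKernel a C k) (ha0 : 0 < a) (ha : a ≤ 2) (hf : Decays s M f)
    (hs : 3 < s) (hf1 : ContDiff ℝ 1 f) (hd : ∀ i, Decays s M (pd f i)) :
    ContDiff ℝ 1 (conv k f) := by
  refine contDiff_succ_of_pd (n := 0)
    (fun x => (hasFDerivAt_conv hk ha0 ha hf hs hf1 hd x).1.differentiableAt) fun i => ?_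
  rw [pd_conv hk ha0 ha hf hs hf1 hd]
  exact contDiff_zero.2 (continuous_conv hk ha0 ha (hd i) hs)

lemma conv_eq_integral (k f : E3 → ℝ) (x : E3) : conv k f x = ∫ y, k (x - y) * f y := by
  rw [conv, ← integral_sub_left_eq_self (fun z => k z * f (x - z)) volume x]
  simp

/-! ### Moving a derivative onto the kernel -/

/-- A regularised cutoff that vanishes to fourth order at the origin. -/
def originCutoff (ε : ℝ) (z : E3) : ℝ := (‖z‖ ^ 2 / (‖z‖ ^ 2 + ε)) ^ 2

lemma originCutoff_le_one {ε : ℝ} (hε : 0 < ε) (z : E3) : originCutoff ε z ≤ 1 := by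
  unfold originCutoff
  refine pow_le_one₀ (by positivity) ?_
  rw [div_le_one (by positivity)]; linarith

lemma originCutoff_nonneg (ε : ℝ) (z : E3) : 0 ≤ originCutoff ε z := sq_nonneg _

lemma pd_norm_sq (l : Fin 3) (z : E3) : pd (fun y => ‖y‖ ^ 2) l z = 2 * z l := by
  simp only [pd]
  rw [(hasStrictFDerivAt_norm_sq z).hasFDerivAt.fderiv]
  simp [EuclideanSpace.inner_single_right]

lemma contDiff_originCutoff {ε : ℝ} (hε : 0 < ε) : ContDiff ℝ 1 (originCutoff ε) := by
  unfold originCutoff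
  exact ((contDiff_norm_sq ℝ).div ((contDiff_norm_sq ℝ).add contDiff_const)
    fun z => by positivity).pow 2

lemma pd_originCutoff {ε : ℝ} (hε : 0 < ε) (l : Fin 3) (z : E3) :
    pd (originCutoff ε) l z = 4 * ε * ‖z‖ ^ 2 * z l / (‖z‖ ^ 2 + ε) ^ 3 := by
  have h0 : ‖z‖ ^ 2 + ε ≠ 0 := by positivity
  have h1 : HasDerivAt (fun t : ℝ => (t / (t + ε)) ^ 2)
      (2 * (‖z‖ ^ 2 / (‖z‖ ^ 2 + ε)) * (ε / (‖z‖ ^ 2 + ε) ^ 2)) (‖z‖ ^ 2) := by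
    have := (((hasDerivAt_id (‖z‖ ^ 2)).div ((hasDerivAt_id (‖z‖ ^ 2)).add_const ε) h0).pow 2)
    refine this.congr_deriv ?_
    simp only [id, Nat.cast_ofNat, Pi.div_apply]
    ring
  have hd : DifferentiableAt ℝ (fun y : E3 => ‖y‖ ^ 2) z :=
    ((contDiff_norm_sq ℝ (n := 1)).differentiable (by norm_num)) z
  have := pd_comp h1 hd l
  rw [pd_norm_sq] at this
  unfold originCutoff
  rw [this]; field_simp; ring

lemma abs_pd_originCutoff_le {ε : ℝ} (hε : 0 < ε) (l : Fin 3) (z : E3) :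
    |pd (originCutoff ε) l z| ≤ 4 * (‖z‖ ^ 1)⁻¹ := by
  rcases eq_or_ne z 0 with rfl | hz
  · simp [pd_originCutoff hε]
  have hz0 : 0 < ‖z‖ := norm_pos_iff.2 hz
  rw [pd_originCutoff hε, abs_div, abs_mul, abs_of_nonneg (by positivity : 0 ≤ 4 * ε * ‖z‖ ^ 2),
    abs_of_pos (by positivity : 0 < (‖z‖ ^ 2 + ε) ^ 3), div_le_iff₀ (by positivity), pow_one]
  have hc := abs_coord_le z l
  calc 4 * ε * ‖z‖ ^ 2 * |z l| ≤ 4 * ε * ‖z‖ ^ 2 * ‖z‖ := by gcongr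
    _ = 4 * ‖z‖⁻¹ * (ε * (‖z‖ ^ 2) ^ 2) := by field_simp
    _ ≤ 4 * ‖z‖⁻¹ * (‖z‖ ^ 2 + ε) ^ 3 := by
        gcongr
        have h2 : 0 < ‖z‖ ^ 2 := by positivity
        nlinarith [mul_pos h2 hε, mul_pos (mul_pos h2 hε) hε, mul_pos (mul_pos h2 hε) h2,
          pow_pos hε 3, pow_pos h2 3]

lemma tendsto_originCutoff {z : E3} (hz : z ≠ 0) :
    Tendsto (fun ε => originCutoff ε z) (𝓝[>] 0) (𝓝 1) := by
  have hz0 : 0 < ‖z‖ := norm_pos_iff.2 hz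
  have h : ContinuousAt (fun ε => originCutoff ε z) 0 := by
    unfold originCutoff
    refine (ContinuousAt.div continuousAt_const (by fun_prop) ?_).pow 2
    positivity
  have h0 : originCutoff 0 z = 1 := by
    rw [originCutoff, add_zero, div_self (by positivity), one_pow]
  have := h.tendsto.mono_left (nhdsWithin_le_nhds (s := Ioi 0))
  rwa [h0] at this

lemma tendsto_pd_originCutoff (l : Fin 3) {z : E3} (hz : z ≠ 0) :
    Tendsto (fun ε => pd (originCutoff ε) l z) (𝓝[>] 0) (𝓝 0) := by
  have hz0 : 0 < ‖z‖ := norm_pos_iff.2 hz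
  have h : ContinuousAt (fun ε => 4 * ε * ‖z‖ ^ 2 * z l / (‖z‖ ^ 2 + ε) ^ 3) 0 := by
    refine ContinuousAt.div (by fun_prop) (by fun_prop) ?_
    positivity
  have := h.tendsto.mono_left (nhdsWithin_le_nhds (s := Ioi 0))
  simp only [mul_zero, zero_mul, zero_div] at this
  refine this.congr' ?_
  filter_upwards [self_mem_nhdsWithin] with ε hε
  rw [pd_originCutoff hε]

/-- Integration by parts against a kernel of degree `-1`. -/
lemma conv_pd_eq {H H' : E3 → ℝ} {l : Fin 3} (hH : IsKernel 1 C H) (hH' : IsKernel 2 C H')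
    (hd : ∀ z, z ≠ 0 → DifferentiableAt ℝ H z) (hpd : ∀ z, z ≠ 0 → pd H l z = H' z)
    (hf : Decays s M f) (hs : 3 < s) (hf1 : ContDiff ℝ 1 f) (hdf : Decays s M (pd f l)) (x : E3) :
    conv H (pd f l) x = conv H' f x := by
  set F : E3 → ℝ := fun z => f (x - z) with hF
  have hFd : ∀ z, pd F l z = - pd f l (x - z) := by
    intro z
    have h1 : HasFDerivAt f (fderiv ℝ f (x - z)) (x - z) :=
      (hf1.differentiable (by norm_num) _).hasFDerivAt
    have h2 : HasFDerivAt F (-(fderiv ℝ f (x - z))) z := by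
      have := h1.comp z ((hasFDerivAt_id z).const_sub x)
      refine this.congr_fderiv ?_
      ext y; simp
    simp [pd, h2.fderiv]
  have hFdiff : Differentiable ℝ F :=
    (hf1.differentiable (by norm_num)).comp (differentiable_id.const_sub x)
  have hcut : ∀ ε : ℝ, 0 < ε → Differentiable ℝ fun z => H z * originCutoff ε z := by
    intro ε hε z
    rcases eq_or_ne z 0 with rfl | hz
    · refine (Asymptotics.IsBigO.hasFDerivAt (n := 3) (𝕜 := ℝ) ?_ (by norm_num)).differentiableAt
      refine Asymptotics.IsBigO.of_bound (C / ε ^ 2) (Eventually.of_forall fun z => ?_)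
      rcases eq_or_ne z 0 with rfl | hz
      · simp [originCutoff]
      have hz0 : 0 < ‖z‖ := norm_pos_iff.2 hz
      have hb := hH.bound z
      have hC := hH.nonneg
      rw [sub_zero, norm_mul, Real.norm_eq_abs, Real.norm_of_nonneg (originCutoff_nonneg _ _),
        Real.norm_of_nonneg (by positivity)]
      have h1 : originCutoff ε z ≤ ‖z‖ ^ 4 / ε ^ 2 := by
        rw [originCutoff, div_pow]
        calc _ ≤ (‖z‖ ^ 2) ^ 2 / ε ^ 2 := by gcongr; nlinarith
          _ = _ := by ring
      calc _ ≤ C * (‖z‖ ^ 1)⁻¹ * (‖z‖ ^ 4 / ε ^ 2) :=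
            mul_le_mul hb h1 (originCutoff_nonneg _ _) (by positivity)
        _ = _ := by field_simp
    · exact (hd z hz).mul ((contDiff_originCutoff hε).differentiable (by norm_num) z)
  have hcutK : ∀ ε : ℝ, 0 < ε → IsKernel 1 C fun z => H z * originCutoff ε z := fun ε hε =>
    ⟨hH.meas.mul (contDiff_originCutoff hε).continuous.measurable, fun z => by
      rw [abs_mul, abs_of_nonneg (originCutoff_nonneg _ _)]
      exact (mul_le_of_le_one_right (abs_nonneg _) (originCutoff_le_one hε z)).trans (hH.bound z),
      hH.nonneg⟩
  have hpdcut : ∀ ε : ℝ, 0 < ε → ∀ z, z ≠ 0 → pd (fun z => H z * originCutoff ε z) l z =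
      H' z * originCutoff ε z + H z * pd (originCutoff ε) l z := by
    intro ε hε z hz
    rw [pd_mul (hd z hz) ((contDiff_originCutoff hε).differentiable (by norm_num) z), hpd z hz]
  have hk2 : ∀ ε : ℝ, 0 < ε → IsKernel 2 (5 * C) fun z =>
      H' z * originCutoff ε z + H z * pd (originCutoff ε) l z := fun ε hε => by
    have hC := hH.nonneg
    refine ⟨(hH'.meas.mul (contDiff_originCutoff hε).continuous.measurable).add
      (hH.meas.mul (continuous_pd (contDiff_originCutoff hε) l).measurable), fun z => ?_,
      by positivity⟩
    refine (abs_add_le _ _).trans ?_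
    rw [abs_mul, abs_mul, abs_of_nonneg (originCutoff_nonneg _ _)]
    have h1 := (mul_le_of_le_one_right (abs_nonneg _) (originCutoff_le_one hε z)).trans
      (hH'.bound z)
    have h2 : |H z| * |pd (originCutoff ε) l z| ≤ C * (‖z‖ ^ 1)⁻¹ * (4 * (‖z‖ ^ 1)⁻¹) :=
      mul_le_mul (hH.bound z) (abs_pd_originCutoff_le hε l z) (abs_nonneg _) (by positivity)
    have h3 : (‖z‖ ^ 1)⁻¹ * (‖z‖ ^ 1)⁻¹ = (‖z‖ ^ 2)⁻¹ := by rw [← mul_inv]; ring_nf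
    nlinarith
  have hne : ∀ᵐ z : E3, z ≠ 0 := by simp [ae_iff]
  have hparts : ∀ ε : ℝ, 0 < ε →
      conv (fun z => H z * originCutoff ε z) (pd f l) x =
      conv (fun z => H' z * originCutoff ε z + H z * pd (originCutoff ε) l z) f x := by
    intro ε hε
    have hi1 : Integrable fun z => (H z * originCutoff ε z) * pd f l (x - z) :=
      integrable_kernel_mul (hcutK ε hε) one_pos (by norm_num) hdf hs x
    have hi2 := integrable_kernel_mul (hk2 ε hε) two_pos le_rfl hf hs x
    have hi3 : Integrable fun z => (H z * originCutoff ε z) * F z :=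
      integrable_kernel_mul (hcutK ε hε) one_pos (by norm_num) hf hs x
    have hae : (fun z => pd (fun z => H z * originCutoff ε z) l z * F z) =ᵐ[volume]
        fun z => (H' z * originCutoff ε z + H z * pd (originCutoff ε) l z) * f (x - z) := by
      filter_upwards [hne] with z hz
      rw [hpdcut ε hε z hz]
    have hibp := integral_mul_fderiv_eq_neg_fderiv_mul_of_integrable (μ := (volume : Measure E3))
      (f := fun z => H z * originCutoff ε z) (g := F) (v := EuclideanSpace.single l 1)
      (hi2.congr hae.symm) (by
        refine hi1.neg.congr (Eventually.of_forall fun z => ?_)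
        change -(_ * _) = _ * pd F l z
        rw [hFd]; ring) hi3 (fun z _ => hcut ε hε z) (fun z _ => hFdiff z)
    change (∫ z, _ * pd F l z) = -∫ z, pd (fun z => H z * originCutoff ε z) l z * F z at hibp
    rw [integral_congr_ae hae] at hibp
    simp only [hFd, mul_neg, integral_neg, neg_inj] at hibp
    exact hibp
  have hlim1 : Tendsto (fun ε => conv (fun z => H z * originCutoff ε z) (pd f l) x) (𝓝[>] 0)
      (𝓝 (conv H (pd f l) x)) := by
    refine tendsto_integral_filter_of_dominated_convergence
      (fun z => C * M * ((‖z‖ ^ 1)⁻¹ * wt (x - z) ^ (-s))) ?_ ?_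
      ((integrable_inv_pow_mul_wt one_pos (by norm_num) hs x).const_mul _) ?_
    · filter_upwards [self_mem_nhdsWithin] with ε hε
      exact measurable_kernel_mul (hcutK ε hε) hdf.cont x
    · filter_upwards [self_mem_nhdsWithin] with ε hε
      exact Eventually.of_forall fun z => abs_kernel_mul_le (hcutK ε hε) hdf x z
    · filter_upwards [hne] with z hz
      simpa using ((tendsto_originCutoff hz).const_mul (H z)).mul_const (pd f l (x - z))
  have hlim2 : Tendsto (fun ε =>
      conv (fun z => H' z * originCutoff ε z + H z * pd (originCutoff ε) l z) f x) (𝓝[>] 0)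
      (𝓝 (conv H' f x)) := by
    refine tendsto_integral_filter_of_dominated_convergence
      (fun z => (5 * C) * M * ((‖z‖ ^ 2)⁻¹ * wt (x - z) ^ (-s))) ?_ ?_
      ((integrable_inv_pow_mul_wt two_pos le_rfl hs x).const_mul _) ?_
    · filter_upwards [self_mem_nhdsWithin] with ε hε
      exact measurable_kernel_mul (hk2 ε hε) hf.cont x
    · filter_upwards [self_mem_nhdsWithin] with ε hε
      exact Eventually.of_forall fun z => abs_kernel_mul_le (hk2 ε hε) hf x z
    · filter_upwards [hne] with z hz
      simpa using (((tendsto_originCutoff hz).const_mul (H' z)).add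
        ((tendsto_pd_originCutoff l hz).const_mul (H z))).mul_const (f (x - z))
  refine tendsto_nhds_unique (hlim1.congr' ?_) hlim2
  filter_upwards [self_mem_nhdsWithin] with ε hε using hparts ε hε

end VacuumData

namespace VacuumData

variable {a : ℕ} {C s M q : ℝ} {k f : E3 → ℝ}

/-! ### Asymptotics of convolutions -/

/-- A bounded function, Lipschitz at the scale of the distance to the origin. -/
structure IsDirectional (L : ℝ) (m : E3 → ℝ) : Prop where
  meas : Measurable m
  bound : ∀ z, |m z| ≤ 1
  lip : ∀ a b, a ≠ 0 → b ≠ 0 → |m a - m b| ≤ L * ‖a - b‖ / ‖b‖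

lemma isDirectional_one : IsDirectional 0 fun _ => 1 :=
  ⟨measurable_const, by simp, by simp⟩

lemma isDirectional_coord (i : Fin 3) : IsDirectional 2 fun z : E3 => z i / ‖z‖ := by
  refine ⟨by fun_prop, fun z => ?_, fun a b ha hb => ?_⟩
  · rw [abs_div, abs_norm]
    exact div_le_one_of_le₀ (abs_coord_le z i) (norm_nonneg z)
  · have ha0 : 0 < ‖a‖ := norm_pos_iff.2 ha
    have hb0 : 0 < ‖b‖ := norm_pos_iff.2 hb
    have e1 : a i / ‖a‖ - b i / ‖b‖ = (a i / ‖a‖ * (‖b‖ - ‖a‖) + (a - b) i) / ‖b‖ := by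
      simp only [PiLp.sub_apply]; field_simp; ring
    rw [e1, abs_div, abs_norm]
    gcongr
    have h1 : |a i / ‖a‖| ≤ 1 := by
      rw [abs_div, abs_norm]; exact div_le_one_of_le₀ (abs_coord_le a i) ha0.le
    have h2 : |‖b‖ - ‖a‖| ≤ ‖a - b‖ := by rw [norm_sub_rev]; exact abs_norm_sub_norm_le b a
    calc _ ≤ |a i / ‖a‖| * |‖b‖ - ‖a‖| + |(a - b) i| := by
          rw [← abs_mul]; exact abs_add_le _ _
      _ ≤ 1 * ‖a - b‖ + ‖a - b‖ := by gcongr; exact abs_coord_le _ _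
      _ = _ := by ring

lemma IsDirectional.mul {L₁ L₂ : ℝ} {m₁ m₂ : E3 → ℝ} (h₁ : IsDirectional L₁ m₁)
    (h₂ : IsDirectional L₂ m₂) : IsDirectional (L₁ + L₂) fun z => m₁ z * m₂ z := by
  refine ⟨h₁.meas.mul h₂.meas, fun z => ?_, fun a b ha hb => ?_⟩
  · rw [abs_mul]; exact mul_le_one₀ (h₁.bound z) (abs_nonneg _) (h₂.bound z)
  · have e : m₁ a * m₂ a - m₁ b * m₂ b = (m₁ a - m₁ b) * m₂ a + m₁ b * (m₂ a - m₂ b) := by ring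
    rw [e]
    have hb1 := h₁.lip a b ha hb
    have hb2 := h₂.lip a b ha hb
    refine (abs_add_le _ _).trans ?_
    rw [abs_mul, abs_mul]
    have := mul_le_of_le_one_right (abs_nonneg (m₁ a - m₁ b)) (h₂.bound a)
    have := mul_le_of_le_one_left (abs_nonneg (m₂ a - m₂ b)) (h₁.bound b)
    rw [add_mul, add_div]
    linarith

lemma IsDirectional.isKernel {L : ℝ} {m : E3 → ℝ} (h : IsDirectional L m) (a : ℕ) :
    IsKernel a 1 fun z => m z * (‖z‖ ^ a)⁻¹ := by
  refine ⟨h.meas.mul (measurable_inv_pow a), fun z => ?_, zero_le_one⟩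
  rw [abs_mul, abs_of_nonneg (by positivity : 0 ≤ (‖z‖ ^ a)⁻¹)]
  exact mul_le_mul_of_nonneg_right (h.bound z) (by positivity)

lemma abs_inv_norm_sub_le {a b : E3} (ha : a ≠ 0) (hb : b ≠ 0) :
    |‖a‖⁻¹ - ‖b‖⁻¹| ≤ ‖a - b‖ * (‖a‖⁻¹ * ‖b‖⁻¹) := by
  have ha0 : 0 < ‖a‖ := norm_pos_iff.2 ha
  have hb0 : 0 < ‖b‖ := norm_pos_iff.2 hb
  have e : ‖a‖⁻¹ - ‖b‖⁻¹ = (‖b‖ - ‖a‖) * (‖a‖⁻¹ * ‖b‖⁻¹) := by field_simp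
  rw [e, abs_mul, abs_of_pos (by positivity : 0 < ‖a‖⁻¹ * ‖b‖⁻¹)]
  gcongr
  rw [norm_sub_rev]; exact abs_norm_sub_norm_le b a

lemma IsDirectional.abs_sub_le {L : ℝ} {m : E3 → ℝ} (h : IsDirectional L m) {a b : E3}
    (ha : a ≠ 0) (hb : b ≠ 0) : |m a * (‖a‖ ^ 2)⁻¹ - m b * (‖b‖ ^ 2)⁻¹| ≤
      ‖a - b‖ * ((L + 1) * (‖b‖⁻¹ * (‖a‖ ^ 2)⁻¹) + (‖b‖ ^ 2)⁻¹ * (‖a‖ ^ 1)⁻¹) := by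
  have ha0 : 0 < ‖a‖⁻¹ := inv_pos.2 (norm_pos_iff.2 ha)
  have hb0 : 0 < ‖b‖⁻¹ := inv_pos.2 (norm_pos_iff.2 hb)
  have h1 := abs_inv_norm_sub_le ha hb
  have h2 := h.lip a b ha hb
  have h3 := h.bound b
  simp only [← inv_pow, pow_one]
  rw [div_eq_mul_inv] at h2
  set u := ‖a‖⁻¹
  set v := ‖b‖⁻¹
  have e : m a * u ^ 2 - m b * v ^ 2 = (m a - m b) * u ^ 2 + m b * ((u - v) * (u + v)) := by ring
  rw [e]
  calc _ ≤ |m a - m b| * u ^ 2 + |m b| * (|u - v| * (u + v)) := by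
        refine (abs_add_le _ _).trans ?_
        rw [abs_mul, abs_mul, abs_mul, abs_of_nonneg (sq_nonneg u),
          abs_of_pos (add_pos ha0 hb0)]
    _ ≤ L * ‖a - b‖ * v * u ^ 2 + 1 * (‖a - b‖ * (u * v) * (u + v)) := by gcongr
    _ = _ := by ring

lemma integral_kernel_sub (hk : IsKernel a C k) (ha0 : 0 < a) (ha : a ≤ 2) (hf : Decays s M f)
    (hs : 3 < s) (x : E3) :
    conv k f x - k x * ∫ y, f y = ∫ y, (k (x - y) - k x) * f y := by
  have h1 : Integrable fun y => k (x - y) * f y := by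
    simpa using (integrable_kernel_mul hk ha0 ha hf hs x).comp_sub_left x
  have h2 : Integrable fun y => k x * f y := (hf.integrable hs).const_mul _
  rw [conv_eq_integral, ← integral_const_mul, ← integral_sub h1 h2]
  simp only [sub_mul]

lemma Decays.norm_mul_le (hf : Decays (3 + q) M f) (y : E3) :
    ‖y‖ * |f y| ≤ M * wt y ^ (-(2 + q)) := by
  have hM := hf.nonneg
  calc ‖y‖ * |f y| ≤ wt y * (M * wt y ^ (-(3 + q))) := by
        gcongr
        · exact (wt_pos y).le
        · exact norm_le_wt y
        · exact hf.bound y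
    _ = M * (wt y ^ (1 : ℝ) * wt y ^ (-(3 + q))) := by rw [Real.rpow_one]; ring
    _ = _ := by rw [← Real.rpow_add (wt_pos y)]; ring_nf

variable {D : ℝ}

lemma abs_conv_sub_le_two
    (hD : ∀ a : ℕ, 0 < a → a ≤ 2 → ∀ x : E3, x ≠ 0 →
      Integrable (fun y : E3 => (‖x - y‖ ^ a)⁻¹ * wt y ^ (-(2 + q))) ∧
      ∫ y : E3, (‖x - y‖ ^ a)⁻¹ * wt y ^ (-(2 + q)) ≤ D * ‖x‖ ^ (3 - (a : ℝ) - (2 + q)))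
    (hq : 0 < q) {L : ℝ} (hL : 0 ≤ L) {m : E3 → ℝ} (hm : IsDirectional L m)
    (hf : Decays (3 + q) M f) {x : E3} (hx : x ≠ 0) :
    |conv (fun z => m z * (‖z‖ ^ 2)⁻¹) f x - m x * (‖x‖ ^ 2)⁻¹ * ∫ y, f y| ≤
      (L + 2) * M * D * ‖x‖ ^ (-2 - q) := by
  have hM := hf.nonneg
  have hx0 : 0 < ‖x‖ := norm_pos_iff.2 hx
  rw [integral_kernel_sub (hm.isKernel 2) two_pos le_rfl hf (by linarith)]
  obtain ⟨i1, b1⟩ := hD 1 one_pos (by norm_num) x hx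
  obtain ⟨i2, b2⟩ := hD 2 two_pos le_rfl x hx
  have hb := norm_integral_le_of_norm_le (μ := (volume : Measure E3))
    (f := fun y => (m (x - y) * (‖x - y‖ ^ 2)⁻¹ - m x * (‖x‖ ^ 2)⁻¹) * f y)
    (((i2.const_mul ((L + 1) * ‖x‖⁻¹)).add (i1.const_mul (‖x‖ ^ 2)⁻¹)).const_mul M) (by
      have : ∀ᵐ y : E3, y ≠ x := by simp [ae_iff]
      filter_upwards [this] with y hy
      have hxy : x - y ≠ 0 := sub_ne_zero.2 hy.symm
      have h := hm.abs_sub_le hxy hx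
      rw [show x - y - x = -y by abel, norm_neg] at h
      rw [norm_mul, Real.norm_eq_abs, Real.norm_eq_abs]
      have h2 := hf.norm_mul_le y
      set P := (L + 1) * (‖x‖⁻¹ * (‖x - y‖ ^ 2)⁻¹) + (‖x‖ ^ 2)⁻¹ * (‖x - y‖ ^ 1)⁻¹ with hP
      have hP0 : 0 ≤ P := by positivity
      calc _ ≤ (‖y‖ * P) * |f y| := by gcongr
        _ = (‖y‖ * |f y|) * P := by ring
        _ ≤ (M * wt y ^ (-(2 + q))) * P := by gcongr
        _ = _ := by simp only [hP, Pi.add_apply]; ring)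
  refine hb.trans ?_
  simp only [Pi.add_apply]
  rw [integral_const_mul, integral_add (i2.const_mul _) (i1.const_mul _), integral_const_mul,
    integral_const_mul]
  have e1 : (‖x‖ ^ 2)⁻¹ * ‖x‖ ^ (3 - ((1 : ℕ) : ℝ) - (2 + q)) = ‖x‖ ^ (-2 - q) := by
    rw [inv_pow_eq_rpow 2 _ hx0.le, ← Real.rpow_add hx0]; push_cast; ring_nf
  have e2 : ‖x‖⁻¹ * ‖x‖ ^ (3 - ((2 : ℕ) : ℝ) - (2 + q)) = ‖x‖ ^ (-2 - q) := by
    rw [← Real.rpow_neg_one, ← Real.rpow_add hx0]; push_cast; ring_nf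
  calc _ ≤ M * ((L + 1) * ‖x‖⁻¹ * (D * ‖x‖ ^ (3 - ((2 : ℕ) : ℝ) - (2 + q))) +
        (‖x‖ ^ 2)⁻¹ * (D * ‖x‖ ^ (3 - ((1 : ℕ) : ℝ) - (2 + q)))) := by gcongr
    _ = M * D * ((L + 1) * (‖x‖⁻¹ * ‖x‖ ^ (3 - ((2 : ℕ) : ℝ) - (2 + q))) +
        (‖x‖ ^ 2)⁻¹ * ‖x‖ ^ (3 - ((1 : ℕ) : ℝ) - (2 + q))) := by ring
    _ = _ := by rw [e1, e2]; ring

lemma abs_conv_sub_le_one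
    (hD : ∀ a : ℕ, 0 < a → a ≤ 2 → ∀ x : E3, x ≠ 0 →
      Integrable (fun y : E3 => (‖x - y‖ ^ a)⁻¹ * wt y ^ (-(2 + q))) ∧
      ∫ y : E3, (‖x - y‖ ^ a)⁻¹ * wt y ^ (-(2 + q)) ≤ D * ‖x‖ ^ (3 - (a : ℝ) - (2 + q)))
    (hq : 0 < q) (hf : Decays (3 + q) M f) {x : E3} (hx : x ≠ 0) :
    |conv (fun z => ‖z‖⁻¹) f x - ‖x‖⁻¹ * ∫ y, f y| ≤ M * D * ‖x‖ ^ (-1 - q) := by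
  have hM := hf.nonneg
  have hx0 : 0 < ‖x‖ := norm_pos_iff.2 hx
  have hker : IsKernel 1 1 fun z : E3 => ‖z‖⁻¹ := by simpa using isDirectional_one.isKernel 1
  rw [integral_kernel_sub hker one_pos (by norm_num) hf (by linarith)]
  obtain ⟨i1, b1⟩ := hD 1 one_pos (by norm_num) x hx
  have hb := norm_integral_le_of_norm_le (μ := (volume : Measure E3))
    (f := fun y => (‖x - y‖⁻¹ - ‖x‖⁻¹) * f y)
    (i1.const_mul (M * ‖x‖⁻¹)) (by
      have : ∀ᵐ y : E3, y ≠ x := by simp [ae_iff]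
      filter_upwards [this] with y hy
      have hxy : x - y ≠ 0 := sub_ne_zero.2 hy.symm
      have h := abs_inv_norm_sub_le hxy hx
      rw [show x - y - x = -y by abel, norm_neg] at h
      rw [norm_mul, Real.norm_eq_abs, Real.norm_eq_abs]
      have h2 := hf.norm_mul_le y
      calc _ ≤ (‖y‖ * (‖x - y‖⁻¹ * ‖x‖⁻¹)) * |f y| := by gcongr
        _ = (‖y‖ * |f y|) * (‖x - y‖⁻¹ * ‖x‖⁻¹) := by ring
        _ ≤ (M * wt y ^ (-(2 + q))) * (‖x - y‖⁻¹ * ‖x‖⁻¹) := by gcongr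
        _ = _ := by ring)
  refine hb.trans ?_
  rw [integral_const_mul]
  have e1 : ‖x‖⁻¹ * ‖x‖ ^ (3 - ((1 : ℕ) : ℝ) - (2 + q)) = ‖x‖ ^ (-1 - q) := by
    rw [← Real.rpow_neg_one, ← Real.rpow_add hx0]; push_cast; ring_nf
  calc _ ≤ M * ‖x‖⁻¹ * (D * ‖x‖ ^ (3 - ((1 : ℕ) : ℝ) - (2 + q))) := by gcongr
    _ = M * D * (‖x‖⁻¹ * ‖x‖ ^ (3 - ((1 : ℕ) : ℝ) - (2 + q))) := by ring
    _ = _ := by rw [e1]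

/-! ### A first moment identity -/

lemma contDiff_coord {n : WithTop ℕ∞} (i : Fin 3) : ContDiff ℝ n fun y : E3 => y i :=
  (EuclideanSpace.proj i : E3 →L[ℝ] ℝ).contDiff

lemma decays_coord_mul (hf : Decays (s + 1) M f) (i : Fin 3) :
    Decays s M fun y => y i * f y := by
  refine ⟨(contDiff_coord (n := 0) i).continuous.mul hf.cont, fun y => ?_⟩
  have hM := hf.nonneg
  rw [abs_mul]
  calc |y i| * |f y| ≤ wt y * (M * wt y ^ (-(s + 1))) := by
        gcongr
        · exact (wt_pos y).le
        · exact (abs_coord_le y i).trans (norm_le_wt y)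
        · exact hf.bound y
    _ = M * (wt y ^ (1 : ℝ) * wt y ^ (-(s + 1))) := by rw [Real.rpow_one]; ring
    _ = _ := by rw [← Real.rpow_add (wt_pos y)]; ring_nf

lemma integral_coord_mul_pd (hs : 3 < s) (hf : Decays s M f) (hf1 : ContDiff ℝ 1 f) {l : Fin 3}
    (hd : Decays (s + 1) M (pd f l)) (i : Fin 3) :
    ∫ y, y i * pd f l y = - ((if l = i then 1 else 0) * ∫ y, f y) := by
  have hM := hf.nonneg
  set ψ : ℝ → E3 → ℝ := fun ε y => (1 + ε * ‖y‖ ^ 2)⁻¹ with hψ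
  have hψc : ∀ ε : ℝ, 0 < ε → ContDiff ℝ 1 (ψ ε) := fun ε hε =>
    (contDiff_const.add (contDiff_const.mul (contDiff_norm_sq ℝ))).inv fun y => by positivity
  have hψpd : ∀ ε : ℝ, 0 < ε → ∀ y, pd (ψ ε) l y = -(2 * ε * y l) * (ψ ε y) ^ 2 := by
    intro ε hε y
    have h0 : 1 + ε * ‖y‖ ^ 2 ≠ 0 := by positivity
    have h1 : HasDerivAt (fun t : ℝ => (1 + ε * t)⁻¹) (-ε / (1 + ε * ‖y‖ ^ 2) ^ 2) (‖y‖ ^ 2) := by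
      have := (((hasDerivAt_id (‖y‖ ^ 2)).const_mul ε).const_add 1).inv h0
      refine this.congr_deriv ?_
      simp
    have hd : DifferentiableAt ℝ (fun y : E3 => ‖y‖ ^ 2) y :=
      ((contDiff_norm_sq ℝ (n := 1)).differentiable (by norm_num)) y
    have := pd_comp h1 hd l
    rw [pd_norm_sq] at this
    rw [hψ]; simp only
    rw [this]; field_simp
  have hψ0 : ∀ ε : ℝ, 0 < ε → ∀ y, 0 ≤ ψ ε y := fun ε hε y => by rw [hψ]; positivity
  have hψ1 : ∀ ε : ℝ, 0 < ε → ∀ y, ψ ε y ≤ 1 := fun ε hε y =>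
    inv_le_one_of_one_le₀ (by nlinarith [sq_nonneg ‖y‖])
  have hψ2 : ∀ ε : ℝ, 0 < ε → ∀ y, ε * ‖y‖ ^ 2 * ψ ε y ≤ 1 := fun ε hε y => by
    rw [hψ]; simp only
    rw [mul_inv_le_iff₀ (by positivity)]; linarith
  set A : ℝ → E3 → ℝ := fun ε y => y i * ψ ε y with hA
  have hAc : ∀ ε : ℝ, 0 < ε → ContDiff ℝ 1 (A ε) := fun ε hε => (contDiff_coord i).mul (hψc ε hε)
  have hApd : ∀ ε : ℝ, 0 < ε → ∀ y, pd (A ε) l y =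
      (if l = i then 1 else 0) * ψ ε y + y i * (-(2 * ε * y l) * (ψ ε y) ^ 2) := by
    intro ε hε y
    rw [hA]; simp only
    rw [pd_mul ((contDiff_coord (n := 1) i).differentiable (by norm_num) y)
      ((hψc ε hε).differentiable (by norm_num) y), pd_coord, hψpd ε hε]
  have hApdb : ∀ ε : ℝ, 0 < ε → ∀ y, |pd (A ε) l y| ≤ 3 := by
    intro ε hε y
    have h0 := hψ0 ε hε y
    have h1 := hψ1 ε hε y
    have h2 := hψ2 ε hε y
    rw [hApd ε hε]
    refine (abs_add_le _ _).trans ?_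
    have t1 : |(if l = i then (1 : ℝ) else 0) * ψ ε y| ≤ 1 := by
      rw [abs_mul, abs_of_nonneg h0]
      split_ifs <;> simp [h1]
    have t2 : |y i * (-(2 * ε * y l) * (ψ ε y) ^ 2)| ≤ 2 := by
      rw [abs_mul, abs_mul, abs_neg, abs_mul, abs_of_pos (by positivity : 0 < 2 * ε),
        abs_of_nonneg (sq_nonneg (ψ ε y))]
      calc _ ≤ ‖y‖ * (2 * ε * ‖y‖ * ψ ε y ^ 2) := by gcongr <;> exact abs_coord_le _ _
        _ = 2 * (ε * ‖y‖ ^ 2 * ψ ε y) * ψ ε y := by ring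
        _ ≤ 2 * 1 * 1 := by gcongr
        _ = 2 := by norm_num
    linarith
  have hAb : ∀ ε : ℝ, 0 < ε → ∀ y, |A ε y| ≤ 1 + ε⁻¹ := by
    intro ε hε y
    have h0 := hψ0 ε hε y
    rw [hA]; simp only
    rw [abs_mul, abs_of_nonneg h0]
    have h3 : ‖y‖ ≤ 1 + ‖y‖ ^ 2 := by nlinarith [sq_nonneg (‖y‖ - 1), norm_nonneg y]
    calc _ ≤ (1 + ‖y‖ ^ 2) * ψ ε y := by gcongr; exact (abs_coord_le y i).trans h3
      _ = ψ ε y + ε⁻¹ * (ε * ‖y‖ ^ 2 * ψ ε y) := by field_simp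
      _ ≤ 1 + ε⁻¹ * 1 := by gcongr; exacts [hψ1 ε hε y, hψ2 ε hε y]
      _ = _ := by ring
  have hdl : Decays s M (pd f l) := hd.mono (by linarith)
  have hparts : ∀ ε : ℝ, 0 < ε → ∫ y, A ε y * pd f l y = - ∫ y, pd (A ε) l y * f y := by
    intro ε hε
    refine integral_mul_fderiv_eq_neg_fderiv_mul_of_integrable (μ := (volume : Measure E3))
      (f := A ε) (g := f) (v := EuclideanSpace.single l 1) ?_ ?_ ?_
      (fun z _ => (hAc ε hε).differentiable (by norm_num) z)
      (fun z _ => hf1.differentiable (by norm_num) z)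
    · exact (hf.integrable hs).bdd_mul (c := 3) (continuous_pd (hAc ε hε) l).aestronglyMeasurable
        (Eventually.of_forall fun y => hApdb ε hε y)
    · exact (hdl.integrable hs).bdd_mul (c := 1 + ε⁻¹) (hAc ε hε).continuous.aestronglyMeasurable
        (Eventually.of_forall fun y => hAb ε hε y)
    · exact (hf.integrable hs).bdd_mul (c := 1 + ε⁻¹) (hAc ε hε).continuous.aestronglyMeasurable
        (Eventually.of_forall fun y => hAb ε hε y)
  have hψt : ∀ y, Tendsto (fun ε => ψ ε y) (𝓝[>] 0) (𝓝 1) := by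
    intro y
    have h : ContinuousAt (fun ε : ℝ => (1 + ε * ‖y‖ ^ 2)⁻¹) 0 := by
      refine ContinuousAt.inv₀ (by fun_prop) (by simp)
    have := h.tendsto.mono_left (nhdsWithin_le_nhds (s := Ioi 0))
    simpa using this
  have hl1 : Tendsto (fun ε => ∫ y, A ε y * pd f l y) (𝓝[>] 0) (𝓝 (∫ y, y i * pd f l y)) := by
    refine tendsto_integral_filter_of_dominated_convergence (fun y => M * wt y ^ (-s)) ?_ ?_
      ((integrable_wt_rpow hs).const_mul _) ?_
    · filter_upwards [self_mem_nhdsWithin] with ε hε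
      exact ((hAc ε hε).continuous.mul hd.cont).aestronglyMeasurable
    · filter_upwards [self_mem_nhdsWithin] with ε hε
      refine Eventually.of_forall fun y => ?_
      have h := (decays_coord_mul hd i).bound y
      refine le_trans ?_ h
      rw [hA]; simp only
      rw [norm_mul, norm_mul, abs_mul, Real.norm_of_nonneg (hψ0 ε hε y)]
      exact mul_le_mul_of_nonneg_right (mul_le_of_le_one_right (abs_nonneg _) (hψ1 ε hε y))
        (abs_nonneg _)
    · refine Eventually.of_forall fun y => ?_
      simpa using ((hψt y).const_mul (y i)).mul_const (pd f l y)
  have hl2 : Tendsto (fun ε => ∫ y, pd (A ε) l y * f y) (𝓝[>] 0)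
      (𝓝 (∫ y, (if l = i then 1 else 0) * f y)) := by
    refine tendsto_integral_filter_of_dominated_convergence (fun y => 3 * (M * wt y ^ (-s))) ?_ ?_
      (((integrable_wt_rpow hs).const_mul _).const_mul _) ?_
    · filter_upwards [self_mem_nhdsWithin] with ε hε
      exact ((continuous_pd (hAc ε hε) l).mul hf.cont).aestronglyMeasurable
    · filter_upwards [self_mem_nhdsWithin] with ε hε
      refine Eventually.of_forall fun y => ?_
      rw [norm_mul]
      exact mul_le_mul (hApdb ε hε y) (hf.bound y) (abs_nonneg _) (by norm_num)
    · refine Eventually.of_forall fun y => ?_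
      have hε : Tendsto (fun ε : ℝ => ε) (𝓝[>] 0) (𝓝 0) := nhdsWithin_le_nhds
      have h := (((hψt y).const_mul (if l = i then (1 : ℝ) else 0)).add
        ((((hε.const_mul 2).mul_const (y l)).neg.mul ((hψt y).pow 2)).const_mul (y i))).mul_const
          (f y)
      simp only [mul_zero, zero_mul, neg_zero, add_zero, mul_one] at h
      refine h.congr' ?_
      filter_upwards [self_mem_nhdsWithin] with ε hε
      rw [hApd ε hε]
  have := tendsto_nhds_unique (hl1.congr' (by
    filter_upwards [self_mem_nhdsWithin] with ε hε using hparts ε hε)) hl2.neg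
  rw [this, integral_const_mul]

end VacuumData

namespace VacuumData

variable {s M q : ℝ} {f : E3 → ℝ}

/-! ### The Newtonian potential -/

lemma pd_norm {z : E3} (hz : z ≠ 0) (l : Fin 3) : pd (fun y => ‖y‖) l z = z l / ‖z‖ := by
  have hz0 : 0 < ‖z‖ := norm_pos_iff.2 hz
  have hd : DifferentiableAt ℝ (fun y : E3 => ‖y‖) z := differentiableAt_id.norm ℝ hz
  have h := pd_mul hd hd l
  have e : (fun y : E3 => ‖y‖ * ‖y‖) = fun y => ‖y‖ ^ 2 := by ext; ring
  rw [e, pd_norm_sq] at h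
  field_simp
  linarith

lemma differentiableAt_inv_norm_pow (n : ℕ) {z : E3} (hz : z ≠ 0) :
    DifferentiableAt ℝ (fun y : E3 => (‖y‖ ^ n)⁻¹) z :=
  ((differentiableAt_id.norm ℝ hz).pow n).inv (pow_ne_zero _ (norm_ne_zero_iff.2 hz))

lemma pd_inv_norm_pow (n : ℕ) {z : E3} (hz : z ≠ 0) (l : Fin 3) :
    pd (fun y => (‖y‖ ^ n)⁻¹) l z = -(n * z l * (‖z‖ ^ (n + 2))⁻¹) := by
  have hz0 : 0 < ‖z‖ := norm_pos_iff.2 hz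
  have h1 : HasDerivAt (fun t : ℝ => (t ^ n)⁻¹) (-(n * ‖z‖ ^ (n - 1)) / (‖z‖ ^ n) ^ 2) ‖z‖ :=
    (hasDerivAt_pow n ‖z‖).fun_inv (by positivity)
  rw [pd_comp h1 (differentiableAt_id.norm ℝ hz), pd_norm hz]
  rcases n with _ | n
  · simp
  · simp only [Nat.add_sub_cancel]
    field_simp
    ring

lemma differentiable_coord (i : Fin 3) (z : E3) : DifferentiableAt ℝ (fun y : E3 => y i) z :=
  (contDiff_coord (n := 1) i).differentiable (by norm_num) z

/-- The total area of the unit sphere. -/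
def sphereArea : ℝ := (volume : Measure E3).toSphere.real univ

lemma sphereArea_pos : 0 < sphereArea := by
  rw [sphereArea, measureReal_def]
  refine ENNReal.toReal_pos ?_ (measure_ne_top _ _)
  rw [Ne, Measure.measure_univ_eq_zero]
  exact Measure.toSphere_ne_zero _

/-- The gradient kernel `z ↦ z_k / ‖z‖³`, up to normalisation. -/
def gradKernel (k : Fin 3) (z : E3) : ℝ := z k / ‖z‖ * (‖z‖ ^ 2)⁻¹

lemma isKernel_gradKernel (k : Fin 3) : IsKernel 2 1 (gradKernel k) :=
  (isDirectional_coord k).isKernel 2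

lemma isKernel_inv_norm : IsKernel 1 1 fun z : E3 => ‖z‖⁻¹ := by
  simpa using isDirectional_one.isKernel 1

/-- The kernel `z ↦ z_i z_k / ‖z‖³`. -/
def quadKernel (i k : Fin 3) (z : E3) : ℝ := z i / ‖z‖ * (z k / ‖z‖) * (‖z‖ ^ 1)⁻¹

lemma isKernel_quadKernel (i k : Fin 3) : IsKernel 1 1 (quadKernel i k) :=
  ((isDirectional_coord i).mul (isDirectional_coord k)).isKernel 1

/-- The kernel `z ↦ z_i z_k z_l / ‖z‖⁵`. -/
def cubicKernel (i k l : Fin 3) (z : E3) : ℝ :=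
  z i / ‖z‖ * (z k / ‖z‖) * (z l / ‖z‖) * (‖z‖ ^ 2)⁻¹

lemma isKernel_cubicKernel (i k l : Fin 3) : IsKernel 2 1 (cubicKernel i k l) :=
  (((isDirectional_coord i).mul (isDirectional_coord k)).mul (isDirectional_coord l)).isKernel 2

lemma IsKernel.const_mul {a : ℕ} {C : ℝ} {k : E3 → ℝ} (hk : IsKernel a C k) (c : ℝ) :
    IsKernel a (|c| * C) fun z => c * k z :=
  ⟨hk.meas.const_mul c, fun z => by
    rw [abs_mul, mul_assoc]; exact mul_le_mul_of_nonneg_left (hk.bound z) (abs_nonneg c),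
    mul_nonneg (abs_nonneg c) hk.nonneg⟩

lemma IsKernel.add {a : ℕ} {C D : ℝ} {k k' : E3 → ℝ} (hk : IsKernel a C k)
    (hk' : IsKernel a D k') : IsKernel a (C + D) fun z => k z + k' z :=
  ⟨hk.meas.add hk'.meas, fun z => by
    rw [add_mul]; exact (abs_add_le _ _).trans (add_le_add (hk.bound z) (hk'.bound z)),
    add_nonneg hk.nonneg hk'.nonneg⟩

lemma IsKernel.mono {a : ℕ} {C D : ℝ} {k : E3 → ℝ} (hk : IsKernel a C k) (h : C ≤ D) :
    IsKernel a D k :=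
  ⟨hk.meas, fun z => (hk.bound z).trans (mul_le_mul_of_nonneg_right h (by positivity)),
    hk.nonneg.trans h⟩

lemma pd_inv_norm {z : E3} (hz : z ≠ 0) (l : Fin 3) :
    pd (fun y => ‖y‖⁻¹) l z = - gradKernel l z := by
  have := pd_inv_norm_pow 1 hz l
  simp only [pow_one] at this
  rw [this, gradKernel]
  have hz0 : 0 < ‖z‖ := norm_pos_iff.2 hz
  field_simp
  norm_num

lemma gradKernel_eq (k : Fin 3) : gradKernel k = fun z => z k * (‖z‖ ^ 3)⁻¹ := by
  ext z
  rw [gradKernel, div_eq_mul_inv, mul_assoc, ← mul_inv]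
  ring_nf

lemma quadKernel_eq (i k : Fin 3) : quadKernel i k = fun z => z i * gradKernel k z := by
  ext z
  rw [gradKernel_eq, quadKernel]
  simp only [div_eq_mul_inv]
  have : (‖z‖ ^ 3)⁻¹ = ‖z‖⁻¹ * ‖z‖⁻¹ * (‖z‖ ^ 1)⁻¹ := by simp only [← mul_inv]; ring_nf
  rw [this]; ring

lemma differentiableAt_gradKernel (k : Fin 3) {z : E3} (hz : z ≠ 0) :
    DifferentiableAt ℝ (gradKernel k) z := by
  rw [gradKernel_eq]
  exact (differentiable_coord k z).mul (differentiableAt_inv_norm_pow 3 hz)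

lemma pd_gradKernel (k l : Fin 3) {z : E3} (hz : z ≠ 0) :
    pd (gradKernel k) l z = (if l = k then 1 else 0) * (‖z‖ ^ 3)⁻¹ - 3 * z k * z l * (‖z‖ ^ 5)⁻¹ := by
  rw [gradKernel_eq, pd_mul (differentiable_coord k z) (differentiableAt_inv_norm_pow 3 hz),
    pd_coord, pd_inv_norm_pow 3 hz]
  push_cast; ring

/-- The derivative of `quadKernel`. -/
def quadKernelDeriv (i k l : Fin 3) (z : E3) : ℝ :=
  (if l = i then 1 else 0) * gradKernel k z + (if l = k then 1 else 0) * gradKernel i z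
    + (-3) * cubicKernel i k l z

lemma isKernel_quadKernelDeriv (i k l : Fin 3) : IsKernel 2 5 (quadKernelDeriv i k l) := by
  refine ((((isKernel_gradKernel k).const_mul (if l = i then 1 else 0)).add
    ((isKernel_gradKernel i).const_mul (if l = k then 1 else 0))).add
    ((isKernel_cubicKernel i k l).const_mul (-3))).mono ?_
  split_ifs <;> norm_num

lemma pd_quadKernel (i k l : Fin 3) {z : E3} (hz : z ≠ 0) :
    pd (quadKernel i k) l z = quadKernelDeriv i k l z := by
  have hz0 : 0 < ‖z‖ := norm_pos_iff.2 hz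
  rw [quadKernel_eq, pd_mul (differentiable_coord i z) (differentiableAt_gradKernel k hz),
    pd_coord, pd_gradKernel k l hz, quadKernelDeriv, cubicKernel, gradKernel_eq, gradKernel_eq]
  field_simp
  ring

lemma coord_mul_pd_gradKernel (i k l : Fin 3) {z : E3} (hz : z ≠ 0) :
    z i * pd (gradKernel k) l z =
      quadKernelDeriv i k l z - (if l = i then 1 else 0) * gradKernel k z := by
  rw [← pd_quadKernel i k l hz, quadKernel_eq,
    pd_mul (differentiable_coord i z) (differentiableAt_gradKernel k hz), pd_coord]
  ring

/-- A source term for the Poisson equation. -/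
structure IsSource (q M : ℝ) (f : E3 → ℝ) : Prop where
  smooth : ContDiff ℝ 1 f
  bound : ∀ x, |f x| ≤ M * wt x ^ (-(3 + q))
  bound_pd : ∀ i x, |pd f i x| ≤ M * wt x ^ (-(3 + q + 1))

lemma IsSource.decays (hf : IsSource q M f) : Decays (3 + q) M f := ⟨hf.smooth.continuous, hf.bound⟩

lemma IsSource.decays_pd (hf : IsSource q M f) (i : Fin 3) : Decays (3 + q + 1) M (pd f i) :=
  ⟨continuous_pd hf.smooth i, hf.bound_pd i⟩

lemma IsSource.decays_pd' (hf : IsSource q M f) (i : Fin 3) : Decays (3 + q) M (pd f i) :=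
  (hf.decays_pd i).mono (by linarith)

/-- The Newtonian potential of `f`. -/
def newton (f : E3 → ℝ) (x : E3) : ℝ := -(sphereArea⁻¹ * conv (fun z => ‖z‖⁻¹) f x)

lemma pd_newton (hq : 0 < q) (hf : IsSource q M f) (k : Fin 3) :
    pd (newton f) k = fun x => sphereArea⁻¹ * conv (gradKernel k) f x := by
  ext x
  have hs : 3 < 3 + q := by linarith
  have hc := contDiff_conv isKernel_inv_norm one_pos (by norm_num) hf.decays hs hf.smooth
    hf.decays_pd'
  have hd : DifferentiableAt ℝ (conv (fun z => ‖z‖⁻¹) f) x := hc.differentiable (by norm_num) x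
  have h1 : pd (newton f) k x = -(sphereArea⁻¹ * pd (conv (fun z => ‖z‖⁻¹) f) k x) := by
    unfold newton
    rw [pd_neg, pd_const_mul hd]
  rw [h1, pd_conv isKernel_inv_norm one_pos (by norm_num) hf.decays hs hf.smooth hf.decays_pd']
  have hk2 : IsKernel 2 1 fun z => (-1) * gradKernel k z := by
    simpa using (isKernel_gradKernel k).const_mul (-1)
  rw [conv_pd_eq isKernel_inv_norm hk2
    (fun z hz => by simpa using differentiableAt_inv_norm_pow 1 hz)
    (fun z hz => by rw [pd_inv_norm hz]; ring) hf.decays hs hf.smooth (hf.decays_pd' k)]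
  simp only [conv, neg_mul, one_mul, integral_neg]
  ring

lemma pd_pd_newton (hq : 0 < q) (hf : IsSource q M f) (k l : Fin 3) :
    pd (pd (newton f) k) l = fun x => sphereArea⁻¹ * conv (gradKernel k) (pd f l) x := by
  have hs : 3 < 3 + q := by linarith
  ext x
  have hc := contDiff_conv (isKernel_gradKernel k) two_pos le_rfl hf.decays hs hf.smooth
    hf.decays_pd'
  rw [pd_newton hq hf, pd_const_mul (hc.differentiable (by norm_num) x),
    pd_conv (isKernel_gradKernel k) two_pos le_rfl hf.decays hs hf.smooth hf.decays_pd']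

lemma contDiff_newton (hq : 0 < q) (hf : IsSource q M f) : ContDiff ℝ 2 (newton f) := by
  have hs : 3 < 3 + q := by linarith
  have hc := contDiff_conv isKernel_inv_norm one_pos (by norm_num) hf.decays hs hf.smooth
    hf.decays_pd'
  refine contDiff_succ_of_pd (n := 1) ?_ fun k => ?_
  · exact (contDiff_const.mul hc).neg.differentiable (by norm_num)
  · rw [pd_newton hq hf]
    exact contDiff_const.mul (contDiff_conv (isKernel_gradKernel k) two_pos le_rfl hf.decays hs
      hf.smooth hf.decays_pd')

/-- Polar coordinates. -/
lemma integral_polar {F : E3 → ℝ} (hF : Integrable F) :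
    ∫ z, F z = ∫ e : sphere (0 : E3) 1, ∫ t in Ioi (0 : ℝ), t ^ 2 * F (t • (e : E3))
      ∂volume ∂(volume : Measure E3).toSphere ∧
    ∀ᵐ e : sphere (0 : E3) 1 ∂(volume : Measure E3).toSphere,
      IntegrableOn (fun t : ℝ => t ^ 2 * F (t • (e : E3))) (Ioi 0) := by
  have hmp := (volume : Measure E3).measurePreserving_homeomorphUnitSphereProd
  rw [finrank_euclideanSpace, Fintype.card_fin] at hmp
  have hme := (homeomorphUnitSphereProd E3).measurableEmbedding
  set Φ : sphere (0 : E3) 1 × Ioi (0 : ℝ) → ℝ := fun p => F ((p.2 : ℝ) • (p.1 : E3)) with hΦ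
  have hΦF : ∀ z : ({0}ᶜ : Set E3), Φ (homeomorphUnitSphereProd E3 z) = F z := by
    intro z
    have := (homeomorphUnitSphereProd E3).symm_apply_apply z
    have h2 := congrArg (Subtype.val) this
    simp only [homeomorphUnitSphereProd_symm_apply_coe] at h2
    rw [hΦ]; simp only; rw [h2]
  have hms : MeasurableSet ({0}ᶜ : Set E3) := (measurableSet_singleton _).compl
  have hFi : Integrable (fun z : ({0}ᶜ : Set E3) => F z) (Measure.comap (↑) (volume : Measure E3)) :=
    (integrableOn_iff_comap_subtypeVal hms).1 hF.integrableOn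
  have hΦi : Integrable Φ ((volume : Measure E3).toSphere.prod (Measure.volumeIoiPow (3 - 1))) := by
    rw [← hmp.integrable_comp_emb hme]
    exact hFi.congr (Eventually.of_forall fun z => (hΦF z).symm)
  have hdens : ∀ g : ℝ → ℝ, ∫ r : Ioi (0 : ℝ), g r ∂(Measure.volumeIoiPow (3 - 1)) =
      ∫ t in Ioi (0 : ℝ), t ^ 2 * g t := by
    intro g
    simp only [Measure.volumeIoiPow, ENNReal.ofReal]
    rw [integral_withDensity_eq_integral_smul (by fun_prop),
      integral_subtype_comap measurableSet_Ioi fun a : ℝ => Real.toNNReal (a ^ (3 - 1)) • g a]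
    refine setIntegral_congr_fun measurableSet_Ioi fun t ht => ?_
    simp only [NNReal.smul_def, smul_eq_mul]
    rw [Real.coe_toNNReal _ (sq_nonneg t)]
  constructor
  · have h1 : ∫ z, F z = ∫ z : ({0}ᶜ : Set E3), F z ∂(Measure.comap (↑) (volume : Measure E3)) := by
      rw [integral_subtype_comap hms, restrict_compl_singleton]
    rw [h1]
    have h2 := hmp.integral_comp hme Φ
    simp only [hΦF] at h2
    rw [h2, integral_prod _ hΦi]
    exact integral_congr_ae (Eventually.of_forall fun e => hdens fun t => F (t • (e : E3)))
  · filter_upwards [hΦi.prod_right_ae] with e he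
    have h3 : Integrable (fun r : Ioi (0 : ℝ) => F ((r : ℝ) • (e : E3)))
      (Measure.volumeIoiPow (3 - 1)) := he
    simp only [Measure.volumeIoiPow, ENNReal.ofReal] at h3
    rw [integrable_withDensity_iff_integrable_smul (by fun_prop)] at h3
    rw [integrableOn_iff_comap_subtypeVal measurableSet_Ioi]
    refine h3.congr (Eventually.of_forall fun t => ?_)
    simp only [NNReal.smul_def, smul_eq_mul, Function.comp]
    rw [Real.coe_toNNReal _ (sq_nonneg _)]

lemma laplacian_newton (hq : 0 < q) (hf : IsSource q M f) (x : E3) :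
    ∑ k, pd (pd (newton f) k) k x = f x := by
  have hs : 3 < 3 + q := by linarith
  have hi : ∀ k, Integrable fun z => gradKernel k z * pd f k (x - z) := fun k =>
    integrable_kernel_mul (isKernel_gradKernel k) two_pos le_rfl (hf.decays_pd' k) hs x
  simp only [pd_pd_newton hq hf]
  rw [← Finset.mul_sum]
  have h1 : ∑ k, conv (gradKernel k) (pd f k) x =
      ∫ z, ∑ k, gradKernel k z * pd f k (x - z) := by
    rw [integral_finsetSum _ fun k _ => hi k]; rfl
  have hI : Integrable fun z => ∑ k, gradKernel k z * pd f k (x - z) :=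
    integrable_finsetSum _ fun k _ => hi k
  obtain ⟨h2, h3⟩ := integral_polar hI
  rw [h1, h2]
  have hray : ∀ (e : sphere (0 : E3) 1) (t : ℝ), 0 < t →
      t ^ 2 * ∑ k, gradKernel k (t • (e : E3)) * pd f k (x - t • (e : E3)) =
        fderiv ℝ f (x - t • (e : E3)) e := by
    intro e t ht
    have he : ‖(e : E3)‖ = 1 := by simp
    rw [clm_apply_eq_sum, Finset.mul_sum]
    refine Finset.sum_congr rfl fun k _ => ?_
    change _ = pd f k _ * _
    rw [gradKernel_eq]
    simp only [norm_smul, he, mul_one, Real.norm_of_nonneg ht.le, PiLp.smul_apply, smul_eq_mul]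
    field_simp
  have hinner : ∀ᵐ e : sphere (0 : E3) 1 ∂(volume : Measure E3).toSphere,
      ∫ t in Ioi (0 : ℝ), t ^ 2 * ∑ k, gradKernel k (t • (e : E3)) * pd f k (x - t • (e : E3))
        = f x := by
    filter_upwards [h3] with e he
    have hen : ‖(e : E3)‖ = 1 := by simp
    rw [setIntegral_congr_fun measurableSet_Ioi fun t ht => hray e t ht]
    have he' : IntegrableOn (fun t : ℝ => fderiv ℝ f (x - t • (e : E3)) e) (Ioi 0) :=
      he.congr_fun (fun t ht => hray e t ht) measurableSet_Ioi
    have hder : ∀ t : ℝ, HasDerivAt (fun t : ℝ => -f (x - t • (e : E3)))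
        (fderiv ℝ f (x - t • (e : E3)) e) t := by
      intro t
      have h1 : HasFDerivAt f (fderiv ℝ f (x - t • (e : E3))) (x - t • (e : E3)) :=
        (hf.smooth.differentiable (by norm_num) _).hasFDerivAt
      have h2 : HasDerivAt (fun t : ℝ => x - t • (e : E3)) (-(e : E3)) t := by
        simpa using ((hasDerivAt_id t).smul_const (e : E3)).const_sub x
      refine (h1.comp_hasDerivAt t h2).neg.congr_deriv ?_
      simp
    have hlim : Tendsto (fun t : ℝ => -f (x - t • (e : E3))) atTop (𝓝 (-0)) := by
      refine Tendsto.neg ?_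
      refine (tendsto_zero_iff_abs_tendsto_zero _).2 ?_
      have hM := hf.decays.nonneg
      have hw : Tendsto (fun t : ℝ => M * (t - ‖x‖) ^ (-(3 + q))) atTop (𝓝 (M * 0)) :=
        ((tendsto_rpow_neg_atTop (by linarith : 0 < 3 + q)).comp
          (tendsto_atTop_add_const_right _ (-‖x‖) tendsto_id)).const_mul M
      rw [mul_zero] at hw
      refine tendsto_of_tendsto_of_tendsto_of_le_of_le' tendsto_const_nhds hw
        (Eventually.of_forall fun t => abs_nonneg _) ?_
      filter_upwards [eventually_gt_atTop ‖x‖] with t ht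
      refine (hf.bound _).trans (mul_le_mul_of_nonneg_left ?_ hM)
      refine Real.rpow_le_rpow_of_nonpos (by linarith) ?_ (by linarith)
      refine le_trans ?_ (norm_le_wt _)
      have := norm_sub_norm_le (t • (e : E3)) x
      rw [norm_smul, hen, mul_one, Real.norm_of_nonneg ((norm_nonneg x).trans ht.le),
        norm_sub_rev] at this
      exact this
    rw [integral_Ioi_of_hasDerivAt_of_tendsto' (fun t _ => hder t) he' hlim]
    simp
  rw [integral_congr_ae hinner, integral_const, smul_eq_mul]
  change sphereArea⁻¹ * (sphereArea * f x) = f x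
  rw [inv_mul_cancel_left₀ sphereArea_pos.ne']

end VacuumData

namespace VacuumData

variable {q M : ℝ} {f : E3 → ℝ}

lemma abs_ite_le_one (p : Prop) [Decidable p] : |if p then (1 : ℝ) else 0| ≤ 1 := by
  split_ifs <;> simp

lemma conv_quadKernelDeriv (hq : 0 < q) (hf : Decays (3 + q) M f) (i k l : Fin 3) (x : E3) :
    conv (quadKernelDeriv i k l) f x = (if l = i then 1 else 0) * conv (gradKernel k) f x
      + (if l = k then 1 else 0) * conv (gradKernel i) f x
      + (-3) * conv (cubicKernel i k l) f x := by
  have hs : 3 < 3 + q := by linarith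
  have h1 := integrable_kernel_mul (isKernel_gradKernel k) two_pos le_rfl hf hs x
  have h2 := integrable_kernel_mul (isKernel_gradKernel i) two_pos le_rfl hf hs x
  have h3 := integrable_kernel_mul (isKernel_cubicKernel i k l) two_pos le_rfl hf hs x
  have h12 : Integrable fun z => (if l = i then (1 : ℝ) else 0) * (gradKernel k z * f (x - z))
      + (if l = k then (1 : ℝ) else 0) * (gradKernel i z * f (x - z)) :=
    (h1.const_mul _).add (h2.const_mul _)
  simp only [conv]
  rw [← integral_const_mul, ← integral_const_mul, ← integral_const_mul,
    ← integral_add (h1.const_mul _) (h2.const_mul _), ← integral_add h12 (h3.const_mul _)]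
  refine integral_congr_ae (Eventually.of_forall fun z => ?_)
  simp only [quadKernelDeriv]
  ring

lemma coord_mul_conv_gradKernel (hq : 0 < q) (hf : IsSource q M f) (i k l : Fin 3) (x : E3) :
    x i * conv (gradKernel k) (pd f l) x =
      conv (gradKernel k) (fun y => y i * pd f l y) x + conv (quadKernelDeriv i k l) f x := by
  have hs : 3 < 3 + q := by linarith
  have h0 : IsKernel 1 5 (quadKernel i k) := (isKernel_quadKernel i k).mono (by norm_num)
  have hd : ∀ z : E3, z ≠ 0 → DifferentiableAt ℝ (quadKernel i k) z := fun z hz => by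
    rw [quadKernel_eq]
    exact (differentiable_coord i z).mul (differentiableAt_gradKernel k hz)
  rw [← conv_pd_eq h0 (isKernel_quadKernelDeriv i k l) hd (fun z hz => pd_quadKernel i k l hz)
    hf.decays hs hf.smooth (hf.decays_pd' l)]
  have h1 := integrable_kernel_mul (isKernel_gradKernel k) two_pos le_rfl
    (decays_coord_mul (hf.decays_pd l) i) hs x
  have h2 := integrable_kernel_mul h0 one_pos (by norm_num) (hf.decays_pd' l) hs x
  simp only [conv]
  rw [← integral_const_mul, ← integral_add h1 h2]
  refine integral_congr_ae (Eventually.of_forall fun z => ?_)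
  simp only [quadKernel_eq, PiLp.sub_apply]
  ring

lemma norm_le_sum_abs_coord (x : E3) : ‖x‖ ≤ ∑ i, |x i| := by
  conv_lhs => rw [← sum_smul_e x]
  refine (norm_sum_le _ _).trans (Finset.sum_le_sum fun i _ => ?_)
  rw [norm_smul]
  simp [e]

lemma abs_le_wt_rpow {u A B j : ℝ} {x : E3} (hj : 0 ≤ j) (hA0 : 0 ≤ A) (hB0 : 0 ≤ B)
    (hA : |u| ≤ A) (hB : 1 ≤ ‖x‖ → |u| ≤ B * ‖x‖ ^ (-j)) :
    |u| ≤ 2 ^ j * (A + B) * wt x ^ (-j) := by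
  have hw := wt_pos x
  have h2 : (2 : ℝ) ^ j * wt x ^ (-j) = (wt x / 2) ^ (-j) := by
    rw [Real.div_rpow hw.le zero_le_two, Real.rpow_neg zero_le_two]
    field_simp
  have h2' : 0 ≤ (2 : ℝ) ^ j * wt x ^ (-j) := mul_nonneg (by positivity) (wt_rpow_pos _ _).le
  rcases le_total ‖x‖ 1 with h | h
  · have h1 : 1 ≤ (2 : ℝ) ^ j * wt x ^ (-j) := by
      rw [h2]
      have := wt_le_two h
      refine Real.one_le_rpow_of_pos_of_le_one_of_nonpos (by positivity) (by linarith) (by linarith)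
    calc |u| ≤ A := hA
      _ ≤ (A + B) * 1 := by linarith
      _ ≤ (A + B) * ((2 : ℝ) ^ j * wt x ^ (-j)) := by gcongr
      _ = _ := by ring
  · have h1 : ‖x‖ ^ (-j) ≤ (2 : ℝ) ^ j * wt x ^ (-j) := by
      rw [h2]
      have := wt_le_two_mul h
      exact Real.rpow_le_rpow_of_nonpos (by positivity) (by linarith) (by linarith)
    calc |u| ≤ B * ‖x‖ ^ (-j) := hB h
      _ ≤ (A + B) * ‖x‖ ^ (-j) := by gcongr; linarith
      _ ≤ (A + B) * ((2 : ℝ) ^ j * wt x ^ (-j)) := by gcongr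
      _ = _ := by ring

lemma norm_rpow_le_of_le {s t : ℝ} {x : E3} (hx : 1 ≤ ‖x‖) (h : s ≤ t) : ‖x‖ ^ s ≤ ‖x‖ ^ t :=
  Real.rpow_le_rpow_of_exponent_le hx h

lemma pd_const_div_norm (c : ℝ) {x : E3} (hx : x ≠ 0) (k : Fin 3) :
    pd (fun y => c / ‖y‖) k x = -(c * gradKernel k x) := by
  simp only [div_eq_mul_inv]
  rw [pd_const_mul (by simpa using differentiableAt_inv_norm_pow 1 hx), pd_inv_norm hx]
  ring

lemma differentiableAt_const_div_norm (c : ℝ) {x : E3} (hx : x ≠ 0) :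
    DifferentiableAt ℝ (fun y : E3 => c / ‖y‖) x := by
  simp only [div_eq_mul_inv]
  exact (by simpa using differentiableAt_inv_norm_pow 1 hx :
    DifferentiableAt ℝ (fun y : E3 => ‖y‖⁻¹) x).const_mul c

lemma abs_gradKernel_le (k : Fin 3) (x : E3) : |gradKernel k x| ≤ ‖x‖ ^ (-2 : ℝ) := by
  have := (isKernel_gradKernel k).bound x
  rw [one_mul, inv_pow_eq_rpow 2 _ (norm_nonneg x)] at this
  exact_mod_cast this

lemma abs_pd_gradKernel_le (k l : Fin 3) {x : E3} (hx : x ≠ 0) :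
    |pd (gradKernel k) l x| ≤ 4 * ‖x‖ ^ (-3 : ℝ) := by
  have hx0 : 0 < ‖x‖ := norm_pos_iff.2 hx
  have e3 : ‖x‖ ^ (-3 : ℝ) = (‖x‖ ^ 3)⁻¹ := by
    rw [inv_pow_eq_rpow 3 _ hx0.le]; norm_num
  rw [pd_gradKernel k l hx, e3]
  have h1 := abs_ite_le_one (l = k)
  have hk := abs_coord_le x k
  have hl := abs_coord_le x l
  refine (abs_sub _ _).trans ?_
  rw [abs_mul, abs_mul, abs_mul, abs_mul, abs_of_pos (by positivity : 0 < (‖x‖ ^ 3)⁻¹),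
    abs_of_pos (by positivity : 0 < (‖x‖ ^ 5)⁻¹), abs_of_pos (by norm_num : (0 : ℝ) < 3)]
  calc _ ≤ 1 * (‖x‖ ^ 3)⁻¹ + 3 * ‖x‖ * ‖x‖ * (‖x‖ ^ 5)⁻¹ := by gcongr
    _ = _ := by field_simp; norm_num

set_option maxHeartbeats 800000 in
theorem exists_newton_bounds (hq : 0 < q) (hq1 : q < 1) : ∃ C : ℝ, 0 ≤ C ∧ ∀ M f, IsSource q M f →
    (∀ x, |newton f x| ≤ C * M * wt x ^ (-1 : ℝ)) ∧
    (∀ k x, |pd (newton f) k x| ≤ C * M * wt x ^ (-2 : ℝ)) ∧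
    (∀ k l x, |pd (pd (newton f) k) l x| ≤ C * M * wt x ^ (-3 : ℝ)) ∧
    ∃ c, IsO2 (fun x => newton f x - c / ‖x‖) (1 + q) 1 := by
  have hs : 3 < 3 + q := by linarith
  obtain ⟨D, hD0, hD⟩ := exists_integral_inv_pow_mul_wt_le_norm (s := 2 + q) (by linarith)
    (by linarith)
  obtain ⟨D', hD'0, hD'⟩ := exists_integral_inv_pow_mul_wt_le hs
  set I₀ : ℝ := ∫ x : E3, wt x ^ (-(3 + q)) with hI₀
  have hI0 : 0 ≤ I₀ := integral_nonneg fun z => (wt_rpow_pos _ _).le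
  set κ := sphereArea⁻¹ with hκ
  have hκ0 : 0 < κ := inv_pos.2 sphereArea_pos
  set C₀ : ℝ := κ * (D' + 108 * D + 4 * I₀) with hC₀
  have hC₀0 : 0 ≤ C₀ := by positivity
  clear_value C₀
  refine ⟨8 * (2 * C₀), by positivity, fun M f hf => ?_⟩
  have hM := hf.decays.nonneg
  set J : ℝ := ∫ y, f y with hJ
  have hJb : |J| ≤ M * I₀ := hf.decays.abs_integral_le hs
  set c : ℝ := -(κ * J) with hc
  have hcb : |c| ≤ κ * (M * I₀) := by
    rw [hc, abs_neg, abs_mul, abs_of_pos hκ0]; gcongr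
  have hN2 := contDiff_newton hq hf
  have hNd : ∀ x, DifferentiableAt ℝ (newton f) x := hN2.differentiable (by norm_num)
  have hN1 : ∀ k, ContDiff ℝ 1 (pd (newton f) k) := fun k => ContDiff.pd hN2 k
  have E0 : ∀ x : E3, x ≠ 0 → |newton f x - c / ‖x‖| ≤ κ * (M * D * ‖x‖ ^ (-1 - q)) := by
    intro x hx
    have h := abs_conv_sub_le_one hD hq hf.decays hx
    have e : newton f x - c / ‖x‖ = -(κ * (conv (fun z => ‖z‖⁻¹) f x - ‖x‖⁻¹ * J)) := by
      rw [newton, hc]; ring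
    rw [e, abs_neg, abs_mul, abs_of_pos hκ0]
    gcongr
  have E1 : ∀ k, ∀ x : E3, x ≠ 0 → |pd (newton f) k x + c * gradKernel k x| ≤
      κ * ((2 + 2) * M * D * ‖x‖ ^ (-2 - q)) := by
    intro k x hx
    have h := abs_conv_sub_le_two hD hq zero_le_two (isDirectional_coord k) hf.decays hx
    have e : pd (newton f) k x + c * gradKernel k x =
        κ * (conv (gradKernel k) f x - gradKernel k x * J) := by
      rw [pd_newton hq hf, hc]; ring
    rw [e, abs_mul, abs_of_pos hκ0]
    exact mul_le_mul_of_nonneg_left h hκ0.le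
  have E2 : ∀ k l, ∀ x : E3, x ≠ 0 → |pd (pd (newton f) k) l x + c * pd (gradKernel k) l x| ≤
      κ * (108 * M * D * ‖x‖ ^ (-3 - q)) := by
    intro k l x hx
    have hx0 : 0 < ‖x‖ := norm_pos_iff.2 hx
    have hi : ∀ i, |x i * (pd (pd (newton f) k) l x + c * pd (gradKernel k) l x)| ≤
        κ * (36 * M * D * ‖x‖ ^ (-2 - q)) := by
      intro i
      have t1 := abs_conv_sub_le_two hD hq zero_le_two (isDirectional_coord k)
        (decays_coord_mul (hf.decays_pd l) i) hx
      have t2 := abs_conv_sub_le_two hD hq zero_le_two (isDirectional_coord k) hf.decays hx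
      have t3 := abs_conv_sub_le_two hD hq zero_le_two (isDirectional_coord i) hf.decays hx
      have t4 := abs_conv_sub_le_two hD hq (by norm_num) (((isDirectional_coord i).mul
        (isDirectional_coord k)).mul (isDirectional_coord l)) hf.decays hx
      rw [integral_coord_mul_pd hs hf.decays hf.smooth (hf.decays_pd l) i] at t1
      change |conv (gradKernel k) _ x - gradKernel k x * _| ≤ _ at t1
      change |conv (gradKernel k) _ x - gradKernel k x * J| ≤ _ at t2
      change |conv (gradKernel i) _ x - gradKernel i x * J| ≤ _ at t3
      change |conv (cubicKernel i k l) _ x - cubicKernel i k l x * J| ≤ _ at t4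
      have e : x i * (pd (pd (newton f) k) l x + c * pd (gradKernel k) l x) =
          κ * ((conv (gradKernel k) (fun y => y i * pd f l y) x
              - gradKernel k x * -((if l = i then 1 else 0) * J))
            + (if l = i then 1 else 0) * (conv (gradKernel k) f x - gradKernel k x * J)
            + (if l = k then 1 else 0) * (conv (gradKernel i) f x - gradKernel i x * J)
            + (-3) * (conv (cubicKernel i k l) f x - cubicKernel i k l x * J)) := by
        have h1 := coord_mul_conv_gradKernel hq hf i k l x
        have h2 := coord_mul_pd_gradKernel i k l hx
        rw [conv_quadKernelDeriv hq hf.decays] at h1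
        rw [quadKernelDeriv] at h2
        rw [pd_pd_newton hq hf, mul_add, mul_left_comm, h1, mul_left_comm, h2, hc]
        ring
      rw [e, abs_mul, abs_of_pos hκ0]
      refine mul_le_mul_of_nonneg_left ?_ hκ0.le
      set T := M * D * ‖x‖ ^ (-2 - q)
      have a1 := abs_ite_le_one (l = i)
      have a2 := abs_ite_le_one (l = k)
      refine (abs_add_le _ _).trans ((add_le_add ((abs_add_le _ _).trans
        (add_le_add (abs_add_le _ _) le_rfl)) le_rfl).trans ?_)
      rw [abs_mul (if l = i then (1 : ℝ) else 0), abs_mul (if l = k then (1 : ℝ) else 0),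
        abs_mul (-3 : ℝ)]
      have b2 := mul_le_mul a1 t2 (abs_nonneg _) zero_le_one
      have b3 := mul_le_mul a2 t3 (abs_nonneg _) zero_le_one
      have b4 : |(-3 : ℝ)| = 3 := by norm_num
      rw [b4]
      calc _ ≤ (2 + 2) * M * D * ‖x‖ ^ (-2 - q) + 1 * ((2 + 2) * M * D * ‖x‖ ^ (-2 - q))
            + 1 * ((2 + 2) * M * D * ‖x‖ ^ (-2 - q))
            + 3 * ((2 + 2 + 2 + 2) * M * D * ‖x‖ ^ (-2 - q)) := by gcongr
        _ = _ := by ring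
    set Y := pd (pd (newton f) k) l x + c * pd (gradKernel k) l x
    have h3 : ‖x‖ * |Y| ≤ 3 * (κ * (36 * M * D * ‖x‖ ^ (-2 - q))) := by
      calc ‖x‖ * |Y| ≤ (∑ i, |x i|) * |Y| := by gcongr; exact norm_le_sum_abs_coord x
        _ = ∑ i, |x i * Y| := by rw [Finset.sum_mul]; simp only [abs_mul]
        _ ≤ ∑ _i : Fin 3, κ * (36 * M * D * ‖x‖ ^ (-2 - q)) := Finset.sum_le_sum fun i _ => hi i
        _ = _ := by simp
    have e : ‖x‖ ^ (-2 - q) = ‖x‖ * ‖x‖ ^ (-3 - q) := by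
      conv_rhs => rw [← Real.rpow_one ‖x‖, ← Real.rpow_mul hx0.le, ← Real.rpow_add hx0]
      ring_nf
    rw [e] at h3
    refine le_of_mul_le_mul_left (h3.trans (le_of_eq ?_)) hx0
    ring
  have hne : ∀ {x : E3}, 1 ≤ ‖x‖ → x ≠ 0 := fun {x} h => norm_pos_iff.1 (by linarith)
  have hEdiff : ∀ x : E3, x ≠ 0 → ∀ k, pd (fun x => newton f x - c / ‖x‖) k x =
      pd (newton f) k x + c * gradKernel k x := by
    intro x hx k
    rw [pd_sub (hNd x) (differentiableAt_const_div_norm c hx), pd_const_div_norm c hx]; ring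
  have fin : ∀ {u j : ℝ} {x : E3}, 0 ≤ j → j ≤ 3 → |u| ≤ C₀ * M →
      (1 ≤ ‖x‖ → |u| ≤ C₀ * M * ‖x‖ ^ (-j)) → |u| ≤ 8 * (2 * C₀) * M * wt x ^ (-j) := by
    intro u j x hj hj3 h1 h2
    have hCM : 0 ≤ C₀ * M := by positivity
    have h3 : (2 : ℝ) ^ j ≤ 8 := by
      calc (2 : ℝ) ^ j ≤ 2 ^ (3 : ℝ) := Real.rpow_le_rpow_of_exponent_le one_le_two hj3
        _ = 8 := by norm_num
    have hw := wt_rpow_pos (-j) x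
    calc |u| ≤ 2 ^ j * (C₀ * M + C₀ * M) * wt x ^ (-j) := abs_le_wt_rpow hj hCM hCM h1 h2
      _ ≤ 8 * (C₀ * M + C₀ * M) * wt x ^ (-j) := by gcongr
      _ = _ := by ring
  have hunif : ∀ {u : ℝ}, |u| ≤ 1 * M * D' → |κ * u| ≤ C₀ * M := by
    intro u hu
    rw [abs_mul, abs_of_pos hκ0]
    calc κ * |u| ≤ κ * (1 * M * D') := by gcongr
      _ ≤ κ * (1 * M * D') + κ * M * (108 * D + 4 * I₀) := by
        have : 0 ≤ κ * M * (108 * D + 4 * I₀) := by positivity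
        linarith
      _ = _ := by rw [hC₀]; ring
  have hfar : ∀ {u v K j : ℝ} {x : E3}, 1 ≤ ‖x‖ → K ≤ 108 → 0 ≤ K →
      |u + c * v| ≤ κ * (K * M * D * ‖x‖ ^ (-j - q)) → |v| ≤ 4 * ‖x‖ ^ (-j) →
      |u| ≤ C₀ * M * ‖x‖ ^ (-j) := by
    intro u v K j x hx hK hK0 h1 h2
    have h3 : |u| ≤ |u + c * v| + |c| * |v| := by
      rw [← abs_mul]
      have := abs_sub (u + c * v) (c * v)
      simpa using this
    have hx0 : 0 < ‖x‖ := by linarith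
    calc |u| ≤ κ * (K * M * D * ‖x‖ ^ (-j - q)) + κ * (M * I₀) * (4 * ‖x‖ ^ (-j)) := by
          refine h3.trans (add_le_add h1 (mul_le_mul hcb h2 (abs_nonneg _) (by positivity)))
      _ ≤ κ * (108 * M * D * ‖x‖ ^ (-j)) + κ * (M * I₀) * (4 * ‖x‖ ^ (-j)) := by
          refine add_le_add (mul_le_mul_of_nonneg_left (mul_le_mul ?_ ?_ ?_ ?_) hκ0.le) le_rfl
          · rw [mul_assoc, mul_assoc]
            exact mul_le_mul_of_nonneg_right hK (mul_nonneg hM hD0)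
          · exact norm_rpow_le_of_le hx (by linarith)
          · exact Real.rpow_nonneg hx0.le _
          · exact mul_nonneg (mul_nonneg (by norm_num) hM) hD0
      _ ≤ κ * (108 * M * D * ‖x‖ ^ (-j)) + κ * (M * I₀) * (4 * ‖x‖ ^ (-j))
          + κ * D' * M * ‖x‖ ^ (-j) := by
          have : 0 ≤ κ * D' * M * ‖x‖ ^ (-j) := by positivity
          linarith
      _ = _ := by rw [hC₀]; ring
  refine ⟨fun x => ?_, fun k x => ?_, fun k l x => ?_, c, κ * (108 * M * D), fun x hx => ?_⟩
  · refine fin zero_le_one (by norm_num) ?_ fun hx => ?_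
    · have := hunif (abs_conv_le hD' isKernel_inv_norm one_pos (by norm_num) hf.decays hs x)
      rw [newton, abs_neg]; exact this
    · have hx' := hne hx
      refine hfar (v := -‖x‖⁻¹) (K := 1) hx (by norm_num) zero_le_one ?_ ?_
      · have := E0 x hx'
        rw [one_mul]
        convert this using 2
        ring
      · rw [abs_neg, abs_of_nonneg (by positivity), Real.rpow_neg_one]
        have : 0 ≤ ‖x‖⁻¹ := by positivity
        linarith
  · refine fin zero_le_two (by norm_num) ?_ fun hx => ?_
    · rw [pd_newton hq hf]
      exact hunif (abs_conv_le hD' (isKernel_gradKernel k) two_pos le_rfl hf.decays hs x)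
    · have hx' := hne hx
      refine hfar (K := 2 + 2) hx (by norm_num) (by norm_num) (E1 k x hx') ?_
      refine (abs_gradKernel_le k x).trans ?_
      have : 0 ≤ ‖x‖ ^ (-2 : ℝ) := by positivity
      linarith
  · refine fin zero_le_three le_rfl ?_ fun hx => ?_
    · rw [pd_pd_newton hq hf]
      exact hunif (abs_conv_le hD' (isKernel_gradKernel k) two_pos le_rfl (hf.decays_pd' l) hs x)
    · have hx' := hne hx
      exact hfar (K := 108) hx le_rfl (by norm_num) (E2 k l x hx') (abs_pd_gradKernel_le k l hx')
  · have hx' := hne hx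
    have hxp : 0 < ‖x‖ := by linarith
    have hMD : 0 ≤ M * D := by positivity
    refine ⟨(E0 x hx').trans ?_, fun k => ?_, fun k l => ?_⟩
    · rw [show -(1 + q) = -1 - q by ring]
      have : 0 ≤ κ * (M * D) * ‖x‖ ^ (-1 - q) := by positivity
      nlinarith
    · rw [hEdiff x hx', show -(1 + q) - 1 = -2 - q by ring]
      refine (E1 k x hx').trans ?_
      have : 0 ≤ κ * (M * D) * ‖x‖ ^ (-2 - q) := by positivity
      nlinarith
    · have h : pd (fun x => newton f x - c / ‖x‖) k =ᶠ[𝓝 x]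
          fun y => pd (newton f) k y + c * gradKernel k y := by
        filter_upwards [isOpen_ne.mem_nhds hx'] with y hy using hEdiff y hy k
      rw [pd_congr h, pd_add ((hN1 k).differentiable (by norm_num) x)
        ((differentiableAt_gradKernel k hx').const_mul c),
        pd_const_mul (differentiableAt_gradKernel k hx'), show -(1 + q) - 2 = -3 - q by ring]
      refine (E2 k l x hx').trans (le_of_eq (by ring))

lemma newton_add {M' : ℝ} {g : E3 → ℝ} (hq : 0 < q) (hf : IsSource q M f) (hg : IsSource q M' g) :
    newton (fun x => f x + g x) = fun x => newton f x + newton g x := by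
  ext x
  have hs : 3 < 3 + q := by linarith
  have h1 := integrable_kernel_mul isKernel_inv_norm one_pos (by norm_num) hf.decays hs x
  have h2 := integrable_kernel_mul isKernel_inv_norm one_pos (by norm_num) hg.decays hs x
  simp only [newton, conv, mul_add]
  rw [integral_add h1 h2]
  ring

lemma newton_const_mul (c : ℝ) (f : E3 → ℝ) :
    newton (fun x => c * f x) = fun x => c * newton f x := by
  ext x
  simp only [newton, conv, mul_left_comm _ c]
  rw [integral_const_mul]
  ring

end VacuumData

namespace VacuumData

/-- Pairs consisting of a value and a covector, with the product rule as multiplication. -/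
def Jet : Type := TrivSqZeroExt ℝ (E3 →L[ℝ] ℝ)

namespace Jet

instance : NormedCommRing Jet := TrivSqZeroExt.instL1NormedCommRing

instance : NormedAlgebra ℝ Jet := TrivSqZeroExt.instL1NormedAlgebra ℝ

instance : CompleteSpace Jet :=
  inferInstanceAs (CompleteSpace (TrivSqZeroExt ℝ (E3 →L[ℝ] ℝ)))

/-- The value of a jet. -/
def val (a : Jet) : ℝ := TrivSqZeroExt.fst a

/-- The covector of a jet. -/
def slope (a : Jet) : E3 →L[ℝ] ℝ := TrivSqZeroExt.snd a

/-- The jet with given value and covector. -/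
def mk (r : ℝ) (d : E3 →L[ℝ] ℝ) : Jet := (r, d)

lemma val_mk (r : ℝ) (d : E3 →L[ℝ] ℝ) : (mk r d).val = r := rfl

lemma slope_mk (r : ℝ) (d : E3 →L[ℝ] ℝ) : (mk r d).slope = d := rfl

lemma ext {a b : Jet} (h : a.val = b.val) (h' : a.slope = b.slope) : a = b :=
  TrivSqZeroExt.ext h h'

lemma norm_eq (a : Jet) : ‖a‖ = |a.val| + ‖a.slope‖ := TrivSqZeroExt.norm_def a

lemma val_add (a b : Jet) : (a + b).val = a.val + b.val := rfl

lemma slope_add (a b : Jet) : (a + b).slope = a.slope + b.slope := rfl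

lemma val_sub (a b : Jet) : (a - b).val = a.val - b.val := rfl

lemma slope_sub (a b : Jet) : (a - b).slope = a.slope - b.slope := rfl

lemma slope_mul (a b : Jet) : (a * b).slope = a.val • b.slope + b.val • a.slope :=
  (TrivSqZeroExt.snd_mul a b).trans (by rw [op_smul_eq_smul]; rfl)

lemma slope_algebraMap (r : ℝ) : (algebraMap ℝ Jet r).slope = 0 := rfl

lemma abs_val_le (a : Jet) : |a.val| ≤ ‖a‖ := by
  rw [norm_eq]; linarith [norm_nonneg a.slope]

lemma norm_slope_le (a : Jet) : ‖a.slope‖ ≤ ‖a‖ := by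
  rw [norm_eq]; linarith [abs_nonneg a.val]

/-- The value as a continuous linear map. -/
def valCLM : Jet →L[ℝ] ℝ :=
  LinearMap.mkContinuous ⟨⟨val, val_add⟩, fun _ _ => rfl⟩ 1 fun a => by
    rw [one_mul]; exact abs_val_le a

/-- The covector as a continuous linear map. -/
def slopeCLM : Jet →L[ℝ] (E3 →L[ℝ] ℝ) :=
  LinearMap.mkContinuous ⟨⟨slope, slope_add⟩, fun _ _ => rfl⟩ 1 fun a => by
    rw [one_mul]; exact norm_slope_le a

lemma continuous_val : Continuous val := valCLM.continuous

lemma continuous_slope : Continuous slope := slopeCLM.continuous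

lemma continuous_mk {X : Type*} [TopologicalSpace X] {f : X → ℝ} {d : X → E3 →L[ℝ] ℝ}
    (hf : Continuous f) (hd : Continuous d) : Continuous fun x => mk (f x) (d x) := by
  refine continuous_iff_continuousAt.2 fun x => tendsto_iff_norm_sub_tendsto_zero.2 ?_
  simp only [norm_eq, val_sub, slope_sub, val_mk, slope_mk]
  have h1 := tendsto_iff_norm_sub_tendsto_zero.1 (hf.tendsto x)
  have h2 := tendsto_iff_norm_sub_tendsto_zero.1 (hd.tendsto x)
  simpa using h1.add h2

end Jet

/-- The bounded jet fields which come from a function `φ` with `φ` and `wt • fderiv φ` bounded. -/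
def weightedSubalgebra : Subalgebra ℝ (E3 →ᵇ Jet) where
  carrier := {F | ∀ x, HasFDerivAt (fun y => (F y).val) ((wt x)⁻¹ • (F x).slope) x}
  mul_mem' {F G} hF hG x := by
    refine ((hF x).mul (hG x)).congr_fderiv ?_
    rw [BoundedContinuousFunction.mul_apply, Jet.slope_mul, smul_add, smul_comm (wt x)⁻¹,
      smul_comm (wt x)⁻¹ (G x).val]
  add_mem' {F G} hF hG x := by
    refine ((hF x).add (hG x)).congr_fderiv ?_
    rw [BoundedContinuousFunction.add_apply, Jet.slope_add, smul_add]
  algebraMap_mem' r x := by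
    refine (hasFDerivAt_const r x).congr_fderiv ?_
    change 0 = (wt x)⁻¹ • (algebraMap ℝ Jet r).slope
    rw [Jet.slope_algebraMap, smul_zero]

lemma isClosed_weightedSubalgebra : IsClosed (weightedSubalgebra : Set (E3 →ᵇ Jet)) := by
  refine IsSeqClosed.isClosed fun F F₀ hF hlim => ?_
  have hu := BoundedContinuousFunction.tendsto_iff_tendstoUniformly.1 hlim
  refine hasFDerivAt_of_tendstoUniformly (l := atTop)
    (f' := fun n x => (wt x)⁻¹ • (F n x).slope) ?_ hF fun x => ?_
  · rw [Metric.tendstoUniformly_iff] at hu ⊢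
    intro ε hε
    filter_upwards [hu ε hε] with n hn x
    refine lt_of_le_of_lt ?_ (hn x)
    rw [dist_eq_norm, dist_eq_norm, ← smul_sub, ← Jet.slope_sub, norm_smul]
    have h1 : ‖(wt x)⁻¹‖ ≤ 1 := by
      rw [norm_inv, Real.norm_of_nonneg (wt_pos x).le]
      exact inv_le_one_of_one_le₀ (one_le_wt x)
    exact (mul_le_of_le_one_left (norm_nonneg _) h1).trans (Jet.norm_slope_le _)
  · exact (Jet.continuous_val.tendsto _).comp (hu.tendsto_at x)

/-- The Banach algebra of `C¹` functions `φ` with `φ` and `wt • fderiv φ` bounded. -/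
def WAlg : Type := weightedSubalgebra

namespace WAlg

instance : NormedCommRing WAlg := inferInstanceAs (NormedCommRing weightedSubalgebra)

instance : NormedAlgebra ℝ WAlg := inferInstanceAs (NormedAlgebra ℝ weightedSubalgebra)

instance : CompleteSpace WAlg := isClosed_weightedSubalgebra.completeSpace_coe

/-- The bounded jet field of an element. -/
def jet (φ : WAlg) : E3 →ᵇ Jet := φ.1

/-- Evaluation at a point, as an algebra homomorphism. -/
def ev (x : E3) : WAlg →ₐ[ℝ] ℝ where
  toFun φ := (φ.jet x).val
  map_one' := rfl
  map_mul' _ _ := rfl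
  map_zero' := rfl
  map_add' _ _ := rfl
  commutes' _ := rfl

lemma hasFDerivAt_ev (φ : WAlg) (x : E3) :
    HasFDerivAt (fun y => ev y φ) ((wt x)⁻¹ • (φ.jet x).slope) x := φ.2 x

lemma abs_ev_le (φ : WAlg) (x : E3) : |ev x φ| ≤ ‖φ‖ :=
  (Jet.abs_val_le _).trans (φ.jet.norm_coe_le_norm x)

lemma contDiff_ev (φ : WAlg) : ContDiff ℝ 1 fun x => ev x φ := by
  refine contDiff_one_iff_hasFDerivAt.2 ⟨_, ?_, hasFDerivAt_ev φ⟩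
  exact ((contDiff_wt (n := 0)).continuous.inv₀ fun x => (wt_pos x).ne').smul
    (Jet.continuous_slope.comp φ.jet.continuous)

lemma abs_pd_ev_le (φ : WAlg) (i : Fin 3) (x : E3) :
    |pd (fun y => ev y φ) i x| ≤ ‖φ‖ * wt x ^ (-1 : ℝ) := by
  refine (abs_pd_le _ _ _).trans ?_
  rw [(hasFDerivAt_ev φ x).fderiv, norm_smul, norm_inv, Real.norm_of_nonneg (wt_pos x).le,
    Real.rpow_neg_one, mul_comm]
  have := wt_pos x
  gcongr
  exact (Jet.norm_slope_le _).trans (φ.jet.norm_coe_le_norm x)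

lemma ext {φ ψ : WAlg} (h : ∀ x, ev x φ = ev x ψ) : φ = ψ := by
  refine Subtype.ext (BoundedContinuousFunction.ext fun x => Jet.ext (h x) ?_)
  have h1 := hasFDerivAt_ev φ x
  rw [show (fun y => ev y φ) = fun y => ev y ψ from funext h] at h1
  exact smul_right_injective _ (inv_ne_zero (wt_pos x).ne') (h1.unique (hasFDerivAt_ev ψ x))

/-- The weighted `C¹` bound which makes `f` an element of `WAlg`. -/
structure IsBounded (M : ℝ) (f : E3 → ℝ) : Prop where
  smooth : ContDiff ℝ 1 f
  bound : ∀ x, |f x| ≤ M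
  bound_pd : ∀ i x, |pd f i x| ≤ M * wt x ^ (-1 : ℝ)

lemma IsBounded.norm_le {M : ℝ} {f : E3 → ℝ} (hf : IsBounded M f) (x : E3) :
    ‖Jet.mk (f x) (wt x • fderiv ℝ f x)‖ ≤ 4 * M := by
  have hw := wt_pos x
  rw [Jet.norm_eq, Jet.val_mk, Jet.slope_mk, norm_smul, Real.norm_of_nonneg hw.le]
  have h1 := norm_fderiv_le_of_pd fun i => hf.bound_pd i x
  have h2 : wt x * ‖fderiv ℝ f x‖ ≤ 3 * M := by
    calc _ ≤ wt x * (3 * (M * wt x ^ (-1 : ℝ))) := by gcongr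
      _ = 3 * M := by rw [Real.rpow_neg_one]; field_simp
  linarith [hf.bound x]

/-- The element of `WAlg` with a given underlying function. -/
def ofFun {M : ℝ} (f : E3 → ℝ) (hf : IsBounded M f) : WAlg :=
  ⟨BoundedContinuousFunction.ofNormedAddCommGroup
    (fun x => Jet.mk (f x) (wt x • fderiv ℝ f x))
    (Jet.continuous_mk hf.smooth.continuous
      ((contDiff_wt (n := 0)).continuous.smul (hf.smooth.continuous_fderiv one_ne_zero)))
    (4 * M) hf.norm_le, fun x => by
      refine ((hf.smooth.differentiable one_ne_zero x).hasFDerivAt).congr_fderiv ?_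
      change _ = (wt x)⁻¹ • (wt x • fderiv ℝ f x)
      rw [inv_smul_smul₀ (wt_pos x).ne']⟩

lemma ev_ofFun {M : ℝ} {f : E3 → ℝ} (hf : IsBounded M f) (x : E3) : ev x (ofFun f hf) = f x := rfl

lemma norm_ofFun_le {M : ℝ} {f : E3 → ℝ} (hf : IsBounded M f) : ‖ofFun f hf‖ ≤ 4 * M :=
  BoundedContinuousFunction.norm_ofNormedAddCommGroup_le _
    (by linarith [(abs_nonneg _).trans (hf.bound 0)]) hf.norm_le

end WAlg

/-- The source `wt ^ (-(3 + q)) * φ`. -/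
def weightedSource (q : ℝ) (φ : WAlg) (x : E3) : ℝ := wt x ^ (-(3 + q)) * WAlg.ev x φ

variable {q : ℝ}

lemma isSource_weightedSource (hq : 0 < q) (φ : WAlg) :
    IsSource q ((4 + q) * ‖φ‖) (weightedSource q φ) := by
  have h0 := norm_nonneg φ
  refine ⟨(contDiff_wt_rpow _).mul φ.contDiff_ev, fun x => ?_, fun i x => ?_⟩
  · have := wt_rpow_pos (-(3 + q)) x
    rw [weightedSource, abs_mul, abs_of_pos this, mul_comm]
    gcongr
    nlinarith [φ.abs_ev_le x]
  · have e1 : wt x ^ (-(3 + q)) * wt x ^ (-1 : ℝ) = wt x ^ (-(3 + q + 1)) := by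
      rw [← Real.rpow_add (wt_pos x)]; ring_nf
    have h1 := abs_pd_wt_rpow_le (-(3 + q)) i x
    rw [abs_neg, abs_of_pos (show 0 < 3 + q by linarith), show -(3 + q) - 1 = -(3 + q + 1) by ring] at h1
    have h2 := φ.abs_pd_ev_le i x
    have h3 := φ.abs_ev_le x
    have hw := wt_rpow_pos (-(3 + q)) x
    have hw' := wt_rpow_pos (-(3 + q + 1)) x
    change |pd (fun y => wt y ^ (-(3 + q)) * WAlg.ev y φ) i x| ≤ _
    rw [pd_mul ((contDiff_wt_rpow (n := 1) _).differentiable one_ne_zero x)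
      (φ.contDiff_ev.differentiable one_ne_zero x)]
    refine (abs_add_le _ _).trans ?_
    rw [abs_mul, abs_mul, abs_of_pos hw]
    calc _ ≤ (3 + q) * wt x ^ (-(3 + q + 1)) * ‖φ‖
          + wt x ^ (-(3 + q)) * (‖φ‖ * wt x ^ (-1 : ℝ)) := by gcongr
      _ = (4 + q) * ‖φ‖ * wt x ^ (-(3 + q + 1)) := by rw [← e1]; ring

lemma weightedSource_add (φ ψ : WAlg) :
    weightedSource q (φ + ψ) = fun x => weightedSource q φ x + weightedSource q ψ x := by
  ext x; simp only [weightedSource, map_add]; ring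

lemma weightedSource_smul (c : ℝ) (φ : WAlg) :
    weightedSource q (c • φ) = fun x => c * weightedSource q φ x := by
  ext x; simp only [weightedSource, map_smul, smul_eq_mul]; ring

/-- A family of functions which depends linearly on `φ` and obeys the weighted bound is given by a
continuous linear operator on `WAlg`. -/
lemma exists_clm_of_isBounded (F : WAlg → E3 → ℝ) (K : ℝ)
    (hF : ∀ φ, WAlg.IsBounded (K * ‖φ‖) (F φ))
    (hadd : ∀ φ ψ x, F (φ + ψ) x = F φ x + F ψ x) (hsmul : ∀ (c : ℝ) φ x, F (c • φ) x = c * F φ x) :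
    ∃ T : WAlg →L[ℝ] WAlg, ∀ φ x, WAlg.ev x (T φ) = F φ x := by
  refine ⟨LinearMap.mkContinuous ⟨⟨fun φ => WAlg.ofFun _ (hF φ), fun φ ψ => ?_⟩, fun c φ => ?_⟩
    (4 * K) fun φ => ?_, fun φ x => rfl⟩
  · exact WAlg.ext fun x => by rw [map_add]; exact hadd φ ψ x
  · exact WAlg.ext fun x => by rw [map_smul]; exact hsmul c φ x
  · refine (WAlg.norm_ofFun_le (hF φ)).trans (le_of_eq (by ring))

/-- The Newtonian potential as an operator on `WAlg`. -/
theorem exists_potential (hq : 0 < q) (hq1 : q < 1) :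
    ∃ (T : WAlg →L[ℝ] WAlg) (T' : Fin 3 → WAlg →L[ℝ] WAlg), ∀ φ, ∃ v : E3 → ℝ,
      ContDiff ℝ 2 v ∧ (∀ x, WAlg.ev x (T φ) = v x) ∧
      (∀ k x, WAlg.ev x (T' k φ) = wt x ^ 2 * pd v k x) ∧
      (∀ x, ∑ k, pd (pd v k) k x = wt x ^ (-(3 + q)) * WAlg.ev x φ) ∧
      ∃ c, IsO2 (fun x => v x - c / ‖x‖) (1 + q) 1 := by
  obtain ⟨C, hC0, hC⟩ := exists_newton_bounds hq hq1
  have hs := isSource_weightedSource hq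
  have hN2 : ∀ φ, ContDiff ℝ 2 (newton (weightedSource q φ)) := fun φ => contDiff_newton hq (hs φ)
  have hNadd : ∀ φ ψ, newton (weightedSource q (φ + ψ)) =
      fun x => newton (weightedSource q φ) x + newton (weightedSource q ψ) x := fun φ ψ => by
    rw [weightedSource_add, newton_add hq (hs φ) (hs ψ)]
  have hNsmul : ∀ (c : ℝ) φ, newton (weightedSource q (c • φ)) =
      fun x => c * newton (weightedSource q φ) x := fun c φ => by
    rw [weightedSource_smul, newton_const_mul]
  have hNd : ∀ φ x, DifferentiableAt ℝ (newton (weightedSource q φ)) x := fun φ =>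
    (hN2 φ).differentiable (by norm_num)
  obtain ⟨T, hT⟩ := exists_clm_of_isBounded (fun φ => newton (weightedSource q φ)) (C * (4 + q))
    (fun φ => by
      have hM : 0 ≤ C * ((4 + q) * ‖φ‖) := mul_nonneg hC0 (mul_nonneg (by linarith) (norm_nonneg _))
      obtain ⟨h0, h1, -⟩ := hC _ _ (hs φ)
      refine ⟨(hN2 φ).of_le (by norm_num), fun x => (h0 x).trans ?_, fun i x => (h1 i x).trans ?_⟩
      · rw [mul_assoc C (4 + q)]
        refine mul_le_of_le_one_right hM ?_
        exact Real.rpow_le_one_of_one_le_of_nonpos (one_le_wt x) (by norm_num)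
      · rw [mul_assoc C (4 + q)]
        exact mul_le_mul_of_nonneg_left (wt_rpow_le (by norm_num) x) hM)
    (fun φ ψ x => congrFun (hNadd φ ψ) x) (fun c φ x => congrFun (hNsmul c φ) x)
  have hT' : ∀ k, ∃ T : WAlg →L[ℝ] WAlg, ∀ φ x, WAlg.ev x (T φ) =
      wt x ^ 2 * pd (newton (weightedSource q φ)) k x := fun k => by
    refine exists_clm_of_isBounded (fun φ x => wt x ^ 2 * pd (newton (weightedSource q φ)) k x)
      (3 * (C * (4 + q))) (fun φ => ?_) (fun φ ψ x => ?_) fun c φ x => ?_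
    · obtain ⟨-, h1, h2, -⟩ := hC _ _ (hs φ)
      have hM : 0 ≤ C * ((4 + q) * ‖φ‖) := mul_nonneg hC0 (mul_nonneg (by linarith) (norm_nonneg _))
      have hp : ContDiff ℝ 1 (pd (newton (weightedSource q φ)) k) := ContDiff.pd (hN2 φ) k
      set M := C * ((4 + q) * ‖φ‖) with hMdef
      have hM' : 3 * (C * (4 + q)) * ‖φ‖ = 3 * M := by rw [hMdef]; ring
      clear_value M
      rw [hM']
      refine ⟨(contDiff_wt.pow 2).mul hp, fun x => ?_, fun i x => ?_⟩
      · have h := h1 k x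
        have hw := wt_pos x
        rw [abs_mul, abs_of_pos (by positivity)]
        calc _ ≤ wt x ^ 2 * (M * wt x ^ (-2 : ℝ)) := by gcongr
          _ = M := by
            rw [Real.rpow_neg hw.le]
            norm_cast
            field_simp
          _ ≤ 3 * M := by linarith
      · have hw := wt_pos x
        have hd : pd (fun y => wt y ^ 2) i x = 2 * x i := by
          have h := pd_comp (φ := fun t => t ^ 2) (hasDerivAt_pow 2 (wt x))
            ((contDiff_wt (n := 1)).differentiable one_ne_zero x) i
          rw [h, pd_wt, Nat.cast_two, show 2 - 1 = 1 from rfl]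
          field_simp
        rw [pd_mul (((contDiff_wt (n := 1)).pow 2).differentiable one_ne_zero x)
          (hp.differentiable one_ne_zero x), hd]
        refine (abs_add_le _ _).trans ?_
        rw [abs_mul, abs_mul, abs_mul, abs_two, abs_of_pos (by positivity : 0 < wt x ^ 2)]
        have hx : |x i| ≤ wt x := (abs_coord_le x i).trans (norm_le_wt x)
        have h := h1 k x
        have h' := h2 k i x
        calc _ ≤ 2 * wt x * (M * wt x ^ (-2 : ℝ)) + wt x ^ 2 * (M * wt x ^ (-3 : ℝ)) := by gcongr
          _ = 3 * M * wt x ^ (-1 : ℝ) := by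
            rw [Real.rpow_neg hw.le, Real.rpow_neg hw.le, Real.rpow_neg hw.le]
            norm_cast
            field_simp
            norm_num
    · rw [hNadd, pd_add (hNd φ x) (hNd ψ x)]; ring
    · rw [hNsmul, pd_const_mul (hNd φ x)]; ring
  choose T' hT' using hT'
  exact ⟨T, T', fun φ => ⟨newton (weightedSource q φ), hN2 φ, hT φ, fun k => hT' k φ,
    laplacian_newton hq (hs φ), (hC _ _ (hs φ)).2.2.2⟩⟩

end VacuumData

namespace VacuumData

section Algebra

variable {R : Type*} [CommRing R] [Algebra ℝ R]

/-- The cofactor matrix. -/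
def cof (A : Fin 3 → Fin 3 → R) (i j : Fin 3) : R :=
  A (i + 1) (j + 1) * A (i + 2) (j + 2) - A (i + 1) (j + 2) * A (i + 2) (j + 1)

/-- The polarization of the cofactor matrix. -/
def cofPolar (A B : Fin 3 → Fin 3 → R) (i j : Fin 3) : R :=
  A (i + 1) (j + 1) * B (i + 2) (j + 2) + B (i + 1) (j + 1) * A (i + 2) (j + 2)
    - (A (i + 1) (j + 2) * B (i + 2) (j + 1) + B (i + 1) (j + 2) * A (i + 2) (j + 1))

/-- The determinant. -/
def det3 (A : Fin 3 → Fin 3 → R) : R := ∑ j, A 0 j * cof A 0 j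

/-- The Christoffel symbols as a function of the inverse metric `h` and of `d k i j = ∂ₖ gᵢⱼ`. -/
def chr (h : Fin 3 → Fin 3 → R) (d : Fin 3 → Fin 3 → Fin 3 → R) (k i j : Fin 3) : R :=
  (1 / 2 : ℝ) • ∑ l, h k l * (d j i l + d i j l - d l i j)

/-- The part of the scalar curvature which involves only first derivatives of the metric. -/
def curvLow (h : Fin 3 → Fin 3 → R) (d dh : Fin 3 → Fin 3 → Fin 3 → R) : R :=
  ∑ i, ∑ k, h i k * ((∑ j, (chr (dh j) d j i k - chr (dh i) d j j k))
    + ∑ j, ∑ m, (chr h d m i k * chr h d j j m - chr h d m j k * chr h d j i m))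

/-- The part of the scalar curvature which involves second derivatives of the metric. -/
def curvTop (h : Fin 3 → Fin 3 → R) (dd : Fin 3 → Fin 3 → Fin 3 → Fin 3 → R) : R :=
  ∑ i, ∑ k, h i k * ∑ j, (chr h (dd j) j i k - chr h (dd i) j j k)

/-- Lowering both indices of `p` with the metric. -/
def lower (g p : Fin 3 → Fin 3 → R) (i j : Fin 3) : R := ∑ a, ∑ b, g i a * g j b * p a b

/-- The part of the divergence of `lower g p` which does not involve derivatives of `p`. -/
def divLow (h g p : Fin 3 → Fin 3 → R) (d : Fin 3 → Fin 3 → Fin 3 → R) (j : Fin 3) : R :=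
  ∑ i, ∑ k, h i k * ((∑ a, ∑ b, (d i k a * g j b + g k a * d i j b) * p a b)
    - (∑ l, chr h d l i k * lower g p l j) - ∑ l, chr h d l i j * lower g p k l)

/-- The derivative of `s` when `s ^ 2 * det3 G = 1`. -/
def dScale (s : R) (G : Fin 3 → Fin 3 → R) (dG : Fin 3 → Fin 3 → Fin 3 → R) (k : Fin 3) : R :=
  (-(1 / 2) : ℝ) • (s ^ 3 * ∑ i, ∑ j, cof G i j * dG k i j)

/-- The derivative of `s • cof G` when `s ^ 2 * det3 G = 1`. -/
def dMetric (s : R) (G : Fin 3 → Fin 3 → R) (dG : Fin 3 → Fin 3 → Fin 3 → R) (k i j : Fin 3) : R :=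
  dScale s G dG k * cof G i j + s * cofPolar G (dG k) i j

/-- The derivative of `s • G` when `s ^ 2 * det3 G = 1`. -/
def dInv (s : R) (G : Fin 3 → Fin 3 → R) (dG : Fin 3 → Fin 3 → Fin 3 → R) (k i j : Fin 3) : R :=
  dScale s G dG k * G i j + s * dG k i j

/-- The squared norm of a tensor. -/
def normSqLow (h π : Fin 3 → Fin 3 → R) : R :=
  ∑ i, ∑ j, ∑ k, ∑ l, h i j * h k l * π i k * π j l

/-- The trace of a tensor. -/
def traceLow (h π : Fin 3 → Fin 3 → R) : R := ∑ i, ∑ j, h i j * π i j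

/-- The nonlinearity of the Hamiltonian constraint. -/
def hamLow (s : R) (G p : Fin 3 → Fin 3 → R) (dG : Fin 3 → Fin 3 → Fin 3 → R) : R :=
  (∑ i, ∑ j, cofPolar (dMetric s G dG i) (dMetric s G dG j) i j)
    + s * det3 G * (curvLow (fun i j => s * G i j) (dMetric s G dG) (dInv s G dG)
      - normSqLow (fun i j => s * G i j) (lower (fun i j => s * cof G i j) p)
      + (1 / 2 : ℝ) • traceLow (fun i j => s * G i j) (lower (fun i j => s * cof G i j) p) ^ 2)

/-- The nonlinearity of the momentum constraint. -/
def momLow (s : R) (G p : Fin 3 → Fin 3 → R) (dG : Fin 3 → Fin 3 → Fin 3 → R) (b : Fin 3) : R :=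
  -∑ j, s * G b j * divLow (fun i j => s * G i j) (fun i j => s * cof G i j) p (dMetric s G dG) j

end Algebra

lemma cof_symm {A : Fin 3 → Fin 3 → ℝ} (hA : ∀ i j, A i j = A j i) (i j : Fin 3) :
    cof A i j = cof A j i := by
  simp only [cof]
  rw [hA (i + 1), hA (i + 2), hA (i + 1), hA (i + 2)]
  ring

lemma cof_smul_cof {s : ℝ} {G : Fin 3 → Fin 3 → ℝ} (h : s ^ 2 * det3 G = 1) (i j : Fin 3) :
    cof (fun i j => s * cof G i j) i j = G i j := by
  rw [← one_mul (G i j), ← h]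
  fin_cases i <;> fin_cases j <;>
  · simp [cof, det3, Fin.sum_univ_three]
    ring

lemma sum_smul_cof_mul {s : ℝ} {G : Fin 3 → Fin 3 → ℝ} (hG : ∀ i j, G i j = G j i)
    (h : s ^ 2 * det3 G = 1) (i j : Fin 3) :
    ∑ k, s * cof G i k * (s * G k j) = if i = j then 1 else 0 := by
  have : (if i = j then (1 : ℝ) else 0) = (if i = j then 1 else 0) * (s ^ 2 * det3 G) := by
    rw [h, mul_one]
  rw [this]
  fin_cases i <;> fin_cases j <;>
  · simp [cof, det3, Fin.sum_univ_three, hG 1 0, hG 2 0, hG 2 1]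
    ring

section Derivatives

variable {A : Fin 3 → Fin 3 → E3 → ℝ} {x : E3}

lemma pd_cof (hA : ∀ i j, DifferentiableAt ℝ (A i j) x) (i j k : Fin 3) :
    pd (fun y => cof (fun a b => A a b y) i j) k x =
      cofPolar (fun a b => A a b x) (fun a b => pd (A a b) k x) i j := by
  simp only [cof, cofPolar]
  simp (disch := fun_prop) only [pd_sub, pd_mul]
  ring

lemma contDiff_cof {n : WithTop ℕ∞} (hA : ∀ i j, ContDiff ℝ n (A i j)) (i j : Fin 3) :
    ContDiff ℝ n fun y => cof (fun a b => A a b y) i j := by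
  simp only [cof]
  exact ((hA _ _).mul (hA _ _)).sub ((hA _ _).mul (hA _ _))

lemma differentiableAt_cof (hA : ∀ i j, DifferentiableAt ℝ (A i j) x) (i j : Fin 3) :
    DifferentiableAt ℝ (fun y => cof (fun a b => A a b y) i j) x := by
  simp only [cof]
  exact ((hA _ _).mul (hA _ _)).sub ((hA _ _).mul (hA _ _))

lemma contDiff_det3 {n : WithTop ℕ∞} (hA : ∀ i j, ContDiff ℝ n (A i j)) :
    ContDiff ℝ n fun y => det3 (fun a b => A a b y) := by
  simp only [det3]
  exact ContDiff.sum fun j _ => (hA _ _).mul (contDiff_cof hA _ _)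

lemma pd_det3 (hA : ∀ i j, DifferentiableAt ℝ (A i j) x) (k : Fin 3) :
    pd (fun y => det3 (fun a b => A a b y)) k x =
      ∑ i, ∑ j, cof (fun a b => A a b x) i j * pd (A i j) k x := by
  simp only [det3]
  rw [pd_sum fun j _ => (hA 0 j).fun_mul (differentiableAt_cof hA 0 j)]
  simp_rw [pd_mul (hA 0 _) (differentiableAt_cof hA 0 _), pd_cof hA]
  simp only [cof, cofPolar, Fin.sum_univ_three]
  simp only [Fin.isValue, show (0 : Fin 3) + 1 = 1 from rfl, show (0 : Fin 3) + 2 = 2 from rfl,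
    show (1 : Fin 3) + 1 = 2 from rfl, show (1 : Fin 3) + 2 = 0 from rfl,
    show (2 : Fin 3) + 1 = 0 from rfl, show (2 : Fin 3) + 2 = 1 from rfl]
  ring

/-- A derivative of `cofPolar` when its first argument is `A` and its second is independent. -/
lemma pd_cofPolar {B : Fin 3 → Fin 3 → E3 → ℝ} (hA : ∀ i j, DifferentiableAt ℝ (A i j) x)
    (hB : ∀ i j, DifferentiableAt ℝ (B i j) x) (i j k : Fin 3) :
    pd (fun y => cofPolar (fun a b => A a b y) (fun a b => B a b y) i j) k x =
      cofPolar (fun a b => pd (A a b) k x) (fun a b => B a b x) i j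
        + cofPolar (fun a b => A a b x) (fun a b => pd (B a b) k x) i j := by
  simp only [cofPolar]
  simp (disch := fun_prop) only [pd_sub, pd_add, pd_mul]
  ring

end Derivatives

lemma curvTop_eq {G : Fin 3 → Fin 3 → ℝ} (hG : ∀ i j, G i j = G j i)
    {dd : Fin 3 → Fin 3 → Fin 3 → Fin 3 → ℝ} (h1 : ∀ k l i j, dd k l i j = dd l k i j)
    (h2 : ∀ k l i j, dd k l i j = dd k l j i) :
    curvTop G dd = - ∑ i, ∑ j, cofPolar (cof G) (dd i j) i j := by
  simp only [curvTop, chr, cofPolar, cof, Fin.sum_univ_three, smul_eq_mul]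
  simp only [Fin.isValue, show (0 : Fin 3) + 1 = 1 from rfl, show (0 : Fin 3) + 2 = 2 from rfl,
    show (1 : Fin 3) + 1 = 2 from rfl, show (1 : Fin 3) + 2 = 0 from rfl,
    show (2 : Fin 3) + 1 = 0 from rfl, show (2 : Fin 3) + 2 = 1 from rfl, hG 1 0, hG 2 0, hG 2 1,
    h1 1 0, h1 2 0, h1 2 1, h2 _ _ 1 0, h2 _ _ 2 0, h2 _ _ 2 1]
  ring

end VacuumData

namespace VacuumData

/-- A scalar `s` and a symmetric matrix field `G` for which `s • cof G` is a metric with inverse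
`s • G` and cofactor matrix `G`. -/
structure IsConformal (s : E3 → ℝ) (G : Fin 3 → Fin 3 → E3 → ℝ) : Prop where
  smooth_scale : ContDiff ℝ 1 s
  smooth : ∀ i j, ContDiff ℝ 2 (G i j)
  symm : ∀ i j, G i j = G j i
  det_eq : ∀ x, s x ^ 2 * det3 (fun i j => G i j x) = 1

/-- The metric `s • cof G`. -/
def metric (s : E3 → ℝ) (G : Fin 3 → Fin 3 → E3 → ℝ) (x : E3) : Matrix (Fin 3) (Fin 3) ℝ :=
  fun i j => s x * cof (fun a b => G a b x) i j

/-- The momentum tensor with contravariant components `p`. -/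
def momentum (s : E3 → ℝ) (G p : Fin 3 → Fin 3 → E3 → ℝ) (x : E3) : Matrix (Fin 3) (Fin 3) ℝ :=
  fun i j => lower (fun a b => s x * cof (fun a b => G a b x) a b) (fun a b => p a b x) i j

namespace IsConformal

variable {s : E3 → ℝ} {G p : Fin 3 → Fin 3 → E3 → ℝ}

lemma symm_apply (h : IsConformal s G) (x : E3) (i j : Fin 3) : G i j x = G j i x :=
  congrFun (h.symm i j) x

lemma differentiable (h : IsConformal s G) (i j : Fin 3) (x : E3) :
    DifferentiableAt ℝ (G i j) x := (h.smooth i j).differentiable (by norm_num) x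

lemma differentiable_scale (h : IsConformal s G) (x : E3) : DifferentiableAt ℝ s x :=
  h.smooth_scale.differentiable one_ne_zero x

lemma pd_scale (h : IsConformal s G) (k : Fin 3) (x : E3) :
    pd s k x = dScale (s x) (fun i j => G i j x) (fun k i j => pd (G i j) k x) k := by
  have hs := h.differentiable_scale x
  have hD : DifferentiableAt ℝ (fun y => det3 fun i j => G i j y) x :=
    (contDiff_det3 h.smooth).differentiable (by norm_num) x
  have h1 : pd (fun y => s y ^ 2 * det3 fun i j => G i j y) k x = 0 := by
    rw [funext h.det_eq, pd_const]
  simp only [pow_two] at h1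
  rw [pd_mul (hs.fun_mul hs) hD, pd_mul hs hs, pd_det3 fun i j => h.differentiable i j x] at h1
  have h2 := h.det_eq x
  simp only [dScale, smul_eq_mul]
  linear_combination (1 / 2) * s x * h1 - pd s k x * h2

lemma contDiff_scale (h : IsConformal s G) : ContDiff ℝ 2 s := by
  refine contDiff_succ_of_pd (n := 1) (h.smooth_scale.differentiable one_ne_zero) fun k => ?_
  rw [show pd s k = _ from funext fun x => h.pd_scale k x]
  simp only [dScale, smul_eq_mul]
  refine contDiff_const.mul ((h.smooth_scale.pow 3).mul
    (ContDiff.sum fun i _ => ContDiff.sum fun j _ => ?_))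
  exact (contDiff_cof (fun i j => (h.smooth i j).of_le (by norm_num)) i j).mul
    (ContDiff.pd (h.smooth i j) k)

lemma contDiff_metric (h : IsConformal s G) (i j : Fin 3) :
    ContDiff ℝ 2 fun x => metric s G x i j :=
  h.contDiff_scale.mul (contDiff_cof h.smooth i j)

lemma metric_symm (h : IsConformal s G) (x : E3) (i j : Fin 3) :
    metric s G x i j = metric s G x j i := by
  simp only [metric, cof_symm (h.symm_apply x) i j]

lemma inv_metric (h : IsConformal s G) (x : E3) (i j : Fin 3) :
    (metric s G x)⁻¹ i j = s x * G i j x := by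
  rw [Matrix.inv_eq_right_inv (B := Matrix.of fun i j => s x * G i j x), Matrix.of_apply]
  ext i j
  rw [Matrix.mul_apply, Matrix.one_apply]
  exact sum_smul_cof_mul (h.symm_apply x) (h.det_eq x) i j

lemma pd_metric (h : IsConformal s G) (k i j : Fin 3) (x : E3) :
    pd (fun y => metric s G y i j) k x =
      dMetric (s x) (fun i j => G i j x) (fun k i j => pd (G i j) k x) k i j := by
  have hG := fun i j => h.differentiable i j x
  simp only [metric]
  rw [pd_mul (h.differentiable_scale x) (differentiableAt_cof hG i j), pd_cof hG, h.pd_scale,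
    dMetric]

lemma pd_inv (h : IsConformal s G) (k i j : Fin 3) (x : E3) :
    pd (fun y => s y * G i j y) k x =
      dInv (s x) (fun i j => G i j x) (fun k i j => pd (G i j) k x) k i j := by
  rw [pd_mul (h.differentiable_scale x) (h.differentiable i j x), h.pd_scale, dInv]

lemma Gamma_eq (h : IsConformal s G) (k i j : Fin 3) (x : E3) :
    Gamma (metric s G) k i j x = chr (fun i j => s x * G i j x)
      (fun k i j => pd (fun y => metric s G y i j) k x) k i j := by
  simp only [Gamma, chr, h.inv_metric, smul_eq_mul]

lemma pd_Gamma (h : IsConformal s G) (k i j l : Fin 3) (x : E3) :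
    pd (fun y => Gamma (metric s G) k i j y) l x =
      chr (fun a b => pd (fun y => s y * G a b y) l x)
        (fun k i j => pd (fun y => metric s G y i j) k x) k i j
      + chr (fun a b => s x * G a b x)
        (fun k i j => pd (pd (fun y => metric s G y i j) k) l x) k i j := by
  have h1 : ∀ a b c, DifferentiableAt ℝ (pd (fun y => metric s G y a b) c) x := fun a b c =>
    (ContDiff.pd (n := 1) (h.contDiff_metric a b) c).differentiable one_ne_zero x
  have h2 : ∀ a b, DifferentiableAt ℝ (fun y => s y * G a b y) x := fun a b =>
    (h.differentiable_scale x).fun_mul (h.differentiable a b x)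
  rw [show (fun y => Gamma (metric s G) k i j y) = _ from funext fun y => h.Gamma_eq k i j y]
  simp only [chr, smul_eq_mul]
  rw [pd_const_mul (by fun_prop), pd_sum fun a _ => by fun_prop, ← mul_add,
    ← Finset.sum_add_distrib]
  congr 1
  refine Finset.sum_congr rfl fun a _ => ?_
  rw [pd_mul (h2 k a) (by fun_prop), pd_sub (by fun_prop) (h1 _ _ _), pd_add (h1 _ _ _) (h1 _ _ _)]

/-- The second derivatives of `G` in terms of those of the metric. -/
lemma sum_pd_pd (h : IsConformal s G) (x : E3) :
    ∑ i, ∑ j, cofPolar (fun a b => metric s G x a b)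
        (fun a b => pd (pd (fun y => metric s G y a b) j) i x) i j =
      ∑ i, ∑ j, pd (pd (G i j) j) i x
      - ∑ i, ∑ j, cofPolar (fun a b => pd (fun y => metric s G y a b) i x)
        (fun a b => pd (fun y => metric s G y a b) j x) i j := by
  have hm := h.contDiff_metric
  have hd : ∀ a b y, DifferentiableAt ℝ (fun y => metric s G y a b) y := fun a b =>
    (hm a b).differentiable (by norm_num)
  have hd' : ∀ a b c y, DifferentiableAt ℝ (pd (fun y => metric s G y a b) c) y := fun a b c =>
    (ContDiff.pd (n := 1) (hm a b) c).differentiable one_ne_zero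
  have e : ∀ i j, G i j = fun y => cof (fun a b => metric s G y a b) i j := fun i j =>
    funext fun y => (cof_smul_cof (h.det_eq y) i j).symm
  have e' : ∀ i j, pd (G i j) j = fun y => cofPolar (fun a b => metric s G y a b)
      (fun a b => pd (fun y => metric s G y a b) j y) i j := fun i j => by
    funext y
    conv_lhs => rw [e i j]
    exact pd_cof (fun a b => hd a b y) i j j
  rw [← Finset.sum_sub_distrib]
  refine Finset.sum_congr rfl fun i _ => ?_
  rw [← Finset.sum_sub_distrib]
  refine Finset.sum_congr rfl fun j _ => ?_
  rw [e' i j, pd_cofPolar (A := fun a b y => metric s G y a b) (fun a b => hd a b x)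
    (fun a b => hd' a b j x)]
  ring

lemma curvTop_metric (h : IsConformal s G) (x : E3) :
    curvTop (fun i j => s x * G i j x)
        (fun l k i j => pd (pd (fun y => metric s G y i j) k) l x) =
      - s x * ∑ i, ∑ j, cofPolar (fun a b => metric s G x a b)
        (fun a b => pd (pd (fun y => metric s G y a b) j) i x) i j := by
  have h1 := curvTop_eq (h.symm_apply x)
    (dd := fun l k i j => pd (pd (fun y => metric s G y i j) k) l x)
    (fun k l i j => pd_comm (h.contDiff_metric i j) l k x)
    (fun k l i j => by simp only [h.metric_symm _ i j])
  have h2 : ∀ dd : Fin 3 → Fin 3 → Fin 3 → Fin 3 → ℝ, curvTop (fun i j => s x * G i j x) dd =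
      s x ^ 2 * curvTop (fun i j => G i j x) dd := fun dd => by
    simp only [curvTop, chr, Finset.mul_sum, smul_eq_mul]
    refine Finset.sum_congr rfl fun i _ => Finset.sum_congr rfl fun k _ =>
      Finset.sum_congr rfl fun j _ => ?_
    rw [← Finset.sum_sub_distrib, ← Finset.sum_sub_distrib, Finset.mul_sum, Finset.mul_sum,
      Finset.mul_sum]
    exact Finset.sum_congr rfl fun l _ => by ring
  rw [h2, h1]
  rw [mul_neg, neg_mul]
  simp only [Finset.mul_sum, cofPolar, metric]
  congr 1
  exact Finset.sum_congr rfl fun i _ => Finset.sum_congr rfl fun j _ => by ring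

lemma scalarCurvature_eq (h : IsConformal s G) (x : E3) :
    scalarCurvature (metric s G) x =
      curvLow (fun i j => s x * G i j x)
        (dMetric (s x) (fun i j => G i j x) (fun k i j => pd (G i j) k x))
        (dInv (s x) (fun i j => G i j x) (fun k i j => pd (G i j) k x))
      - s x * (∑ i, ∑ j, pd (pd (G i j) j) i x
        - ∑ i, ∑ j, cofPolar
          (dMetric (s x) (fun i j => G i j x) (fun k i j => pd (G i j) k x) i)
          (dMetric (s x) (fun i j => G i j x) (fun k i j => pd (G i j) k x) j) i j) := by
  have e1 : (fun k i j => pd (fun y => metric s G y i j) k x) =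
      dMetric (s x) (fun i j => G i j x) (fun k i j => pd (G i j) k x) := by
    funext k i j; exact h.pd_metric k i j x
  have e2 : ∀ k, (fun i j => pd (fun y => s y * G i j y) k x) =
      dInv (s x) (fun i j => G i j x) (fun k i j => pd (G i j) k x) k := fun k => by
    funext i j; exact h.pd_inv k i j x
  have h1 := h.curvTop_metric x
  rw [h.sum_pd_pd] at h1
  have e3 : ∀ k, (fun i j => pd (fun y => metric s G y i j) k x) =
      dMetric (s x) (fun i j => G i j x) (fun k i j => pd (G i j) k x) k := fun k => by
    funext i j; exact h.pd_metric k i j x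
  simp only [e3] at h1
  rw [sub_eq_add_neg, ← neg_mul, ← h1]
  simp only [scalarCurvature, h.pd_Gamma]
  simp only [h.Gamma_eq, e1, e2, h.inv_metric, curvLow, curvTop]
  rw [← Finset.sum_add_distrib]
  refine Finset.sum_congr rfl fun i _ => ?_
  rw [← Finset.sum_add_distrib]
  refine Finset.sum_congr rfl fun k _ => ?_
  rw [← mul_add]
  congr 1
  simp only [← Finset.sum_add_distrib]
  exact Finset.sum_congr rfl fun j _ => by ring

lemma hamiltonian_eq (h : IsConformal s G) (x : E3) :
    hamiltonian (metric s G) (momentum s G p) x = s x *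
      (hamLow (s x) (fun i j => G i j x) (fun i j => p i j x) (fun k i j => pd (G i j) k x)
        - ∑ i, ∑ j, pd (pd (G i j) j) i x) := by
  have h1 := h.det_eq x
  have h2 : normSq (metric s G) (momentum s G p) x = normSqLow (fun i j => s x * G i j x)
      (lower (fun a b => s x * cof (fun a b => G a b x) a b) (fun a b => p a b x)) := by
    simp only [normSq, h.inv_metric]; rfl
  have h3 : traceT (metric s G) (momentum s G p) x = traceLow (fun i j => s x * G i j x)
      (lower (fun a b => s x * cof (fun a b => G a b x) a b) (fun a b => p a b x)) := by
    simp only [traceT, h.inv_metric]; rfl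
  rw [hamiltonian, h.scalarCurvature_eq, h2, h3, hamLow, smul_eq_mul]
  set L := curvLow (fun i j => s x * G i j x) _ _
  set N := normSqLow (fun i j => s x * G i j x) _
  set T := traceLow (fun i j => s x * G i j x) _
  linear_combination (-(L - N + 1 / 2 * T ^ 2)) * h1

lemma divT_eq (h : IsConformal s G) (hp : ∀ i j, ContDiff ℝ 1 (p i j)) (j : Fin 3) (x : E3) :
    divT (metric s G) (momentum s G p) j x =
      ∑ b, metric s G x j b * ((∑ i, pd (p i b) i x)
        - momLow (s x) (fun i j => G i j x) (fun i j => p i j x)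
          (fun k i j => pd (G i j) k x) b) := by
  have e1 : (fun k i j => pd (fun y => metric s G y i j) k x) =
      dMetric (s x) (fun i j => G i j x) (fun k i j => pd (G i j) k x) := by
    funext k i j; exact h.pd_metric k i j x
  have hd : ∀ a b, DifferentiableAt ℝ (fun y => metric s G y a b) x := fun a b =>
    (h.contDiff_metric a b).differentiable (by norm_num) x
  have hp' : ∀ a b, DifferentiableAt ℝ (p a b) x := fun a b =>
    (hp a b).differentiable one_ne_zero x
  have e2 : ∀ i k, pd (fun y => momentum s G p y k j) i x =
      (∑ a, ∑ b, (pd (fun y => metric s G y k a) i x * metric s G x j b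
        + metric s G x k a * pd (fun y => metric s G y j b) i x) * p a b x)
      + ∑ a, ∑ b, metric s G x k a * metric s G x j b * pd (p a b) i x := fun i k => by
    change pd (fun y => ∑ a, ∑ b, metric s G y k a * metric s G y j b * p a b y) i x = _
    rw [pd_sum fun a _ => by fun_prop, ← Finset.sum_add_distrib]
    refine Finset.sum_congr rfl fun a _ => ?_
    rw [pd_sum fun b _ => by fun_prop, ← Finset.sum_add_distrib]
    refine Finset.sum_congr rfl fun b _ => ?_
    rw [pd_mul (by fun_prop) (by fun_prop), pd_mul (by fun_prop) (by fun_prop)]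
  have e3 : ∀ (f : Fin 3 → Fin 3 → Fin 3 → ℝ), ∑ i, ∑ k, s x * G i k x *
      (∑ a, ∑ b, metric s G x k a * metric s G x j b * f a b i) =
      ∑ b, metric s G x j b * ∑ i, f i b i := fun f => by
    have hδ : ∀ a i, ∑ k, s x * G i k x * metric s G x k a = if a = i then 1 else 0 :=
      fun a i => by
        rw [← sum_smul_cof_mul (h.symm_apply x) (h.det_eq x) a i]
        refine Finset.sum_congr rfl fun k _ => ?_
        rw [h.metric_symm, h.symm_apply, metric]; ring
    calc _ = ∑ i, ∑ a, ∑ b, (∑ k, s x * G i k x * metric s G x k a) *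
          (metric s G x j b * f a b i) := by
          refine Finset.sum_congr rfl fun i _ => ?_
          simp only [Finset.mul_sum, Finset.sum_mul]
          rw [Finset.sum_comm]
          refine Finset.sum_congr rfl fun a _ => ?_
          rw [Finset.sum_comm]
          exact Finset.sum_congr rfl fun b _ => Finset.sum_congr rfl fun k _ => by ring
      _ = ∑ i, ∑ b, metric s G x j b * f i b i := by
          refine Finset.sum_congr rfl fun i _ => ?_
          simp only [hδ, ite_mul, one_mul, zero_mul]
          rw [Finset.sum_comm]
          simp
      _ = _ := by
          rw [Finset.sum_comm]
          simp only [Finset.mul_sum]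
  have e4 : ∑ b, metric s G x j b * momLow (s x) (fun i j => G i j x) (fun i j => p i j x)
      (fun k i j => pd (G i j) k x) b = - divLow (fun i j => s x * G i j x)
        (fun i j => metric s G x i j) (fun i j => p i j x)
        (dMetric (s x) (fun i j => G i j x) (fun k i j => pd (G i j) k x)) j := by
    simp only [momLow, mul_neg, Finset.sum_neg_distrib, Finset.mul_sum]
    rw [Finset.sum_comm]
    congr 1
    calc _ = ∑ m, (∑ b, s x * cof (fun a b => G a b x) j b * (s x * G b m x)) *
          divLow (fun i j => s x * G i j x) (fun i j => metric s G x i j) (fun i j => p i j x)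
            (dMetric (s x) (fun i j => G i j x) (fun k i j => pd (G i j) k x)) m := by
          refine Finset.sum_congr rfl fun m _ => ?_
          rw [Finset.sum_mul]
          exact Finset.sum_congr rfl fun b _ => by simp only [metric]; ring
      _ = _ := by simp [sum_smul_cof_mul (h.symm_apply x) (h.det_eq x)]
  simp only [mul_sub, Finset.sum_sub_distrib]
  rw [e4, ← e3 fun a b i => pd (p a b) i x, sub_neg_eq_add, divLow, ← Finset.sum_add_distrib]
  rw [divT]
  refine Finset.sum_congr rfl fun i _ => ?_
  rw [← Finset.sum_add_distrib]
  refine Finset.sum_congr rfl fun k _ => ?_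
  rw [e2, ← e1, ← mul_add]
  simp only [h.Gamma_eq, h.inv_metric]
  congr 1
  simp only [momentum, metric]
  ring

end IsConformal

end VacuumData

namespace VacuumData

lemma rpow_le_of_comparable (s : ℝ) {a b K : ℝ} (ha : 0 < a) (hb : 0 < b) (hK : 0 < K)
    (h1 : a ≤ K * b) (h2 : b ≤ K * a) : a ^ s ≤ K ^ |s| * b ^ s := by
  rcases le_total 0 s with hs | hs
  · rw [abs_of_nonneg hs, ← Real.mul_rpow hK.le hb.le]
    exact Real.rpow_le_rpow ha.le h1 hs
  · rw [abs_of_nonpos hs]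
    have := Real.rpow_le_rpow_of_nonpos hb h2 hs
    rw [Real.mul_rpow hK.le ha.le] at this
    calc a ^ s = K ^ (-s) * (K ^ s * a ^ s) := by
          rw [← mul_assoc, ← Real.rpow_add hK]; simp
      _ ≤ _ := by gcongr

lemma norm_rpow_le_wt_rpow (s : ℝ) {x : E3} (hx : 1 ≤ ‖x‖) : ‖x‖ ^ s ≤ 2 ^ |s| * wt x ^ s :=
  rpow_le_of_comparable s (by linarith) (wt_pos x) two_pos
    (by linarith [norm_le_wt x, wt_pos x]) (wt_le_two_mul hx)

lemma wt_rpow_le_norm_rpow (s : ℝ) {x : E3} (hx : 1 ≤ ‖x‖) : wt x ^ s ≤ 2 ^ |s| * ‖x‖ ^ s :=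
  rpow_le_of_comparable s (wt_pos x) (by linarith) two_pos (wt_le_two_mul hx)
    (by linarith [norm_le_wt x, wt_pos x])

lemma exists_wt_smul_rpow_le (s : ℝ) {c : ℝ} (hc : 0 < c) :
    ∃ K, ∀ x : E3, wt (c • x) ^ s ≤ K * wt x ^ s := by
  have hle : ∀ {d : ℝ} {x y : E3}, ‖x‖ ≤ d * ‖y‖ → 0 ≤ d → wt x ≤ (1 + d) * wt y := by
    intro d x y h hd
    have hy := wt_pos y
    refine (sq_le_sq₀ (wt_pos x).le (by positivity)).1 ?_
    rw [mul_pow, wt_sq, wt_sq]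
    have := pow_le_pow_left₀ (norm_nonneg x) h 2
    nlinarith [sq_nonneg ‖y‖, mul_nonneg hd (sq_nonneg ‖y‖)]
  have hci : 0 < c⁻¹ := inv_pos.2 hc
  refine ⟨(1 + c + c⁻¹) ^ |s|, fun x => rpow_le_of_comparable s (wt_pos _) (wt_pos x)
    (by positivity) ?_ ?_⟩
  · refine (hle (y := x) (by rw [norm_smul, Real.norm_of_nonneg hc.le]) hc.le).trans ?_
    nlinarith [wt_pos x]
  · refine (hle (y := c • x) ?_ hci.le).trans ?_
    · rw [norm_smul, Real.norm_of_nonneg hc.le, inv_mul_cancel_left₀ hc.ne']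
    · nlinarith [wt_pos (c • x)]

lemma pd_comp_smul (f : E3 → ℝ) (c : ℝ) (i : Fin 3) (x : E3) :
    pd (fun y => f (c • y)) i x = c * pd f i (c • x) := by
  simp only [pd]
  rw [fderiv_comp_smul]
  rfl

/-- `f` is homogeneous of degree `s` outside the ball of radius `R`. -/
def IsHomogeneous (R : ℝ) (f : E3 → ℝ) (s : ℝ) : Prop :=
  ∀ c : ℝ, 1 ≤ c → ∀ x : E3, R < ‖x‖ → f (c • x) = c ^ s * f x

namespace IsHomogeneous

variable {R R' s t : ℝ} {f g : E3 → ℝ}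

lemma mono (hf : IsHomogeneous R f s) (h : R ≤ R') : IsHomogeneous R' f s :=
  fun c hc x hx => hf c hc x (h.trans_lt hx)

lemma norm_lt_norm_smul {c : ℝ} (hc : 1 ≤ c) {x : E3} (hx : R < ‖x‖) : R < ‖c • x‖ := by
  rw [norm_smul, Real.norm_of_nonneg (by linarith)]
  nlinarith [norm_nonneg x]

lemma congr (hf : IsHomogeneous R f s) (h : ∀ x, R < ‖x‖ → g x = f x) : IsHomogeneous R g s :=
  fun c hc x hx => by rw [h x hx, h _ (norm_lt_norm_smul hc hx), hf c hc x hx]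

lemma of_eq_zero (h : ∀ x, R < ‖x‖ → f x = 0) : IsHomogeneous R f s :=
  fun c hc x hx => by rw [h x hx, h _ (norm_lt_norm_smul hc hx), mul_zero]

lemma mul (hf : IsHomogeneous R f s) (hg : IsHomogeneous R g t) :
    IsHomogeneous R (fun x => f x * g x) (s + t) := fun c hc x hx => by
  simp only [hf c hc x hx, hg c hc x hx]
  rw [Real.rpow_add (by linarith)]
  ring

lemma coord (i : Fin 3) : IsHomogeneous R (fun x => x i) 1 := fun c hc x hx => by simp

lemma derivative (hf : IsHomogeneous R f s) (hd : Differentiable ℝ f) (i : Fin 3) :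
    IsHomogeneous R (pd f i) (s - 1) := fun c hc x hx => by
  have hc0 : 0 < c := by linarith
  have h1 : (fun y => f (c • y)) =ᶠ[𝓝 x] fun y => c ^ s * f y := by
    filter_upwards [(isOpen_lt continuous_const continuous_norm).mem_nhds hx] with y hy
    exact hf c hc y hy
  have h2 := pd_congr h1 i
  rw [pd_comp_smul, pd_const_mul (hd x)] at h2
  rw [Real.rpow_sub_one hc0.ne']
  field_simp
  linarith

/-- Euler's identity. -/
lemma sum_coord_mul_pd (hf : IsHomogeneous R f s) {x : E3} (hx : R < ‖x‖)
    (hd : DifferentiableAt ℝ f x) : ∑ i, x i * pd f i x = s * f x := by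
  have h1 : HasDerivAt (fun c : ℝ => f (c • x)) (fderiv ℝ f x x) 1 := by
    have h := (hasDerivAt_id (1 : ℝ)).smul_const x
    simp only [id, one_smul] at h
    exact HasFDerivAt.comp_hasDerivAt (1 : ℝ) (by simpa using hd.hasFDerivAt) h
  have h2 : HasDerivAt (fun c : ℝ => c ^ s * f x) (s * f x) 1 := by
    simpa using (Real.hasDerivAt_rpow_const (x := 1) (p := s) (Or.inl one_ne_zero)).mul_const (f x)
  have h3 : (fun c : ℝ => f (c • x)) =ᶠ[𝓝 1] fun c => c ^ s * f x := by
    have hc : ContinuousAt (fun c : ℝ => ‖c • x‖) 1 := by fun_prop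
    have hc' : ∀ᶠ c in 𝓝 (1 : ℝ), R < ‖c • x‖ := hc.eventually (lt_mem_nhds (by simpa using hx))
    filter_upwards [hc', lt_mem_nhds zero_lt_one] with c h hc0
    rcases le_total 1 c with h1 | h1
    · exact hf c h1 x hx
    · have h2 := hf c⁻¹ (one_le_inv₀ hc0 |>.2 h1) (c • x) h
      rw [inv_smul_smul₀ hc0.ne', Real.inv_rpow hc0.le] at h2
      have := Real.rpow_pos_of_pos hc0 s
      rw [h2]
      field_simp
  have h4 := h1.unique (h2.congr_of_eventuallyEq h3)
  rw [← h4, clm_apply_eq_sum]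
  exact Finset.sum_congr rfl fun i _ => mul_comm _ _

end IsHomogeneous

/-- `IsSymbol n f s`: the derivatives of `f` of order `k ≤ n` are `O(wt ^ (s - k))`. -/
def IsSymbol : ℕ → (E3 → ℝ) → ℝ → Prop
  | 0, f, s => Continuous f ∧ ∃ C, ∀ x, |f x| ≤ C * wt x ^ s
  | n + 1, f, s => Differentiable ℝ f ∧ (∃ C, ∀ x, |f x| ≤ C * wt x ^ s) ∧
      ∀ i, IsSymbol n (pd f i) (s - 1)

namespace IsSymbol

variable {n : ℕ} {f g : E3 → ℝ} {s t : ℝ}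

lemma exists_bound (h : IsSymbol n f s) : ∃ C, ∀ x, |f x| ≤ C * wt x ^ s := by
  cases n with
  | zero => exact h.2
  | succ n => exact h.2.1

lemma nonneg_of_bound {C : ℝ} (h : ∀ x, |f x| ≤ C * wt x ^ s) : 0 ≤ C :=
  nonneg_of_mul_nonneg_left ((abs_nonneg _).trans (h 0)) (wt_rpow_pos s 0)

lemma contDiff (h : IsSymbol n f s) : ContDiff ℝ n f := by
  induction n generalizing f s with
  | zero => simpa using h.1
  | succ n ih =>
    have := contDiff_succ_of_pd h.1 fun i => ih (h.2.2 i)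
    exact_mod_cast this

lemma differentiable (h : IsSymbol (n + 1) f s) (x : E3) : DifferentiableAt ℝ f x := h.1 x

lemma derivative (h : IsSymbol (n + 1) f s) (i : Fin 3) : IsSymbol n (pd f i) (s - 1) := h.2.2 i

lemma of_succ (h : IsSymbol (n + 1) f s) : IsSymbol n f s := by
  induction n generalizing f s with
  | zero => exact ⟨h.1.continuous, h.2.1⟩
  | succ n ih => exact ⟨h.1, h.2.1, fun i => ih (h.2.2 i)⟩

lemma mono (h : IsSymbol n f s) (hst : s ≤ t) : IsSymbol n f t := by
  have hb : ∀ {f : E3 → ℝ} {s t : ℝ}, (∃ C, ∀ x, |f x| ≤ C * wt x ^ s) → s ≤ t →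
      ∃ C, ∀ x, |f x| ≤ C * wt x ^ t := fun ⟨C, hC⟩ hst => ⟨C, fun x => (hC x).trans
    (mul_le_mul_of_nonneg_left (wt_rpow_le hst x) (nonneg_of_bound hC))⟩
  induction n generalizing f s t with
  | zero => exact ⟨h.1, hb h.2 hst⟩
  | succ n ih => exact ⟨h.1, hb h.2.1 hst, fun i => ih (h.2.2 i) (by linarith)⟩

lemma exists_bound_add (hf : ∃ C, ∀ x, |f x| ≤ C * wt x ^ s)
    (hg : ∃ C, ∀ x, |g x| ≤ C * wt x ^ s) : ∃ C, ∀ x, |f x + g x| ≤ C * wt x ^ s := by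
  obtain ⟨C, hC⟩ := hf
  obtain ⟨D, hD⟩ := hg
  exact ⟨C + D, fun x => (abs_add_le _ _).trans (by linarith [hC x, hD x])⟩

lemma exists_bound_mul (hf : ∃ C, ∀ x, |f x| ≤ C * wt x ^ s)
    (hg : ∃ C, ∀ x, |g x| ≤ C * wt x ^ t) : ∃ C, ∀ x, |f x * g x| ≤ C * wt x ^ (s + t) := by
  obtain ⟨C, hC⟩ := hf
  obtain ⟨D, hD⟩ := hg
  refine ⟨C * D, fun x => ?_⟩
  have := nonneg_of_bound hC
  have := wt_rpow_pos s x
  rw [abs_mul, Real.rpow_add (wt_pos x)]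
  calc _ ≤ (C * wt x ^ s) * (D * wt x ^ t) := by gcongr; exacts [hC x, hD x]
    _ = _ := by ring

lemma add (hf : IsSymbol n f s) (hg : IsSymbol n g s) : IsSymbol n (fun x => f x + g x) s := by
  induction n generalizing f g s with
  | zero => exact ⟨hf.1.add hg.1, exists_bound_add hf.2 hg.2⟩
  | succ n ih =>
    refine ⟨hf.1.fun_add hg.1, exists_bound_add hf.2.1 hg.2.1, fun i => ?_⟩
    rw [funext fun x => pd_add (hf.1 x) (hg.1 x) i]
    exact ih (hf.2.2 i) (hg.2.2 i)

lemma zero : IsSymbol n (fun _ => 0) s := by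
  induction n generalizing s with
  | zero => exact ⟨continuous_const, 0, fun x => by simp⟩
  | succ n ih =>
    refine ⟨differentiable_const _, ⟨0, fun x => by simp⟩, fun i => ?_⟩
    rw [funext fun x => pd_const 0 i x]
    exact ih

lemma const (c : ℝ) : IsSymbol n (fun _ => c) 0 := by
  have hb : ∃ C, ∀ x, |c| ≤ C * wt x ^ (0 : ℝ) := ⟨|c|, fun x => by simp⟩
  cases n with
  | zero => exact ⟨continuous_const, hb⟩
  | succ n =>
    refine ⟨differentiable_const _, hb, fun i => ?_⟩
    rw [funext fun x => pd_const c i x]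
    exact zero

lemma mul (hf : IsSymbol n f s) (hg : IsSymbol n g t) :
    IsSymbol n (fun x => f x * g x) (s + t) := by
  induction n generalizing f g s t with
  | zero => exact ⟨hf.1.mul hg.1, exists_bound_mul hf.2 hg.2⟩
  | succ n ih =>
    refine ⟨hf.1.fun_mul hg.1, exists_bound_mul hf.2.1 hg.2.1, fun i => ?_⟩
    rw [funext fun x => pd_mul (hf.1 x) (hg.1 x) i]
    refine add ?_ ?_
    · simpa [sub_add_eq_add_sub] using ih (hf.2.2 i) hg.of_succ
    · simpa [add_sub_assoc] using ih hf.of_succ (hg.2.2 i)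

lemma const_mul (c : ℝ) (hf : IsSymbol n f s) : IsSymbol n (fun x => c * f x) s := by
  simpa using (const c).mul hf

lemma neg (hf : IsSymbol n f s) : IsSymbol n (fun x => -f x) s := by
  simpa using hf.const_mul (-1)

lemma sub (hf : IsSymbol n f s) (hg : IsSymbol n g s) : IsSymbol n (fun x => f x - g x) s := by
  simpa [sub_eq_add_neg] using hf.add hg.neg

lemma sum {ι : Type*} {S : Finset ι} {F : ι → E3 → ℝ} (h : ∀ a ∈ S, IsSymbol n (F a) s) :
    IsSymbol n (fun x => ∑ a ∈ S, F a x) s := by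
  classical
  induction S using Finset.induction_on with
  | empty => simpa using zero
  | insert a S ha ih =>
    simp only [Finset.sum_insert ha]
    exact (h a (Finset.mem_insert_self a S)).add
      (ih fun b hb => h b (Finset.mem_insert_of_mem hb))

/-- Bounds outside a ball suffice. -/
lemma of_exterior {R : ℝ} (hf : Continuous f)
    (h : ∃ C, ∀ x, R ≤ ‖x‖ → |f x| ≤ C * wt x ^ s) : ∃ C, ∀ x, |f x| ≤ C * wt x ^ s := by
  obtain ⟨C, hC⟩ := h
  have hc : Continuous fun x => f x * wt x ^ (-s) := hf.mul (contDiff_wt_rpow (n := 0) _).continuous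
  obtain ⟨D, hD⟩ := (isCompact_closedBall (0 : E3) R).exists_bound_of_continuousOn hc.continuousOn
  refine ⟨max C D, fun x => ?_⟩
  have hw := wt_rpow_pos s x
  rcases le_total R ‖x‖ with hx | hx
  · exact (hC x hx).trans (mul_le_mul_of_nonneg_right (le_max_left _ _) hw.le)
  · have := hD x (by simpa using hx)
    rw [norm_mul, Real.norm_eq_abs, Real.norm_of_nonneg (wt_rpow_pos _ x).le,
      Real.rpow_neg (wt_pos x).le, ← div_eq_mul_inv, div_le_iff₀ hw] at this
    exact this.trans (mul_le_mul_of_nonneg_right (le_max_right _ _) hw.le)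

lemma of_homogeneous {R : ℝ} (hR : 0 ≤ R) (hf : ContDiff ℝ n f)
    (h : IsHomogeneous R f s) : IsSymbol n f s := by
  have hb : ∀ {f : E3 → ℝ} {s : ℝ}, Continuous f →
      IsHomogeneous R f s →
      ∃ C, ∀ x, |f x| ≤ C * wt x ^ s := fun {f s} hf h => by
    refine of_exterior (R := R + 1) hf ?_
    obtain ⟨D, hD⟩ :=
      (isCompact_closedBall (0 : E3) (R + 1)).exists_bound_of_continuousOn hf.continuousOn
    have hD0 : 0 ≤ D := (norm_nonneg _).trans (hD 0 (by simp; linarith))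
    refine ⟨(R + 1) ^ (-s) * 2 ^ |s| * D, fun x hx => ?_⟩
    have hR1 : 0 < R + 1 := by linarith
    have hx0 : 0 < ‖x‖ := by linarith
    set c := ‖x‖ / (R + 1) with hc
    have hc1 : 1 ≤ c := by rwa [hc, one_le_div hR1]
    have hy : ‖c⁻¹ • x‖ = R + 1 := by
      rw [norm_smul, Real.norm_of_nonneg (by positivity), hc]; field_simp
    have h1 := h c hc1 (c⁻¹ • x) (by linarith)
    rw [smul_inv_smul₀ (by positivity)] at h1
    rw [h1, abs_mul, abs_of_nonneg (by positivity), hc, Real.div_rpow hx0.le hR1.le,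
      Real.rpow_neg hR1.le, div_eq_mul_inv]
    have h2 := norm_rpow_le_wt_rpow s (x := x) (by linarith)
    have h3 := hD (c⁻¹ • x) (by simp [hy])
    rw [Real.norm_eq_abs] at h3
    have hw := wt_pos x
    calc _ ≤ (2 ^ |s| * wt x ^ s) * ((R + 1) ^ s)⁻¹ * D := by gcongr
      _ = _ := by ring
  induction n generalizing f s with
  | zero => exact ⟨hf.continuous, hb hf.continuous h⟩
  | succ n ih =>
    have hd : Differentiable ℝ f := hf.differentiable (by simp)
    exact ⟨hd, hb hf.continuous h,
      fun i => ih (ContDiff.pd (by exact_mod_cast hf) i) (h.derivative hd i)⟩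

lemma of_isO2 {R : ℝ} (hf : ContDiff ℝ 2 f) (h : IsO2 g s 1) (he : ∀ x, R < ‖x‖ → f x = g x) :
    IsSymbol 2 f (-s) := by
  obtain ⟨C, hC⟩ := h
  have hev : ∀ x, R < ‖x‖ → f =ᶠ[𝓝 x] g := fun x hx => by
    filter_upwards [(isOpen_lt continuous_const continuous_norm).mem_nhds hx] with y hy
    exact he y hy
  have key : ∀ {u : E3 → ℝ} {t : ℝ}, Continuous u →
      (∀ x, R < ‖x‖ → 1 ≤ ‖x‖ → |u x| ≤ C * ‖x‖ ^ t) → ∃ C, ∀ x, |u x| ≤ C * wt x ^ t := by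
    intro u t hu hb
    refine of_exterior (R := max (R + 1) 1) hu ⟨|C| * 2 ^ |t|, fun x hx => ?_⟩
    have h1 : 1 ≤ ‖x‖ := (le_max_right _ _).trans hx
    have h0 : R < ‖x‖ := by linarith [(le_max_left (R + 1) 1).trans hx]
    calc _ ≤ C * ‖x‖ ^ t := hb x h0 h1
      _ ≤ |C| * (2 ^ |t| * wt x ^ t) := by
        gcongr
        exacts [le_abs_self C, norm_rpow_le_wt_rpow t h1]
      _ = _ := by ring
  have hp : ∀ i, ContDiff ℝ 1 (pd f i) := fun i => ContDiff.pd hf i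
  refine ⟨hf.differentiable (by norm_num), key hf.continuous fun x hx h1 => ?_, fun i =>
    ⟨(hp i).differentiable one_ne_zero, key (hp i).continuous fun x hx h1 => ?_, fun k =>
      ⟨continuous_pd (hp i) k, key (continuous_pd (hp i) k) fun x hx h1 => ?_⟩⟩⟩
  · rw [he x hx]; exact (hC x h1).1
  · rw [pd_congr (hev x hx)]; exact (hC x h1).2.1 i
  · have : pd f i =ᶠ[𝓝 x] pd g i := by
      filter_upwards [(isOpen_lt continuous_const continuous_norm).mem_nhds hx] with y hy
      exact pd_congr (hev y hy) i
    rw [pd_congr this, show -s - 1 - 1 = -s - 2 by ring]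
    exact (hC x h1).2.2 i k

lemma exists_norm_bound (h : ∃ C, ∀ x, |f x| ≤ C * wt x ^ s) :
    ∃ C, 0 ≤ C ∧ ∀ x : E3, 1 ≤ ‖x‖ → |f x| ≤ C * ‖x‖ ^ s := by
  obtain ⟨C, hC⟩ := h
  have hC0 := nonneg_of_bound hC
  refine ⟨C * 2 ^ |s|, by positivity, fun x hx => (hC x).trans ?_⟩
  rw [mul_assoc]
  exact mul_le_mul_of_nonneg_left (wt_rpow_le_norm_rpow s hx) hC0

lemma isO1 {ρ : ℝ} (hf : IsSymbol 1 f (-s)) (hρ : 1 ≤ ρ) {R : ℝ} (hR : R < ρ)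
    (he : ∀ x, R < ‖x‖ → g x = f x) : IsO1 g s ρ := by
  have hev : ∀ x, R < ‖x‖ → g =ᶠ[𝓝 x] f := fun x hx => by
    filter_upwards [(isOpen_lt continuous_const continuous_norm).mem_nhds hx] with y hy
    exact he y hy
  obtain ⟨C, hC0, hC⟩ := exists_norm_bound hf.exists_bound
  choose D hD0 hD using fun i => exists_norm_bound (hf.derivative i).exists_bound
  refine ⟨C + ∑ i, D i, fun x hx => ⟨?_, fun i => ?_⟩⟩
  · rw [he x (by linarith)]
    refine (hC x (by linarith)).trans ?_
    gcongr
    exact le_add_of_nonneg_right (Finset.sum_nonneg fun i _ => hD0 i)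
  · rw [pd_congr (hev x (by linarith))]
    refine (hD i x (by linarith)).trans ?_
    gcongr
    linarith [Finset.single_le_sum (fun i _ => hD0 i) (Finset.mem_univ i)]

lemma isO2 {ρ : ℝ} (hf : IsSymbol 2 f (-s)) (hρ : 1 ≤ ρ) {R : ℝ} (hR : R < ρ)
    (he : ∀ x, R < ‖x‖ → g x = f x) : IsO2 g s ρ := by
  obtain ⟨C, hC⟩ := hf.of_succ.isO1 hρ hR he
  have hev : ∀ i x, R < ‖x‖ → pd g i =ᶠ[𝓝 x] pd f i := fun i x hx => by
    filter_upwards [(isOpen_lt continuous_const continuous_norm).mem_nhds hx] with y hy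
    refine pd_congr ?_ i
    filter_upwards [(isOpen_lt continuous_const continuous_norm).mem_nhds hy] with z hz
    exact he z hz
  choose D hD0 hD using fun i k =>
    exists_norm_bound ((hf.derivative i).derivative k).exists_bound
  refine ⟨|C| + ∑ i, ∑ k, D i k, fun x hx => ?_⟩
  have hS : 0 ≤ ∑ i, ∑ k, D i k :=
    Finset.sum_nonneg fun i _ => Finset.sum_nonneg fun k _ => hD0 i k
  have hle : C ≤ |C| + ∑ i, ∑ k, D i k := (le_abs_self C).trans (le_add_of_nonneg_right hS)
  obtain ⟨h0, h1⟩ := hC x hx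
  refine ⟨h0.trans (by gcongr), fun i => (h1 i).trans (by gcongr), fun i k => ?_⟩
  rw [pd_congr (hev i x (by linarith))]
  have h2 := hD i k x (by linarith)
  rw [show -s - 1 - 1 = -s - 2 by ring] at h2
  refine h2.trans ?_
  gcongr
  have e1 := Finset.single_le_sum (f := fun i => ∑ k, D i k)
    (fun i _ => Finset.sum_nonneg fun k _ => hD0 i k) (Finset.mem_univ i)
  have e2 := Finset.single_le_sum (fun k _ => hD0 i k) (Finset.mem_univ k)
  linarith [abs_nonneg C]

lemma comp_smul {c : ℝ} (hc : 0 < c) (hf : IsSymbol n f s) :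
    IsSymbol n (fun x => f (c • x)) s := by
  have hb : ∀ {f : E3 → ℝ} {s : ℝ}, (∃ C, ∀ x, |f x| ≤ C * wt x ^ s) →
      ∃ C, ∀ x, |f (c • x)| ≤ C * wt x ^ s := fun {f s} ⟨C, hC⟩ => by
    obtain ⟨K, hK⟩ := exists_wt_smul_rpow_le s hc
    refine ⟨C * K, fun x => (hC _).trans ?_⟩
    rw [mul_assoc]
    exact mul_le_mul_of_nonneg_left (hK x) (nonneg_of_bound hC)
  induction n generalizing f s with
  | zero => exact ⟨hf.1.comp (continuous_const_smul c), hb hf.2⟩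
  | succ n ih =>
    refine ⟨hf.1.comp (differentiable_id.const_smul c), hb hf.2.1, fun i => ?_⟩
    rw [funext fun x => pd_comp_smul f c i x]
    exact (ih (hf.2.2 i)).const_mul c

lemma wt_rpow (s : ℝ) : IsSymbol 1 (fun x => wt x ^ s) s :=
  ⟨(contDiff_wt_rpow (n := 1) s).differentiable one_ne_zero,
    ⟨1, fun x => by rw [abs_of_pos (wt_rpow_pos s x), one_mul]⟩, fun i =>
      ⟨continuous_pd (contDiff_wt_rpow s) i, |s|, abs_pd_wt_rpow_le s i⟩⟩

lemma exists_ev_eq (hf : IsSymbol 1 f 0) : ∃ φ : WAlg, ∀ x, WAlg.ev x φ = f x := by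
  obtain ⟨C, hC⟩ := hf.exists_bound
  choose D hD using fun i => (hf.derivative i).exists_bound
  have hC0 := nonneg_of_bound hC
  have hD0 := fun i => nonneg_of_bound (hD i)
  have hS : 0 ≤ ∑ i, D i := Finset.sum_nonneg fun i _ => hD0 i
  have hB : WAlg.IsBounded (C + ∑ i, D i) f := by
    refine ⟨hf.contDiff, fun x => ?_, fun i x => ?_⟩
    · have := hC x
      rw [Real.rpow_zero] at this
      linarith
    · have := hD i x
      rw [zero_sub] at this
      refine this.trans (mul_le_mul_of_nonneg_right ?_ (wt_rpow_pos _ x).le)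
      linarith [Finset.single_le_sum (fun i _ => hD0 i) (Finset.mem_univ i)]
  exact ⟨WAlg.ofFun f hB, WAlg.ev_ofFun hB⟩

lemma ev (φ : WAlg) : IsSymbol 1 (fun x => WAlg.ev x φ) 0 :=
  ⟨φ.contDiff_ev.differentiable one_ne_zero, ⟨‖φ‖, fun x => by simpa using φ.abs_ev_le x⟩, fun i =>
    ⟨continuous_pd φ.contDiff_ev i, ‖φ‖, fun x => by simpa using φ.abs_pd_ev_le i x⟩⟩

end IsSymbol

end VacuumData

namespace VacuumData

variable {f a ψ : E3 → ℝ}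

/-- A function which is smooth away from the origin agrees, outside a ball, with a smooth function
which vanishes near the origin. -/
lemma exists_contDiff_eq {n : ℕ} (hf : ContDiffOn ℝ n f {x | x ≠ 0}) {r : ℝ} (hr : 0 < r) :
    ∃ a : E3 → ℝ, ContDiff ℝ n a ∧ (∀ x, ‖x‖ < r → a x = 0) ∧ ∀ x, 2 * r ≤ ‖x‖ → a x = f x := by
  refine ⟨fun x => Real.smoothTransition (‖x‖ ^ 2 / r ^ 2 - 1) * f x,
    contDiff_iff_contDiffAt.2 fun x => ?_, fun x hx => ?_, fun x hx => ?_⟩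
  · have hχ : ContDiff ℝ n fun x : E3 => Real.smoothTransition (‖x‖ ^ 2 / r ^ 2 - 1) :=
      Real.smoothTransition.contDiff.comp (((contDiff_norm_sq ℝ).div_const _).sub contDiff_const)
    rcases eq_or_ne x 0 with rfl | hx
    · have h0 : (fun x : E3 => Real.smoothTransition (‖x‖ ^ 2 / r ^ 2 - 1) * f x) =ᶠ[𝓝 0]
          fun _ => 0 := by
        filter_upwards [Metric.ball_mem_nhds (0 : E3) hr] with y hy
        have hy' : ‖y‖ < r := by simpa using hy
        rw [Real.smoothTransition.zero_of_nonpos, zero_mul]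
        rw [sub_nonpos, div_le_one (by positivity)]
        gcongr
      exact contDiffAt_const.congr_of_eventuallyEq h0
    · exact hχ.contDiffAt.mul (hf.contDiffAt (isOpen_ne.mem_nhds hx))
  · simp only
    rw [Real.smoothTransition.zero_of_nonpos, zero_mul]
    rw [sub_nonpos, div_le_one (by positivity)]
    gcongr
  · simp only
    rw [Real.smoothTransition.one_of_one_le, one_mul]
    rw [le_sub_iff_add_le, le_div_iff₀ (by positivity)]
    nlinarith

lemma exists_contDiff_eq_inv_norm_pow (m : ℕ) :
    ∃ ψ : E3 → ℝ, ContDiff ℝ 4 ψ ∧ (∀ x, ‖x‖ < 1 → ψ x = 0) ∧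
      ∀ x, 2 < ‖x‖ → ψ x = (‖x‖ ^ m)⁻¹ := by
  have h : ContDiffOn ℝ (4 : ℕ) (fun x : E3 => (‖x‖ ^ m)⁻¹) {x | x ≠ 0} := fun x hx =>
    (((contDiffAt_norm ℝ hx).pow m).inv (pow_ne_zero m (norm_ne_zero_iff.2 hx))).contDiffWithinAt
  obtain ⟨ψ, h1, h2, h3⟩ := exists_contDiff_eq h one_pos
  exact ⟨ψ, h1, h2, fun x hx => h3 x (by linarith)⟩

lemma isHomogeneous_inv_norm_pow (m : ℕ) {R : ℝ} :
    IsHomogeneous R (fun x => (‖x‖ ^ m)⁻¹) (-m) := fun c hc x hx => by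
  have hc0 : 0 < c := by linarith
  simp only [norm_smul, Real.norm_of_nonneg hc0.le]
  rw [mul_pow, mul_inv, inv_pow_eq_rpow m c hc0.le]

/-- The operator `x · ∇ + k`. -/
def euler (k : ℝ) (ψ : E3 → ℝ) (x : E3) : ℝ := ∑ l, x l * pd ψ l x + k * ψ x

lemma contDiff_euler {n : ℕ} (h : ContDiff ℝ (n + 1) ψ) (k : ℝ) : ContDiff ℝ n (euler k ψ) :=
  (ContDiff.sum fun l _ => (contDiff_coord l).mul (ContDiff.pd h l)).add
    (contDiff_const.mul (h.of_le (by exact_mod_cast Nat.le_succ n)))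

lemma euler_eq_of_isHomogeneous {R s : ℝ} (h : IsHomogeneous R ψ s) (hd : Differentiable ℝ ψ)
    (k : ℝ) {x : E3} (hx : R < ‖x‖) : euler k ψ x = (s + k) * ψ x := by
  rw [euler, h.sum_coord_mul_pd hx (hd x)]
  ring

lemma euler_eq_zero {R : ℝ} (h : ∀ x, ‖x‖ < R → ψ x = 0) (k : ℝ) {x : E3} (hx : ‖x‖ < R) :
    euler k ψ x = 0 := by
  have : ψ =ᶠ[𝓝 x] fun _ => 0 := by
    filter_upwards [(isOpen_lt continuous_norm continuous_const).mem_nhds hx] with y hy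
    exact h y hy
  simp [euler, pd_congr this, pd_const, h x hx]

lemma sum_pd_mul_coord_mul_coord {x : E3} (ha : DifferentiableAt ℝ a x)
    (hψ : DifferentiableAt ℝ ψ x) (h : (∑ l, x l * pd a l x) * ψ x = 0) (i : Fin 3) :
    ∑ j, pd (fun y => a y * ψ y * (y i * y j)) j x = a x * euler 4 ψ x * x i := by
  have hc : ∀ l, DifferentiableAt ℝ (fun y : E3 => y l) x := fun l => differentiable_coord l x
  have e : ∀ j, pd (fun y => a y * ψ y * (y i * y j)) j x =
      (pd a j x * ψ x + a x * pd ψ j x) * (x i * x j)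
        + a x * ψ x * ((if j = i then 1 else 0) * x j + x i) := fun j => by
    rw [pd_mul (ha.fun_mul hψ) ((hc i).fun_mul (hc j)), pd_mul ha hψ, pd_mul (hc i) (hc j), pd_coord,
      pd_coord, if_pos rfl, mul_one]
  simp only [e, euler]
  simp only [Fin.sum_univ_three] at h ⊢
  have : (if (0 : Fin 3) = i then (1 : ℝ) else 0) * x 0 + (if (1 : Fin 3) = i then (1 : ℝ) else 0) * x 1
      + (if (2 : Fin 3) = i then (1 : ℝ) else 0) * x 2 = x i := by
    fin_cases i <;> simp
  linear_combination x i * h + a x * ψ x * this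

lemma sum_pd_mul_coord {x : E3} (ha : DifferentiableAt ℝ a x)
    (hψ : DifferentiableAt ℝ ψ x) (h : (∑ l, x l * pd a l x) * ψ x = 0) :
    ∑ j, pd (fun y => a y * ψ y * y j) j x = a x * euler 3 ψ x := by
  have hc : ∀ l, DifferentiableAt ℝ (fun y : E3 => y l) x := fun l => differentiable_coord l x
  have e : ∀ j, pd (fun y => a y * ψ y * y j) j x =
      (pd a j x * ψ x + a x * pd ψ j x) * x j + a x * ψ x := fun j => by
    rw [pd_mul (ha.fun_mul hψ) (hc j), pd_mul ha hψ, pd_coord, if_pos rfl, mul_one]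
  simp only [e, euler]
  simp only [Fin.sum_univ_three] at h ⊢
  linear_combination h

/-- The angular profile `f` times a cut-off radial profile `‖x‖ ^ (-m)` and two coordinates, together
with its first and second divergence. -/
lemma exists_radial_tensor (hf : ContDiffOn ℝ 2 f {x : E3 | x ≠ 0})
    (hhom : ∀ c : ℝ, 0 < c → ∀ x : E3, x ≠ 0 → f (c • x) = f x) (m : ℕ) :
    ∃ (K : Fin 3 → Fin 3 → E3 → ℝ) (D : Fin 3 → E3 → ℝ) (DD : E3 → ℝ),
      (∀ i j, IsSymbol 2 (K i j) (2 - m)) ∧ (∀ i j, K i j = K j i) ∧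
      (∀ i j x, 2 < ‖x‖ → K i j x = f x * (x i * x j) / ‖x‖ ^ m) ∧
      (∀ i x, ∑ j, pd (K i j) j x = D i x) ∧ (∀ x, ∑ i, pd (D i) i x = DD x) ∧
      (∀ i, ContDiff ℝ 2 (D i)) ∧ ContDiff ℝ 2 DD ∧
      (m = 3 → ∀ x, 2 < ‖x‖ → DD x = 0) ∧ (m = 4 → ∀ i x, 2 < ‖x‖ → D i x = 0) := by
  obtain ⟨a, ha, -, haf⟩ := exists_contDiff_eq (n := 2) hf (r := 1 / 4) (by norm_num)
  obtain ⟨ψ, hψ, hψ0, hψm⟩ := exists_contDiff_eq_inv_norm_pow m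
  have hah : IsHomogeneous (1 / 2) a 0 := by
    refine IsHomogeneous.congr (f := f) (fun c hc x hx => ?_) fun x hx => haf x (by linarith)
    rw [Real.rpow_zero, one_mul]
    exact hhom c (by linarith) x (norm_pos_iff.1 (by linarith))
  have had : Differentiable ℝ a := ha.differentiable (by simp)
  have hψd : Differentiable ℝ ψ := hψ.differentiable (by simp)
  have hψh : IsHomogeneous 2 ψ (-m) := (isHomogeneous_inv_norm_pow m).congr hψm
  have hψ1 : ContDiff ℝ 3 (euler 4 ψ) := contDiff_euler (n := 3) hψ 4
  have hψ1d : Differentiable ℝ (euler 4 ψ) := hψ1.differentiable (by simp)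
  have hψ1z : ∀ x, ‖x‖ < 1 → euler 4 ψ x = 0 := fun x => euler_eq_zero hψ0 4
  have hψ2 : ContDiff ℝ 2 (euler 3 (euler 4 ψ)) := contDiff_euler (n := 2) hψ1 3
  have hz : ∀ {φ : E3 → ℝ}, (∀ x, ‖x‖ < 1 → φ x = 0) → ∀ x,
      (∑ l, x l * pd a l x) * φ x = 0 := fun {φ} hφ x => by
    rcases lt_or_ge ‖x‖ 1 with h | h
    · rw [hφ x h, mul_zero]
    · rw [hah.sum_coord_mul_pd (by linarith) (had x), zero_mul, zero_mul]
  have hD : ∀ i x, ∑ j, pd (fun y => a y * ψ y * (y i * y j)) j x = a x * euler 4 ψ x * x i :=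
    fun i x => sum_pd_mul_coord_mul_coord (had x) (hψd x) (hz hψ0 x) i
  refine ⟨fun i j y => a y * ψ y * (y i * y j), fun i y => a y * euler 4 ψ y * y i,
    fun y => a y * euler 3 (euler 4 ψ) y, fun i j => ?_, fun i j => ?_, fun i j x hx => ?_, hD,
    fun x => sum_pd_mul_coord (had x) (hψ1d x) (hz hψ1z x),
    fun i => (ha.mul (hψ1.of_le (by norm_num))).mul (contDiff_coord i), ha.mul hψ2,
    fun hm x hx => ?_, fun hm i x hx => ?_⟩
  · have h := ((hah.mono (by norm_num)).mul hψh).mul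
      ((IsHomogeneous.coord i).mul (IsHomogeneous.coord j))
    rw [show (0 : ℝ) + -m + (1 + 1) = 2 - m by ring] at h
    exact IsSymbol.of_homogeneous (n := 2) two_pos.le
      ((ha.mul (hψ.of_le (by norm_num))).mul ((contDiff_coord i).mul (contDiff_coord j))) h
  · funext y; ring
  · simp only
    rw [haf x (by linarith), hψm x hx]
    ring
  · subst hm
    have h1 : IsHomogeneous 2 (euler 4 ψ) (-(3 : ℕ)) := hψh.congr fun y hy => by
      rw [euler_eq_of_isHomogeneous hψh hψd 4 hy]; push_cast; ring
    simp only
    rw [euler_eq_of_isHomogeneous h1 hψ1d 3 hx]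
    push_cast; ring
  · subst hm
    simp only
    rw [euler_eq_of_isHomogeneous hψh hψd 4 hx]
    push_cast; ring

/-- A compactly supported function is a symbol of every order. -/
lemma isSymbol_of_eq_zero {n : ℕ} {R s : ℝ} (hR : 0 ≤ R) (hf : ContDiff ℝ n f)
    (h : ∀ x, R < ‖x‖ → f x = 0) : IsSymbol n f s :=
  IsSymbol.of_homogeneous hR hf (IsHomogeneous.of_eq_zero h)

lemma exists_metric_data {α : E3 → ℝ} (hα : ContDiffOn ℝ 2 α {x : E3 | x ≠ 0})
    (hhom : ∀ c : ℝ, 0 < c → ∀ x : E3, x ≠ 0 → α (c • x) = α x) (t : ℝ) :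
    ∃ G : Fin 3 → Fin 3 → E3 → ℝ, (∀ i j, IsSymbol 2 (G i j) (-1)) ∧ (∀ i j, G i j = G j i) ∧
      (∀ i j x, 2 < ‖x‖ → G i j x = -(α x * (x i * x j) / ‖x‖ ^ 3)) ∧
      IsSymbol 1 (fun x => ∑ i, ∑ j, pd (pd (G i j) j) i x) t := by
  obtain ⟨K, D, DD, hK, hsymm, hKeq, hD, hDD, -, hDDc, hDDz, -⟩ := exists_radial_tensor hα hhom 3
  refine ⟨fun i j x => -K i j x, fun i j => ?_, fun i j => by simp only [hsymm i j],
    fun i j x hx => ?_, ?_⟩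
  · have := (hK i j).neg
    norm_num at this
    exact this
  · simp only [hKeq i j x hx]
  · have e : (fun x => ∑ i, ∑ j, pd (pd (fun y => -K i j y) j) i x) = fun x => -DD x := by
      funext x
      rw [← hDD, ← Finset.sum_neg_distrib]
      refine Finset.sum_congr rfl fun i _ => ?_
      have h1 : ∀ j, DifferentiableAt ℝ (pd (K i j) j) x := fun j =>
        ((hK i j).derivative j).differentiable x
      rw [← show (fun y => ∑ j, pd (K i j) j y) = D i from funext (hD i),
        pd_sum fun j _ => h1 j, ← Finset.sum_neg_distrib]
      refine Finset.sum_congr rfl fun j _ => ?_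
      rw [funext fun y => pd_neg (K i j) y j, pd_neg]
    rw [e]
    exact isSymbol_of_eq_zero two_pos.le (hDDc.neg.of_le (by norm_num)) fun x hx => by
      rw [hDDz rfl x hx, neg_zero]

lemma exists_momentum_data {β : E3 → ℝ} (hβ : ContDiffOn ℝ 2 β {x : E3 | x ≠ 0})
    (hhom : ∀ c : ℝ, 0 < c → ∀ x : E3, x ≠ 0 → β (c • x) = β x) (t : ℝ) :
    ∃ P : Fin 3 → Fin 3 → E3 → ℝ, (∀ i j, IsSymbol 1 (P i j) (-2)) ∧ (∀ i j, P i j = P j i) ∧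
      (∀ i j x, 2 < ‖x‖ → P i j x = β x * (x i * x j) / ‖x‖ ^ 4) ∧
      ∀ b, IsSymbol 1 (fun x => ∑ i, pd (P i b) i x) t := by
  obtain ⟨K, D, DD, hK, hsymm, hKeq, hD, -, hDc, -, -, hDz⟩ := exists_radial_tensor hβ hhom 4
  refine ⟨K, fun i j => ?_, hsymm, hKeq, fun b => ?_⟩
  · have := (hK i j).of_succ
    norm_num at this
    exact this
  · have e : (fun x => ∑ i, pd (K i b) i x) = D b := by
      funext x
      rw [← hD]
      exact Finset.sum_congr rfl fun i _ => by rw [hsymm]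
    rw [e]
    exact isSymbol_of_eq_zero two_pos.le ((hDc b).of_le (by norm_num)) (hDz rfl b)

end VacuumData

namespace VacuumData

section Homogeneity

variable (c s : ℝ) (G g h p : Fin 3 → Fin 3 → ℝ) (d dh : Fin 3 → Fin 3 → Fin 3 → ℝ)

lemma chr_smul_right (k i j : Fin 3) :
    chr h (fun k i j => c * d k i j) k i j = c * chr h d k i j := by
  simp only [chr, smul_eq_mul, Finset.mul_sum]
  exact Finset.sum_congr rfl fun l _ => by ring

lemma chr_smul_left (k i j : Fin 3) :
    chr (fun i j => c * h i j) d k i j = c * chr h d k i j := by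
  simp only [chr, smul_eq_mul, Finset.mul_sum]
  exact Finset.sum_congr rfl fun l _ => by ring

lemma curvLow_smul : curvLow h (fun k i j => c * d k i j) (fun k i j => c * dh k i j) =
    c ^ 2 * curvLow h d dh := by
  simp only [curvLow, chr_smul_right, chr_smul_left, Finset.mul_sum]
  refine Finset.sum_congr rfl fun i _ => Finset.sum_congr rfl fun k _ => ?_
  rw [mul_left_comm (c ^ 2), mul_add (c ^ 2)]
  simp only [Finset.mul_sum]
  refine congrArg _ (congrArg₂ _ (Finset.sum_congr rfl fun j _ => by ring)
    (Finset.sum_congr rfl fun j _ => Finset.sum_congr rfl fun m _ => by ring))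

lemma lower_smul (i j : Fin 3) : lower g (fun i j => c * p i j) i j = c * lower g p i j := by
  simp only [lower, Finset.mul_sum]
  exact Finset.sum_congr rfl fun a _ => Finset.sum_congr rfl fun b _ => by ring

lemma divLow_smul (j : Fin 3) : divLow h g (fun i j => c * p i j) (fun k i j => c * d k i j) j =
    c ^ 2 * divLow h g p d j := by
  simp only [divLow, chr_smul_right, lower_smul, Finset.mul_sum]
  refine Finset.sum_congr rfl fun i _ => Finset.sum_congr rfl fun k _ => ?_
  rw [mul_left_comm (c ^ 2), mul_sub (c ^ 2), mul_sub (c ^ 2)]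
  simp only [Finset.mul_sum]
  refine congrArg _ (congrArg₂ _ (congrArg₂ _ ?_ ?_) ?_)
  · exact Finset.sum_congr rfl fun a _ => Finset.sum_congr rfl fun b _ => by ring
  · exact Finset.sum_congr rfl fun a _ => by ring
  · exact Finset.sum_congr rfl fun a _ => by ring

lemma dScale_smul (k : Fin 3) :
    dScale s G (fun k i j => c * d k i j) k = c * dScale s G d k := by
  simp only [dScale, smul_eq_mul, Finset.mul_sum]
  exact Finset.sum_congr rfl fun a _ => Finset.sum_congr rfl fun b _ => by ring

lemma dMetric_smul :
    dMetric s G (fun k i j => c * d k i j) = fun k i j => c * dMetric s G d k i j := by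
  funext k i j
  simp only [dMetric, dScale_smul, cofPolar]
  ring

lemma dInv_smul : dInv s G (fun k i j => c * d k i j) = fun k i j => c * dInv s G d k i j := by
  funext k i j
  simp only [dInv, dScale_smul]
  ring

lemma hamLow_smul : hamLow s G (fun i j => c * p i j) (fun k i j => c * d k i j) =
    c ^ 2 * hamLow s G p d := by
  have h1 : ∀ h π : Fin 3 → Fin 3 → ℝ,
      normSqLow h (fun i j => c * π i j) = c ^ 2 * normSqLow h π := fun h π => by
    simp only [normSqLow, Finset.mul_sum]
    exact Finset.sum_congr rfl fun i _ => Finset.sum_congr rfl fun j _ =>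
      Finset.sum_congr rfl fun k _ => Finset.sum_congr rfl fun l _ => by ring
  have h2 : ∀ h π : Fin 3 → Fin 3 → ℝ,
      traceLow h (fun i j => c * π i j) = c * traceLow h π := fun h π => by
    simp only [traceLow, Finset.mul_sum]
    exact Finset.sum_congr rfl fun i _ => Finset.sum_congr rfl fun j _ => by ring
  have h3 : ∀ A B : Fin 3 → Fin 3 → ℝ, ∀ i j,
      cofPolar (fun i j => c * A i j) (fun i j => c * B i j) i j = c ^ 2 * cofPolar A B i j := by
    intro A B i j
    simp only [cofPolar]
    ring
  have h4 : ∀ g : Fin 3 → Fin 3 → ℝ,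
      lower g (fun i j => c * p i j) = fun i j => c * lower g p i j := fun g => by
    funext i j; exact lower_smul c g p i j
  simp only [hamLow, dMetric_smul, dInv_smul, curvLow_smul, h1, h2, h3, h4, ← Finset.mul_sum,
    smul_eq_mul]
  ring

lemma momLow_smul (b : Fin 3) :
    momLow s G (fun i j => c * p i j) (fun k i j => c * d k i j) b =
      c ^ 2 * momLow s G p d b := by
  simp only [momLow, dMetric_smul, divLow_smul, mul_neg, Finset.mul_sum]
  exact congrArg _ (Finset.sum_congr rfl fun j _ => by ring)

end Homogeneity

section Map

variable {R : Type*} [CommRing R] [Algebra ℝ R] (f : R →ₐ[ℝ] ℝ) (s : R)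
  (G g h p : Fin 3 → Fin 3 → R) (d dh : Fin 3 → Fin 3 → Fin 3 → R)

lemma map_cof (i j : Fin 3) : f (cof G i j) = cof (fun i j => f (G i j)) i j := by
  simp only [cof, map_sub, map_mul]

lemma map_det3 : f (det3 G) = det3 fun i j => f (G i j) := by
  simp only [det3, map_sum, map_mul, map_cof]

lemma map_chr (k i j : Fin 3) :
    f (chr h d k i j) = chr (fun i j => f (h i j)) (fun k i j => f (d k i j)) k i j := by
  simp only [chr, map_add, map_sub, map_mul, map_sum, map_smul]

lemma map_lower (i j : Fin 3) :
    f (lower g p i j) = lower (fun i j => f (g i j)) (fun i j => f (p i j)) i j := by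
  simp only [lower, map_mul, map_sum]

lemma map_dScale (k : Fin 3) : f (dScale s G d k) =
    dScale (f s) (fun i j => f (G i j)) (fun k i j => f (d k i j)) k := by
  simp only [dScale, map_mul, map_sum, map_smul, map_pow, map_cof]

lemma map_dMetric (k i j : Fin 3) : f (dMetric s G d k i j) =
    dMetric (f s) (fun i j => f (G i j)) (fun k i j => f (d k i j)) k i j := by
  simp only [dMetric, cofPolar, map_add, map_sub, map_mul, map_cof, map_dScale]

lemma map_dInv (k i j : Fin 3) : f (dInv s G d k i j) =
    dInv (f s) (fun i j => f (G i j)) (fun k i j => f (d k i j)) k i j := by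
  simp only [dInv, map_add, map_mul, map_dScale]

lemma map_curvLow : f (curvLow h d dh) =
    curvLow (fun i j => f (h i j)) (fun k i j => f (d k i j)) (fun k i j => f (dh k i j)) := by
  simp only [curvLow, map_add, map_sub, map_mul, map_sum, map_chr]

lemma map_divLow (j : Fin 3) : f (divLow h g p d j) =
    divLow (fun i j => f (h i j)) (fun i j => f (g i j)) (fun i j => f (p i j))
      (fun k i j => f (d k i j)) j := by
  simp only [divLow, map_add, map_sub, map_mul, map_sum, map_chr, map_lower]

lemma map_hamLow : f (hamLow s G p d) =
    hamLow (f s) (fun i j => f (G i j)) (fun i j => f (p i j)) (fun k i j => f (d k i j)) := by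
  simp only [hamLow, normSqLow, traceLow, cofPolar, map_det3, map_curvLow, map_lower, map_dMetric,
    map_dInv, map_cof, map_add, map_sub, map_mul, map_sum, map_pow, map_smul]

lemma map_momLow (b : Fin 3) : f (momLow s G p d b) =
    momLow (f s) (fun i j => f (G i j)) (fun i j => f (p i j)) (fun k i j => f (d k i j)) b := by
  simp only [momLow, map_divLow, map_dMetric, map_cof, map_mul, map_sum, map_neg]

end Map

section Smooth

variable {U A : Type*} [NormedAddCommGroup U] [NormedSpace ℝ U] [NormedCommRing A]
  [NormedAlgebra ℝ A] {s : U → A} {G g h p : Fin 3 → Fin 3 → U → A}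
  {d dh : Fin 3 → Fin 3 → Fin 3 → U → A}

lemma contDiff_cof' (hG : ∀ i j, ContDiff ℝ 1 (G i j)) (i j : Fin 3) :
    ContDiff ℝ 1 fun u => cof (fun i j => G i j u) i j := by
  simp only [cof]
  fun_prop

lemma contDiff_chr (hh : ∀ i j, ContDiff ℝ 1 (h i j)) (hd : ∀ k i j, ContDiff ℝ 1 (d k i j))
    (k i j : Fin 3) : ContDiff ℝ 1 fun u => chr (fun i j => h i j u) (fun k i j => d k i j u) k i j := by
  simp only [chr]
  fun_prop

lemma contDiff_curvLow (hh : ∀ i j, ContDiff ℝ 1 (h i j)) (hd : ∀ k i j, ContDiff ℝ 1 (d k i j))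
    (hdh : ∀ k i j, ContDiff ℝ 1 (dh k i j)) :
    ContDiff ℝ 1 fun u => curvLow (fun i j => h i j u) (fun k i j => d k i j u)
      (fun k i j => dh k i j u) := by
  have h1 := contDiff_chr hh hd
  have h2 := fun a => contDiff_chr (hdh a) hd
  simp only [curvLow]
  fun_prop

lemma contDiff_lower (hg : ∀ i j, ContDiff ℝ 1 (g i j)) (hp : ∀ i j, ContDiff ℝ 1 (p i j))
    (i j : Fin 3) : ContDiff ℝ 1 fun u => lower (fun i j => g i j u) (fun i j => p i j u) i j := by
  simp only [lower]
  fun_prop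

lemma contDiff_dScale (hs : ContDiff ℝ 1 s) (hG : ∀ i j, ContDiff ℝ 1 (G i j))
    (hd : ∀ k i j, ContDiff ℝ 1 (d k i j)) (k : Fin 3) :
    ContDiff ℝ 1 fun u => dScale (s u) (fun i j => G i j u) (fun k i j => d k i j u) k := by
  have h1 := contDiff_cof' hG
  simp only [dScale]
  fun_prop

lemma contDiff_dMetric (hs : ContDiff ℝ 1 s) (hG : ∀ i j, ContDiff ℝ 1 (G i j))
    (hd : ∀ k i j, ContDiff ℝ 1 (d k i j)) (k i j : Fin 3) :
    ContDiff ℝ 1 fun u => dMetric (s u) (fun i j => G i j u) (fun k i j => d k i j u) k i j := by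
  have h1 := contDiff_cof' hG
  have h2 := contDiff_dScale hs hG hd
  simp only [dMetric, cofPolar]
  fun_prop

lemma contDiff_hamLow (hs : ContDiff ℝ 1 s) (hG : ∀ i j, ContDiff ℝ 1 (G i j))
    (hp : ∀ i j, ContDiff ℝ 1 (p i j)) (hd : ∀ k i j, ContDiff ℝ 1 (d k i j)) :
    ContDiff ℝ 1 fun u => hamLow (s u) (fun i j => G i j u) (fun i j => p i j u)
      (fun k i j => d k i j u) := by
  have h1 := contDiff_dMetric hs hG hd
  have h2 : ∀ k i j, ContDiff ℝ 1 fun u =>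
      dInv (s u) (fun i j => G i j u) (fun k i j => d k i j u) k i j := fun k i j => by
    have := contDiff_dScale hs hG hd
    simp only [dInv]
    fun_prop
  have hc := contDiff_cof' hG
  have h3 : ∀ i j, ContDiff ℝ 1 fun u => s u * G i j u := fun i j => by fun_prop
  have h4 := contDiff_curvLow h3 h1 h2
  have h5 := contDiff_lower (g := fun i j u => s u * cof (fun i j => G i j u) i j)
    (fun i j => by fun_prop) hp
  simp only [hamLow, normSqLow, traceLow, cofPolar, det3]
  fun_prop

lemma contDiff_momLow (hs : ContDiff ℝ 1 s) (hG : ∀ i j, ContDiff ℝ 1 (G i j))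
    (hp : ∀ i j, ContDiff ℝ 1 (p i j)) (hd : ∀ k i j, ContDiff ℝ 1 (d k i j)) (b : Fin 3) :
    ContDiff ℝ 1 fun u => momLow (s u) (fun i j => G i j u) (fun i j => p i j u)
      (fun k i j => d k i j u) b := by
  have h1 := contDiff_dMetric hs hG hd
  have hc := contDiff_cof' hG
  have h3 : ∀ i j, ContDiff ℝ 1 fun u => s u * G i j u := fun i j => by fun_prop
  have h4 := contDiff_chr h3 h1
  have h5 := contDiff_lower (g := fun i j u => s u * cof (fun i j => G i j u) i j)
    (fun i j => by fun_prop) hp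
  simp only [momLow, divLow]
  fun_prop

end Smooth

/-- Solvability of `u = u₀ + λ • K (u, λ)` for small `λ`. -/
lemma eventually_exists_fixedPoint {U : Type*} [NormedAddCommGroup U] [NormedSpace ℝ U]
    [CompleteSpace U] {K : U × ℝ → U} (hK : ContDiff ℝ 1 K) (u₀ : U) {P : U × ℝ → Prop}
    (hP : ∀ᶠ z in 𝓝 (u₀, (0 : ℝ)), P z) :
    ∀ᶠ l : ℝ in 𝓝 0, ∃ u, P (u, l) ∧ u = u₀ + l • K (u, l) := by
  have hKd : HasStrictFDerivAt K (fderiv ℝ K (u₀, 0)) (u₀, 0) :=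
    hK.contDiffAt.hasStrictFDerivAt one_ne_zero
  have h1 := (hasStrictFDerivAt_fst (𝕜 := ℝ) (p := (u₀, (0 : ℝ)))).sub
    ((hasStrictFDerivAt_snd (𝕜 := ℝ) (p := (u₀, (0 : ℝ)))).smul hKd)
  have h2 := h1.prodMk (hasStrictFDerivAt_snd (𝕜 := ℝ) (p := (u₀, (0 : ℝ))))
  have h3 := h2.map_nhds_eq_of_surj (by
    rw [LinearMap.range_eq_top]
    rintro ⟨a, b⟩
    refine ⟨(a + b • K (u₀, 0), b), ?_⟩
    simp)
  simp only [Pi.sub_apply, Pi.smul_apply', zero_smul, sub_zero] at h3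
  have h4 : ∀ᶠ y in 𝓝 (u₀, (0 : ℝ)), ∃ z, P z ∧ (z.1 - z.2 • K z, z.2) = y := by
    rw [← h3]
    filter_upwards [image_mem_map hP] with y hy
    exact hy
  have h5 : Tendsto (fun l : ℝ => (u₀, l)) (𝓝 0) (𝓝 (u₀, 0)) :=
    (Continuous.prodMk_right u₀).tendsto 0
  filter_upwards [h5.eventually h4] with l ⟨⟨u, m⟩, hz, he⟩
  simp only [Prod.mk.injEq] at he
  obtain ⟨he1, rfl⟩ := he
  exact ⟨u, hz, by rw [← he1]; simp⟩

end VacuumData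

namespace VacuumData

section System

variable {A : Type*} [NormedCommRing A] [NormedAlgebra ℝ A]

/-- The perturbation of the inverse metric, with conformal part `T φ`. -/
def invPert (g₀ : Fin 3 → Fin 3 → A) (T : A →L[ℝ] A) (φ : A) (i j : Fin 3) : A :=
  g₀ i j + kron i j • T φ

/-- The derivatives of the perturbation of the inverse metric. -/
def invPertDeriv (d₀ : Fin 3 → Fin 3 → Fin 3 → A) (T' : Fin 3 → A →L[ℝ] A) (φ : A)
    (k i j : Fin 3) : A := d₀ k i j + kron i j • T' k φ

/-- The momentum, with conformal Killing part built from `φ`. -/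
def momPert (p₀ : Fin 3 → Fin 3 → A) (T' : Fin 3 → A →L[ℝ] A) (φ : Fin 3 → A) (i j : Fin 3) : A :=
  p₀ i j + T' i (φ j) + T' j (φ i) - kron i j • ∑ l, T' l (φ l)

/-- The matrix `1 + l • H`. -/
def oneAdd (l : ℝ) (H : Fin 3 → Fin 3 → A) (i j : Fin 3) : A := kron i j • 1 + l • H i j

lemma det3_oneAdd (l : ℝ) (H : Fin 3 → Fin 3 → A) : det3 (oneAdd l H) =
    1 + l • ∑ i, H i i + l ^ 2 • (∑ i, cof H i i + l • det3 H) := by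
  simp [det3, cof, oneAdd, kron, Fin.sum_univ_three, Algebra.smul_def]
  ring

lemma exists_system_solution [CompleteSpace A] (g₀ p₀ : Fin 3 → Fin 3 → A)
    (d₀ : Fin 3 → Fin 3 → Fin 3 → A) (S₀ w : A) (S : Fin 3 → A) (T : A →L[ℝ] A)
    (T' : Fin 3 → A →L[ℝ] A) {ε : ℝ} (hε : 0 < ε) :
    ∃ l : ℝ, 0 < l ∧ ∃ (φ₀ : A) (φ : Fin 3 → A) (σ : A),
      φ₀ = S₀ + l • (w * hamLow (1 + l • σ) (oneAdd l (invPert g₀ T φ₀)) (momPert p₀ T' φ)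
        (invPertDeriv d₀ T' φ₀)) ∧
      (∀ b, φ b = S b + l • (w * momLow (1 + l • σ) (oneAdd l (invPert g₀ T φ₀)) (momPert p₀ T' φ)
        (invPertDeriv d₀ T' φ₀) b)) ∧
      (1 + l • σ) ^ 2 * det3 (oneAdd l (invPert g₀ T φ₀)) = 1 ∧
      (∀ i j, ‖l • invPert g₀ T φ₀ i j‖ < ε) ∧ ‖l • σ‖ < ε := by
  let H : Fin 3 → Fin 3 → (A × (Fin 3 → A) × A) × ℝ → A := fun i j z => invPert g₀ T z.1.1 i j
  let t : (A × (Fin 3 → A) × A) × ℝ → A := fun z => ∑ i, H i i z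
  let σ : (A × (Fin 3 → A) × A) × ℝ → A := fun z => z.1.2.2 - (1 / 2 : ℝ) • t z
  let s : (A × (Fin 3 → A) × A) × ℝ → A := fun z => 1 + z.2 • σ z
  let G : Fin 3 → Fin 3 → (A × (Fin 3 → A) × A) × ℝ → A := fun i j z => oneAdd z.2 (fun i j => H i j z) i j
  let p : Fin 3 → Fin 3 → (A × (Fin 3 → A) × A) × ℝ → A := fun i j z => momPert p₀ T' z.1.2.1 i j
  let d : Fin 3 → Fin 3 → Fin 3 → (A × (Fin 3 → A) × A) × ℝ → A := fun k i j z => invPertDeriv d₀ T' z.1.1 k i j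
  have hH : ∀ i j, ContDiff ℝ 1 (H i j) := fun i j => by
    simp only [H, invPert]
    fun_prop
  have ht : ContDiff ℝ 1 t := by fun_prop
  have hσ : ContDiff ℝ 1 σ := by fun_prop
  have hs : ContDiff ℝ 1 s := by fun_prop
  have hG : ∀ i j, ContDiff ℝ 1 (G i j) := fun i j => by
    simp only [G, oneAdd]
    fun_prop
  have hp : ∀ i j, ContDiff ℝ 1 (p i j) := fun i j => by
    simp only [p, momPert]
    fun_prop
  have hd : ∀ k i j, ContDiff ℝ 1 (d k i j) := fun k i j => by
    simp only [d, invPertDeriv]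
    fun_prop
  let K : (A × (Fin 3 → A) × A) × ℝ → A × (Fin 3 → A) × A := fun z =>
    (w * hamLow (s z) (fun i j => G i j z) (fun i j => p i j z) (fun k i j => d k i j z),
      fun b => w * momLow (s z) (fun i j => G i j z) (fun i j => p i j z) (fun k i j => d k i j z) b,
      (-(1 / 2) : ℝ) • (σ z ^ 2 + (∑ i, cof (fun i j => H i j z) i i
        + z.2 • det3 fun i j => H i j z) * s z ^ 2 + t z * ((2 : ℝ) • σ z + z.2 • σ z ^ 2)))
  have hK : ContDiff ℝ 1 K := by
    have h1 := contDiff_hamLow hs hG hp hd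
    have h2 := contDiff_momLow hs hG hp hd
    have h3 := contDiff_cof' hH
    simp only [K, det3]
    fun_prop
  have hP : ∀ᶠ z : (A × (Fin 3 → A) × A) × ℝ in 𝓝 ((S₀, S, 0), 0), (∀ i j, ‖z.2 • H i j z‖ < ε) ∧ ‖z.2 • σ z‖ < ε := by
    have hsmall : ∀ F : (A × (Fin 3 → A) × A) × ℝ → A, ContDiff ℝ 1 F →
        ∀ᶠ z : (A × (Fin 3 → A) × A) × ℝ in 𝓝 ((S₀, S, 0), 0), ‖z.2 • F z‖ < ε := fun F hF => by
      have hc : Continuous fun z : (A × (Fin 3 → A) × A) × ℝ => ‖z.2 • F z‖ :=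
        (continuous_snd.smul hF.continuous).norm
      refine hc.continuousAt.eventually (gt_mem_nhds ?_)
      simpa using hε
    exact (eventually_all.2 fun i => eventually_all.2 fun j => hsmall _ (hH i j)).and (hsmall _ hσ)
  have h := eventually_exists_fixedPoint hK (S₀, S, 0) hP
  obtain ⟨l, ⟨⟨φ₀, φ, τ⟩, ⟨hP1, hP2⟩, hu⟩, hl⟩ :=
    ((h.filter_mono nhdsWithin_le_nhds).and (self_mem_nhdsWithin (s := Ioi (0 : ℝ)))).exists
  refine ⟨l, hl, φ₀, φ, σ ((φ₀, φ, τ), l), ?_, fun b => ?_, ?_, hP1, hP2⟩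
  · exact congrArg Prod.fst hu
  · exact congrFun (congrArg (fun z => z.2.1) hu) b
  · have hτ : τ = 0 + l • (K ((φ₀, φ, τ), l)).2.2 := congrArg (fun z => z.2.2) hu
    have hσ' : σ ((φ₀, φ, τ), l) = τ - (1 / 2 : ℝ) • t ((φ₀, φ, τ), l) := rfl
    rw [det3_oneAdd]
    simp only [K, s] at hτ
    change (1 + l • σ ((φ₀, φ, τ), l)) ^ 2 * (1 + l • t ((φ₀, φ, τ), l)
      + l ^ 2 • (∑ i, cof (fun i j => H i j ((φ₀, φ, τ), l)) i i
      + l • det3 fun i j => H i j ((φ₀, φ, τ), l))) = 1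
    generalize σ ((φ₀, φ, τ), l) = x at *
    generalize t ((φ₀, φ, τ), l) = y at *
    generalize (∑ i, cof (fun i j => H i j ((φ₀, φ, τ), l)) i i) = a at *
    generalize det3 (fun i j => H i j ((φ₀, φ, τ), l)) = b at *
    simp only [Algebra.smul_def, map_pow] at hτ hσ' ⊢
    have h2 : (algebraMap ℝ A) (1 / 2) * 2 = 1 := by
      rw [← map_ofNat (algebraMap ℝ A) 2, ← map_mul]; norm_num
    have h3 : (algebraMap ℝ A) 2 = 2 := map_ofNat _ 2
    rw [map_neg, h3] at hτ
    linear_combination 2 * algebraMap ℝ A l * hσ' + 2 * algebraMap ℝ A l * hτ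
      - (algebraMap ℝ A l * y + algebraMap ℝ A l ^ 2 * (x ^ 2 + (a + algebraMap ℝ A l * b)
        * (1 + algebraMap ℝ A l * x) ^ 2 + y * (2 * x + algebraMap ℝ A l * x ^ 2))) * h2

end System

end VacuumData

namespace VacuumData

/-- The inverse metric density `1 + l • (G₀ + v • 1)`. -/
def invDensity (l : ℝ) (G₀ : Fin 3 → Fin 3 → E3 → ℝ) (v : E3 → ℝ) (i j : Fin 3) (x : E3) : ℝ :=
  kron i j + l * (G₀ i j x + kron i j * v x)

/-- The contravariant momentum `l • (P₀ + ∂ᵢXⱼ + ∂ⱼXᵢ - (div X) δᵢⱼ)`. -/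
def momDensity (l : ℝ) (P₀ : Fin 3 → Fin 3 → E3 → ℝ) (X : Fin 3 → E3 → ℝ) (i j : Fin 3)
    (x : E3) : ℝ :=
  l * (P₀ i j x + pd (X j) i x + pd (X i) j x - kron i j * ∑ k, pd (X k) k x)

lemma kron_comm (i j : Fin 3) : kron i j = kron j i := by
  simp only [kron, eq_comm]

section Densities

variable {l : ℝ} {G₀ P₀ : Fin 3 → Fin 3 → E3 → ℝ} {v : E3 → ℝ} {X : Fin 3 → E3 → ℝ}

lemma pd_invDensity (hG : ∀ i j, ContDiff ℝ 2 (G₀ i j)) (hv : ContDiff ℝ 2 v) (i j k : Fin 3)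
    (x : E3) : pd (invDensity l G₀ v i j) k x = l * (pd (G₀ i j) k x + kron i j * pd v k x) := by
  have h1 := (hG i j).differentiable two_ne_zero
  have h2 := hv.differentiable two_ne_zero
  change pd (fun y => kron i j + l * (G₀ i j y + kron i j * v y)) k x = _
  rw [pd_add (by fun_prop) (by fun_prop), pd_const, pd_const_mul (by fun_prop),
    pd_add (by fun_prop) (by fun_prop), pd_const_mul (by fun_prop), zero_add]

lemma sum_kron_mul (f : Fin 3 → ℝ) (i : Fin 3) : ∑ j, kron i j * f j = f i := by
  simp [kron]

lemma sum_pd_pd_invDensity (hG : ∀ i j, ContDiff ℝ 2 (G₀ i j)) (hv : ContDiff ℝ 2 v) (x : E3) :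
    ∑ i, ∑ j, pd (pd (invDensity l G₀ v i j) j) i x =
      l * (∑ i, ∑ j, pd (pd (G₀ i j) j) i x + ∑ k, pd (pd v k) k x) := by
  have h : ∀ i j, pd (pd (invDensity l G₀ v i j) j) i x =
      l * (pd (pd (G₀ i j) j) i x + kron i j * pd (pd v j) i x) := fun i j => by
    have h1 := (ContDiff.pd (n := 1) (hG i j) j).differentiable one_ne_zero
    have h2 := (ContDiff.pd (n := 1) hv j).differentiable one_ne_zero
    rw [show pd (invDensity l G₀ v i j) j = _ from funext (pd_invDensity hG hv i j j),
      pd_const_mul (by fun_prop),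
      pd_add (by fun_prop) (by fun_prop), pd_const_mul (by fun_prop)]
  simp only [h, ← Finset.mul_sum, Finset.sum_add_distrib, sum_kron_mul]

lemma contDiff_momDensity (hP : ∀ i j, ContDiff ℝ 1 (P₀ i j)) (hX : ∀ i, ContDiff ℝ 2 (X i))
    (i j : Fin 3) : ContDiff ℝ 1 (momDensity l P₀ X i j) := by
  have h : ∀ i k, ContDiff ℝ 1 (pd (X i) k) := fun i k => ContDiff.pd (n := 1) (hX i) k
  unfold momDensity
  fun_prop

lemma sum_pd_momDensity (hP : ∀ i j, ContDiff ℝ 1 (P₀ i j)) (hX : ∀ i, ContDiff ℝ 2 (X i))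
    (b : Fin 3) (x : E3) : ∑ i, pd (momDensity l P₀ X i b) i x =
      l * (∑ i, pd (P₀ i b) i x + ∑ k, pd (pd (X b) k) k x) := by
  have hd : ∀ i k, Differentiable ℝ (pd (X i) k) := fun i k =>
    (ContDiff.pd (n := 1) (hX i) k).differentiable one_ne_zero
  have h : ∀ i, pd (momDensity l P₀ X i b) i x = l * (pd (P₀ i b) i x + pd (pd (X b) i) i x
      + pd (pd (X i) b) i x - kron b i * ∑ k, pd (pd (X k) k) i x) := fun i => by
    have h1 := (hP i b).differentiable one_ne_zero
    change pd (fun y => l * (P₀ i b y + pd (X b) i y + pd (X i) b y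
      - kron i b * ∑ k, pd (X k) k y)) i x = _
    rw [pd_const_mul (by fun_prop), pd_sub (by fun_prop) (by fun_prop),
      pd_add (by fun_prop) (by fun_prop), pd_add (by fun_prop) (by fun_prop),
      pd_const_mul (by fun_prop), pd_sum fun k _ => hd k k x, kron_comm]
  simp only [h, ← Finset.mul_sum, Finset.sum_add_distrib, Finset.sum_sub_distrib, sum_kron_mul,
    fun i => pd_comm (hX i) b i x]
  ring

end Densities

lemma wt_rpow_mul_wt_rpow (s t : ℝ) (x : E3) : wt x ^ s * wt x ^ t = wt x ^ (s + t) :=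
  (Real.rpow_add (wt_pos x) s t).symm

lemma IsSymbol.exists_ev_eq_wt_mul {f : E3 → ℝ} {s t : ℝ} (hf : IsSymbol 1 f t) (h : s + t ≤ 0) :
    ∃ φ : WAlg, ∀ x, WAlg.ev x φ = wt x ^ s * f x :=
  (((wt_rpow s).mul hf).mono h).exists_ev_eq

theorem exists_vacuum_solution {q : ℝ} (hq : 0 < q) (hq1 : q < 1) {G₀ P₀ : Fin 3 → Fin 3 → E3 → ℝ}
    (hG : ∀ i j, IsSymbol 2 (G₀ i j) (-1)) (hGs : ∀ i j, G₀ i j = G₀ j i)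
    (hGd : IsSymbol 1 (fun x => ∑ i, ∑ j, pd (pd (G₀ i j) j) i x) (-(3 + q)))
    (hP : ∀ i j, IsSymbol 1 (P₀ i j) (-2))
    (hPd : ∀ b, IsSymbol 1 (fun x => ∑ i, pd (P₀ i b) i x) (-(3 + q))) :
    ∃ l : ℝ, 0 < l ∧ ∃ (v : E3 → ℝ) (X : Fin 3 → E3 → ℝ) (s : E3 → ℝ),
      ContDiff ℝ 2 v ∧ (∀ i, ContDiff ℝ 2 (X i)) ∧
      (∃ c, IsO2 (fun x => v x - c / ‖x‖) (1 + q) 1) ∧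
      (∀ i, ∃ c, IsO2 (fun x => X i x - c / ‖x‖) (1 + q) 1) ∧
      IsConformal s (invDensity l G₀ v) ∧ IsSymbol 1 s 0 ∧ (∀ x, |s x - 1| < 1 / 10) ∧
      (∀ i j x, |invDensity l G₀ v i j x - kron i j| < 1 / 10) ∧
      (∀ x, hamiltonian (metric s (invDensity l G₀ v))
        (momentum s (invDensity l G₀ v) (momDensity l P₀ X)) x = 0) ∧
      ∀ j x, divT (metric s (invDensity l G₀ v))
        (momentum s (invDensity l G₀ v) (momDensity l P₀ X)) j x = 0 := by
  choose g₀ hg₀ using fun i j => ((hG i j).of_succ.mono (t := 0) (by norm_num)).exists_ev_eq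
  choose d₀ hd₀ using fun k i j =>
    ((hG i j).derivative k).exists_ev_eq_wt_mul (s := 2) (by norm_num)
  choose p₀ hp₀ using fun i j => (hP i j).exists_ev_eq_wt_mul (s := 2) (by norm_num)
  obtain ⟨S₀, hS₀⟩ := (hGd.const_mul (-1)).exists_ev_eq_wt_mul (s := 3 + q) (by linarith)
  choose S hS using fun b => ((hPd b).const_mul (-1)).exists_ev_eq_wt_mul (s := 3 + q) (by linarith)
  obtain ⟨w, hw⟩ := ((IsSymbol.wt_rpow (q - 1)).mono (t := 0) (by linarith)).exists_ev_eq
  obtain ⟨T, T', hT⟩ := exists_potential hq hq1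
  obtain ⟨l, hl, φ₀, φ, σ, hφ₀, hφ, hdet, hH, hσ⟩ :=
    exists_system_solution g₀ p₀ d₀ S₀ w S T T' (ε := 1 / 10) (by norm_num)
  obtain ⟨v, hv, hTv, hTv', hΔv, hvO⟩ := hT φ₀
  choose X hX hTX hTX' hΔX hXO using fun b => hT (φ b)
  have hG2 : ∀ i j, ContDiff ℝ 2 (G₀ i j) := fun i j => (hG i j).contDiff
  have hP1 : ∀ i j, ContDiff ℝ 1 (P₀ i j) := fun i j => (hP i j).contDiff
  have evG : ∀ i j x, WAlg.ev x (oneAdd l (invPert g₀ T φ₀) i j) = invDensity l G₀ v i j x :=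
    fun i j x => by
      simp [oneAdd, invPert, invDensity, hg₀, hTv, mul_add]
  have e2 : ∀ x, wt x ^ (2 : ℝ) = wt x ^ 2 := fun x => Real.rpow_natCast _ 2
  have evd : ∀ x k i j, pd (invDensity l G₀ v i j) k x =
      l * (wt x ^ 2)⁻¹ * WAlg.ev x (invPertDeriv d₀ T' φ₀ k i j) := fun x k i j => by
    have := (wt_pos x).ne'
    rw [pd_invDensity hG2 hv]
    simp only [invPertDeriv, map_add, map_smul, hd₀, hTv', e2, smul_eq_mul]
    field_simp
  have evp : ∀ x i j, momDensity l P₀ X i j x =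
      l * (wt x ^ 2)⁻¹ * WAlg.ev x (momPert p₀ T' φ i j) := fun x i j => by
    have := (wt_pos x).ne'
    simp only [momDensity, momPert, map_add, map_sub, map_smul, map_sum, hp₀, hTX', e2,
      smul_eq_mul, ← Finset.mul_sum]
    field_simp
  have hconf : IsConformal (fun x => WAlg.ev x (1 + l • σ)) (invDensity l G₀ v) := by
    refine ⟨WAlg.contDiff_ev _, fun i j => ?_, fun i j => ?_, fun x => ?_⟩
    · have := hG2 i j
      unfold invDensity
      fun_prop
    · unfold invDensity
      rw [hGs i j, kron_comm i j]
    · have := congrArg (WAlg.ev x) hdet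
      rwa [map_mul, map_pow, map_one, map_det3, funext₂ fun i j => evG i j x] at this
  have hwt : ∀ x, wt x ^ (3 + q) * wt x ^ (-(3 + q)) = 1 := fun x => by
    rw [wt_rpow_mul_wt_rpow, add_neg_cancel, Real.rpow_zero]
  have hwq : ∀ x, wt x ^ (-(3 + q)) * wt x ^ (q - 1) = ((wt x ^ 2)⁻¹) ^ 2 := fun x => by
    rw [wt_rpow_mul_wt_rpow, inv_pow, ← pow_mul, inv_pow_eq_rpow _ _ (wt_pos x).le]
    congr 1; push_cast; ring
  refine ⟨l, hl, v, X, fun x => WAlg.ev x (1 + l • σ), hv, hX, hvO, hXO, hconf, IsSymbol.ev _,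
    fun x => ?_, fun i j x => ?_, fun x => ?_, fun j x => ?_⟩
  · beta_reduce
    rw [map_add, map_one, add_sub_cancel_left]
    exact (WAlg.abs_ev_le _ _).trans_lt hσ
  · rw [← evG, oneAdd, map_add, map_smul, map_one, smul_eq_mul, mul_one, add_sub_cancel_left]
    exact (WAlg.abs_ev_le _ _).trans_lt (hH i j)
  · rw [hconf.hamiltonian_eq, sum_pd_pd_invDensity hG2 hv, hΔv, funext₂ (evp x),
      funext₃ (evd x), hamLow_smul]
    have h := congrArg (WAlg.ev x) hφ₀
    rw [map_add, map_smul, map_mul, map_hamLow, funext₂ fun i j => evG i j x, hS₀, hw,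
      smul_eq_mul] at h
    rw [h]
    set Q : ℝ := hamLow _ _ _ _
    set D := ∑ i, ∑ j, pd (pd (G₀ i j) j) i x
    linear_combination (WAlg.ev x (1 + l • σ)) * (l * D * hwt x - l ^ 2 * Q * hwq x)
  · rw [hconf.divT_eq (contDiff_momDensity hP1 hX)]
    refine Finset.sum_eq_zero fun b _ => ?_
    rw [sum_pd_momDensity hP1 hX, hΔX, funext₂ (evp x), funext₃ (evd x), momLow_smul]
    have h := congrArg (WAlg.ev x) (hφ b)
    rw [map_add, map_smul, map_mul, map_momLow, funext₂ fun i j => evG i j x, hS, hw,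
      smul_eq_mul] at h
    rw [h]
    set Q : ℝ := momLow _ _ _ _ b
    set D := ∑ i, pd (P₀ i b) i x
    linear_combination (metric (fun x => WAlg.ev x (1 + l • σ)) (invDensity l G₀ v) x j b) *
      (-l * D * hwt x + l ^ 2 * Q * hwq x)

end VacuumData

namespace VacuumData

lemma posDef_of_near_one {B : Matrix (Fin 3) (Fin 3) ℝ} (hB : ∀ i j, B i j = B j i)
    (h : ∀ i j, |B i j - kron i j| < 1 / 10) : B.PosDef := by
  refine Matrix.PosDef.of_dotProduct_mulVec_pos ?_ fun y hy => ?_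
  · ext i j
    simpa using hB j i
  · have hpos : 0 < y 0 ^ 2 + y 1 ^ 2 + y 2 ^ 2 := by
      by_contra! hn
      refine hy (funext fun i => ?_)
      have : y i ^ 2 = 0 := by
        fin_cases i <;> simp <;> nlinarith [sq_nonneg (y 0), sq_nonneg (y 1), sq_nonneg (y 2)]
      simpa using this
    have hb : ∀ i j, -(1 / 20) * (y i ^ 2 + y j ^ 2) ≤ (B i j - kron i j) * (y i * y j) :=
      fun i j => by
        have h1 := abs_lt.1 (h i j)
        nlinarith [sq_nonneg (y i + y j), sq_nonneg (y i - y j)]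
    have e : star y ⬝ᵥ B.mulVec y = (y 0 ^ 2 + y 1 ^ 2 + y 2 ^ 2)
        + ∑ i, ∑ j, (B i j - kron i j) * (y i * y j) := by
      simp [dotProduct, Matrix.mulVec, Fin.sum_univ_three, kron]
      ring
    rw [e]
    have h2 : ∑ i, ∑ j, -(1 / 20) * (y i ^ 2 + y j ^ 2)
        ≤ ∑ i, ∑ j, (B i j - kron i j) * (y i * y j) :=
      Finset.sum_le_sum fun i _ => Finset.sum_le_sum fun j _ => hb i j
    simp only [Fin.sum_univ_three] at h2 ⊢
    linarith

lemma IsConformal.posDef_metric {s : E3 → ℝ} {G : Fin 3 → Fin 3 → E3 → ℝ} (h : IsConformal s G)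
    {x : E3} (hs : 0 < s x) (hG : ∀ i j, |G i j x - kron i j| < 1 / 10) :
    (metric s G x).PosDef := by
  have h1 : (Matrix.of fun i j => G i j x).PosDef :=
    posDef_of_near_one (fun i j => h.symm_apply x i j) hG
  have h2 := (h1.smul hs).inv
  rwa [Matrix.inv_eq_left_inv (B := metric s G x)] at h2
  ext i j
  rw [Matrix.mul_apply, Matrix.one_apply]
  exact sum_smul_cof_mul (h.symm_apply x) (h.det_eq x) i j

lemma cof_add_kron {H : Fin 3 → Fin 3 → ℝ} (hH : ∀ i j, H i j = H j i) (i j : Fin 3) :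
    cof (fun a b => kron a b + H a b) i j =
      kron i j + (∑ k, H k k) * kron i j - H i j + cof H i j := by
  have h1 := hH 0 1
  have h2 := hH 0 2
  have h3 := hH 1 2
  fin_cases i <;> fin_cases j <;> simp [cof, kron, Fin.sum_univ_three, h1, h2, h3] <;> ring

section Asymptotics

variable {n : ℕ} {t : ℝ} {A : Fin 3 → Fin 3 → E3 → ℝ}

lemma IsSymbol.congr {f g : E3 → ℝ} (hf : IsSymbol n f t) (h : ∀ x, f x = g x) : IsSymbol n g t :=
  funext h ▸ hf

lemma IsSymbol.cof (hA : ∀ i j, IsSymbol n (A i j) t) (i j : Fin 3) :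
    IsSymbol n (fun x => cof (fun a b => A a b x) i j) (t + t) :=
  ((hA _ _).mul (hA _ _)).sub ((hA _ _).mul (hA _ _))

lemma IsSymbol.det3 (hA : ∀ i j, IsSymbol n (A i j) t) :
    IsSymbol n (fun x => det3 (fun a b => A a b x)) (t + (t + t)) :=
  IsSymbol.sum fun j _ => (hA 0 j).mul (IsSymbol.cof hA 0 j)

lemma IsSymbol.pow {f : E3 → ℝ} (hA : IsSymbol n f 0) (m : ℕ) : IsSymbol n (fun x => f x ^ m) 0 := by
  induction m with
  | zero => simpa using IsSymbol.const 1
  | succ m ih => simpa [pow_succ] using ih.mul hA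

namespace IsConformal

variable {s : E3 → ℝ} {G p : Fin 3 → Fin 3 → E3 → ℝ}

lemma isSymbol_pd_scale (h : IsConformal s G) (hs : IsSymbol 1 s 0)
    (hG : ∀ i j, IsSymbol 2 (fun x => G i j x - kron i j) (-1)) (k : Fin 3) :
    IsSymbol 1 (pd s k) (-2) := by
  have hG0 : ∀ i j, IsSymbol 1 (G i j) 0 := fun i j => by
    simpa using ((hG i j).of_succ.mono (t := 0) (by norm_num)).add (IsSymbol.const (kron i j))
  have hpd : ∀ i j, IsSymbol 1 (pd (G i j) k) (-2) := fun i j => by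
    have := (hG i j).derivative k
    rw [show pd (fun x => G i j x - kron i j) k = pd (G i j) k from funext fun x => by
      rw [pd_sub (h.differentiable i j x) (by fun_prop), pd_const, sub_zero]] at this
    exact this.mono (by norm_num)
  rw [show pd s k = _ from funext (h.pd_scale k)]
  have hc := IsSymbol.cof hG0
  have h1 : IsSymbol 1 (fun x => ∑ i, ∑ j, VacuumData.cof (fun a b => G a b x) i j * pd (G i j) k x)
      (-2) := IsSymbol.sum fun i _ => IsSymbol.sum fun j _ =>
    ((hc i j).mul (hpd i j)).mono (by norm_num)
  exact (((hs.pow 3).mul h1).mono (by norm_num)).const_mul _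

/-- The expansion of the determinant of a perturbation of the identity. -/
lemma det3_eq (x : E3) : det3 (fun i j => G i j x) = 1 + ∑ k, (G k k x - kron k k)
    + ∑ k, VacuumData.cof (fun i j => G i j x - kron i j) k k
    + det3 (fun i j => G i j x - kron i j) := by
  have := det3_oneAdd 1 (fun i j => G i j x - kron i j)
  rw [show oneAdd 1 (fun i j => G i j x - kron i j) = fun i j => G i j x from
    funext₂ fun i j => by simp [oneAdd]] at this
  simpa [add_assoc] using this

lemma isSymbol_det3_sub (hG : ∀ i j, IsSymbol 2 (fun x => G i j x - kron i j) (-1)) :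
    IsSymbol 2 (fun x => det3 (fun i j => G i j x) - 1 - ∑ k, (G k k x - kron k k)) (-2) := by
  have h1 : IsSymbol 2 (fun x => ∑ k, VacuumData.cof (fun i j => G i j x - kron i j) k k) (-2) :=
    IsSymbol.sum fun k _ => (IsSymbol.cof hG k k).mono (by norm_num)
  have h2 := (IsSymbol.det3 hG).mono (t := -2) (by norm_num)
  refine (h1.add h2).congr fun x => ?_
  rw [det3_eq]; ring

lemma isSymbol_trace (hG : ∀ i j, IsSymbol 2 (fun x => G i j x - kron i j) (-1)) :
    IsSymbol 2 (fun x => ∑ k, (G k k x - kron k k)) (-1) :=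
  IsSymbol.sum fun k _ => hG k k

lemma isSymbol_det3_sub_one (hG : ∀ i j, IsSymbol 2 (fun x => G i j x - kron i j) (-1)) :
    IsSymbol 2 (fun x => det3 (fun i j => G i j x) - 1) (-1) := by
  simpa using ((isSymbol_det3_sub hG).mono (t := -1) (by norm_num)).add (isSymbol_trace hG)

lemma isSymbol_scale_sub_one (h : IsConformal s G) (hs : IsSymbol 1 s 0) (hs1 : ∀ x, 0 < s x)
    (hG : ∀ i j, IsSymbol 2 (fun x => G i j x - kron i j) (-1)) :
    IsSymbol 2 (fun x => s x - 1) (-1) := by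
  refine ⟨fun x => (h.differentiable_scale x).sub_const 1, ?_, fun k => ?_⟩
  · obtain ⟨C, hC⟩ := ((hs.pow 2).mul (isSymbol_det3_sub_one hG).of_succ).exists_bound
    refine ⟨C, fun x => le_trans ?_ ((hC x).trans_eq (by norm_num))⟩
    rw [show s x ^ 2 * (det3 (fun i j => G i j x) - 1) = -((s x - 1) * (s x + 1)) by
      linear_combination h.det_eq x, abs_neg, abs_mul]
    exact le_mul_of_one_le_right (abs_nonneg _) (by linarith [hs1 x, le_abs_self (s x + 1)])
  · rw [show pd (fun x => s x - 1) k = pd s k from funext fun x => by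
      rw [pd_sub (h.differentiable_scale x) (by fun_prop), pd_const, sub_zero]]
    exact (h.isSymbol_pd_scale hs hG k).mono (by norm_num)

lemma isSymbol_metric_sub (h : IsConformal s G) (hs : IsSymbol 1 s 0) (hs1 : ∀ x, 0 < s x)
    (hG : ∀ i j, IsSymbol 2 (fun x => G i j x - kron i j) (-1)) (i j : Fin 3) :
    IsSymbol 2 (fun x => metric s G x i j - (kron i j
      + ((1 / 2) * (∑ k, (G k k x - kron k k)) * kron i j - (G i j x - kron i j)))) (-2) := by
  have hσ := h.isSymbol_scale_sub_one hs hs1 hG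
  have hD := isSymbol_det3_sub_one hG
  have ht := isSymbol_trace hG
  have hs2 : IsSymbol 2 s 0 := by
    simpa using (hσ.mono (t := 0) (by norm_num)).add (IsSymbol.const 1)
  have h1 := ((hσ.mul (hs2.add (IsSymbol.const 1))).mul hD).mono (t := -2) (by norm_num)
  have h2 := (hσ.mul hσ).mono (t := -2) (by norm_num)
  have h3 := (((h1.add (isSymbol_det3_sub hG)).add h2).const_mul (-(1 / 2))).const_mul (kron i j)
  have h4 := ((hσ.mul ht).const_mul (kron i j)).mono (t := -2) (by norm_num)
  have h5 := (hσ.mul (hG i j)).mono (t := -2) (by norm_num)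
  have h6 := (hs2.mul (IsSymbol.cof hG i j)).mono (t := -2) (by norm_num)
  refine (((h3.add h4).sub h5).add h6).congr fun x => ?_
  have e := cof_add_kron (H := fun a b => G a b x - kron a b)
    (fun a b => by rw [h.symm_apply x a b, kron_comm]) i j
  simp only [add_sub_cancel] at e
  rw [metric, e]
  linear_combination (-(1 / 2)) * kron i j * h.det_eq x

lemma isSymbol_metric_sub_kron (h : IsConformal s G) (hs : IsSymbol 1 s 0) (hs1 : ∀ x, 0 < s x)
    (hG : ∀ i j, IsSymbol 2 (fun x => G i j x - kron i j) (-1)) (i j : Fin 3) :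
    IsSymbol 2 (fun x => metric s G x i j - kron i j) (-1) := by
  refine (((h.isSymbol_metric_sub hs hs1 hG i j).mono (t := -1) (by norm_num)).add
    (((isSymbol_trace hG).const_mul (1 / 2 * kron i j)).sub (hG i j))).congr fun x => ?_
  ring

lemma isSymbol_momentum_sub (h : IsConformal s G) (hs : IsSymbol 1 s 0) (hs1 : ∀ x, 0 < s x)
    (hG : ∀ i j, IsSymbol 2 (fun x => G i j x - kron i j) (-1))
    (hp : ∀ i j, IsSymbol 1 (p i j) (-2)) (i j : Fin 3) :
    IsSymbol 1 (fun x => momentum s G p x i j - p i j x) (-3) := by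
  have hg := fun i j => (h.isSymbol_metric_sub_kron hs hs1 hG i j).of_succ
  have hg0 : ∀ i j, IsSymbol 1 (fun x => metric s G x i j) 0 := fun i j => by
    simpa using ((hg i j).mono (t := 0) (by norm_num)).add (IsSymbol.const (kron i j))
  have h1 : IsSymbol 1 (fun x => ∑ a, ∑ b, ((metric s G x i a - kron i a) * metric s G x j b
      + kron i a * (metric s G x j b - kron j b)) * p a b x) (-3) :=
    IsSymbol.sum fun a _ => IsSymbol.sum fun b _ =>
      (((((hg i a).mul (hg0 j b)).mono (t := -1) (by norm_num)).add
        ((hg j b).const_mul (kron i a))).mul (hp a b)).mono (by norm_num)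
  refine h1.congr fun x => ?_
  change _ = (∑ a, ∑ b, metric s G x i a * metric s G x j b * p a b x) - p i j x
  rw [show p i j x = ∑ a, ∑ b, kron i a * kron j b * p a b x by
    simp only [mul_assoc, ← Finset.mul_sum, sum_kron_mul], ← Finset.sum_sub_distrib]
  refine Finset.sum_congr rfl fun a _ => ?_
  rw [← Finset.sum_sub_distrib]
  exact Finset.sum_congr rfl fun b _ => by ring

end IsConformal

end Asymptotics

end VacuumData

namespace VacuumData

section Dilation

variable (g π : E3 → Matrix (Fin 3) (Fin 3) ℝ) (c : ℝ) (x : E3)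

lemma pd_const_mul_comp_smul (f : E3 → ℝ) (a : ℝ) (i : Fin 3) :
    pd (fun y => a * f (c • y)) i x = a * (c * pd f i (c • x)) := by
  rw [← pd_comp_smul]
  rcases eq_or_ne a 0 with rfl | ha
  · simp [pd]
  · have := invertibleOfNonzero ha
    exact congrArg (fun L : E3 →L[ℝ] ℝ => L (EuclideanSpace.single i 1))
      (fderiv_const_smul_of_invertible (𝕜 := ℝ) (f := fun y => f (c • y)) (x := x) a)

lemma Gamma_comp_smul (k i j : Fin 3) :
    Gamma (fun y => g (c • y)) k i j x = c * Gamma g k i j (c • x) := by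
  simp only [Gamma, fun a b => pd_comp_smul (fun y => g y a b) c, Finset.mul_sum]
  exact Finset.sum_congr rfl fun l _ => by ring

lemma scalarCurvature_comp_smul :
    scalarCurvature (fun y => g (c • y)) x = c ^ 2 * scalarCurvature g (c • x) := by
  simp only [scalarCurvature, Gamma_comp_smul, pd_const_mul_comp_smul c x (Gamma g _ _ _)]
  rw [Finset.mul_sum]
  refine Finset.sum_congr rfl fun i _ => ?_
  rw [Finset.mul_sum]
  refine Finset.sum_congr rfl fun k _ => ?_
  rw [mul_left_comm (c ^ 2)]
  congr 1
  simp only [mul_add, Finset.mul_sum]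
  congr 1
  · exact Finset.sum_congr rfl fun j _ => by ring
  · exact Finset.sum_congr rfl fun j _ => Finset.sum_congr rfl fun m _ => by ring

lemma normSq_comp_smul :
    normSq (fun y => g (c • y)) (fun y => c • π (c • y)) x = c ^ 2 * normSq g π (c • x) := by
  simp only [normSq, Matrix.smul_apply, smul_eq_mul, Finset.mul_sum]
  exact Finset.sum_congr rfl fun i _ => Finset.sum_congr rfl fun j _ =>
    Finset.sum_congr rfl fun k _ => Finset.sum_congr rfl fun l _ => by ring

lemma traceT_comp_smul :
    traceT (fun y => g (c • y)) (fun y => c • π (c • y)) x = c * traceT g π (c • x) := by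
  simp only [traceT, Matrix.smul_apply, smul_eq_mul, Finset.mul_sum]
  exact Finset.sum_congr rfl fun i _ => Finset.sum_congr rfl fun j _ => by ring

lemma hamiltonian_comp_smul :
    hamiltonian (fun y => g (c • y)) (fun y => c • π (c • y)) x =
      c ^ 2 * hamiltonian g π (c • x) := by
  rw [hamiltonian, scalarCurvature_comp_smul, normSq_comp_smul, traceT_comp_smul, hamiltonian]
  ring

lemma divT_comp_smul (j : Fin 3) :
    divT (fun y => g (c • y)) (fun y => c • π (c • y)) j x = c ^ 2 * divT g π j (c • x) := by
  simp only [divT, Gamma_comp_smul, Matrix.smul_apply, smul_eq_mul,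
    fun a b => pd_const_mul_comp_smul c x (fun y => π y a b)]
  rw [Finset.mul_sum]
  refine Finset.sum_congr rfl fun i _ => ?_
  rw [Finset.mul_sum]
  refine Finset.sum_congr rfl fun k _ => ?_
  rw [mul_left_comm (c ^ 2)]
  congr 1
  rw [mul_sub, mul_sub, Finset.mul_sum, Finset.mul_sum]
  congr 1
  · congr 1
    · ring
    · exact Finset.sum_congr rfl fun l _ => by ring
  · exact Finset.sum_congr rfl fun l _ => by ring

end Dilation

lemma exists_isSymbol_inv_norm :
    ∃ η : E3 → ℝ, IsSymbol 2 η (-1) ∧ ∀ x, 2 < ‖x‖ → η x = ‖x‖⁻¹ := by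
  obtain ⟨η, h1, -, h3⟩ := exists_contDiff_eq_inv_norm_pow 1
  refine ⟨η, ?_, by simpa using h3⟩
  have h := (isHomogeneous_inv_norm_pow 1 (R := 2)).congr h3
  simpa using IsSymbol.of_homogeneous (n := 2) two_pos.le (h1.of_le (by norm_num)) h

lemma pd_eq_of_eq_inv_norm {η : E3 → ℝ} (hη : ∀ x, 2 < ‖x‖ → η x = ‖x‖⁻¹) {x : E3} (hx : 2 < ‖x‖)
    (i : Fin 3) : pd η i x = -(x i / ‖x‖ ^ 3) := by
  have hx0 : x ≠ 0 := norm_pos_iff.1 (by linarith)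
  have h : η =ᶠ[𝓝 x] fun y => ‖y‖⁻¹ := by
    filter_upwards [(isOpen_lt continuous_const continuous_norm).mem_nhds hx] with y hy using hη y hy
  rw [pd_congr h, pd_inv_norm hx0, gradKernel_eq, div_eq_mul_inv]

lemma isSymbol_sub_inv_norm {η v : E3 → ℝ} {c q : ℝ} (hη : IsSymbol 2 η (-1))
    (hηe : ∀ x, 2 < ‖x‖ → η x = ‖x‖⁻¹) (hv : ContDiff ℝ 2 v)
    (h : IsO2 (fun x => v x - c / ‖x‖) (1 + q) 1) :
    IsSymbol 2 (fun x => v x - c * η x) (-(1 + q)) := by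
  refine IsSymbol.of_isO2 (R := 2) (hv.sub (contDiff_const.mul hη.contDiff)) h fun x hx => ?_
  rw [hηe x hx, div_eq_mul_inv]

lemma isSymbol_of_sub_inv_norm {η v : E3 → ℝ} {c q : ℝ} (hq : 0 < q) (hη : IsSymbol 2 η (-1))
    (h : IsSymbol 2 (fun x => v x - c * η x) (-(1 + q))) : IsSymbol 2 v (-1) :=
  ((h.mono (t := -1) (by linarith)).add (hη.const_mul c)).congr fun x => by ring

end VacuumData

namespace VacuumData

section Expansion

variable {l c q : ℝ} {G₀ P₀ : Fin 3 → Fin 3 → E3 → ℝ} {α β v η : E3 → ℝ} {X : Fin 3 → E3 → ℝ}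
  {B : Fin 3 → ℝ}

lemma sum_coord_mul_coord (x : E3) : x 0 * x 0 + x 1 * x 1 + x 2 * x 2 = ‖x‖ ^ 2 := by
  rw [EuclideanSpace.norm_sq_eq]
  simp [Fin.sum_univ_three, pow_two]

lemma metric_expansion_eq (hl : 0 < l)
    (hα : ∀ c : ℝ, 0 < c → ∀ x : E3, x ≠ 0 → α (c • x) = α x)
    (hG : ∀ i j x, 2 < ‖x‖ → G₀ i j x = -(α x * (x i * x j) / ‖x‖ ^ 3))
    (hη : ∀ x, 2 < ‖x‖ → η x = ‖x‖⁻¹) (i j : Fin 3) {x : E3} (hx : 2 / l < ‖x‖) :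
    kron i j + ((1 / 2) * (∑ k, (invDensity l G₀ v k k (l • x) - kron k k)) * kron i j
      - (invDensity l G₀ v i j (l • x) - kron i j)) =
    (1 + (c / 2) / ‖x‖) * kron i j + (α x / ‖x‖) * (x i * x j / ‖x‖ ^ 2 - kron i j / 2)
      + l / 2 * kron i j * (v (l • x) - c * η (l • x)) := by
  have hx0 : 0 < ‖x‖ := lt_trans (by positivity) hx
  have hlx : ‖l • x‖ = l * ‖x‖ := by rw [norm_smul, Real.norm_of_nonneg hl.le]
  have hy : 2 < ‖l • x‖ := by
    rw [hlx]
    rwa [div_lt_iff₀' hl] at hx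
  have hs := sum_coord_mul_coord x
  simp only [invDensity, hG _ _ _ hy, hη _ hy, hα l hl x (norm_pos_iff.1 hx0), hlx,
    Fin.sum_univ_three, PiLp.smul_apply, smul_eq_mul]
  simp only [show ∀ a, kron a a = 1 from fun a => if_pos rfl]
  have e : x 0 * x 0 = ‖x‖ ^ 2 - x 1 * x 1 - x 2 * x 2 := by linarith
  have e0 : ∀ a, l * x a * (l * x a) = l ^ 2 * (x a * x a) := fun a => by ring
  simp only [e0, e]
  field_simp
  ring

lemma momentum_expansion_eq (hl : 0 < l)
    (hβ : ∀ c : ℝ, 0 < c → ∀ x : E3, x ≠ 0 → β (c • x) = β x)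
    (hP : ∀ i j x, 2 < ‖x‖ → P₀ i j x = β x * (x i * x j) / ‖x‖ ^ 4)
    (hη : ∀ x, 2 < ‖x‖ → η x = ‖x‖⁻¹) (hηd : Differentiable ℝ η)
    (hX : ∀ i, Differentiable ℝ (X i)) (i j : Fin 3) {x : E3} (hx : 2 / l < ‖x‖) :
    l * momDensity l P₀ X i j (l • x) =
      β x * (x i * x j) / ‖x‖ ^ 4 + (1 / ‖x‖ ^ 3) *
        (-(B i) * x j - B j * x i + (∑ l, B l * x l) * kron i j)
      + l ^ 2 * (pd (fun y => X j y - B j * η y) i (l • x) + pd (fun y => X i y - B i * η y) j (l • x)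
        - kron i j * ∑ k, pd (fun y => X k y - B k * η y) k (l • x)) := by
  have hx0 : 0 < ‖x‖ := lt_trans (by positivity) hx
  have hlx : ‖l • x‖ = l * ‖x‖ := by rw [norm_smul, Real.norm_of_nonneg hl.le]
  have hy : 2 < ‖l • x‖ := by
    rw [hlx]
    rwa [div_lt_iff₀' hl] at hx
  have e : ∀ a b, pd (fun y => X a y - B a * η y) b (l • x) =
      pd (X a) b (l • x) + B a * x b / (l ^ 2 * ‖x‖ ^ 3) := fun a b => by
    rw [pd_sub (hX a _) (by fun_prop), pd_const_mul (hηd _), pd_eq_of_eq_inv_norm hη hy, hlx]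
    simp only [PiLp.smul_apply, smul_eq_mul]
    field_simp
    ring
  simp only [momDensity, hP _ _ _ hy, hβ l hl x (norm_pos_iff.1 hx0), hlx, e,
    PiLp.smul_apply, smul_eq_mul, Fin.sum_univ_three]
  field_simp
  ring

end Expansion

end VacuumData

open VacuumData

/-- Proposition 3.2 of the paper: for any C² functions `α, β` on the sphere
(i.e. C² on `ℝ³∖{0}` and homogeneous of degree 0) there is a vacuum initial data set
`(ḡ, π̄)` on `ℝ³` with the asymptotics
`ḡ_ij = (1 + A/r)δ_ij + (α/r)(x_i x_j/r² − δ_ij/2) + O₂(r^{−1−q})`,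
`π̄_ij = β x_i x_j/r⁴ + r^{−3}(−B_i x_j − B_j x_i + (Σ_l B_l x_l) δ_ij) + O₁(r^{−2−q})`. -/
theorem exists_vacuum_data_with_special_asymptotics
    (α β : E3 → ℝ)
    (hα : ContDiffOn ℝ 2 α {x : E3 | x ≠ 0})
    (hβ : ContDiffOn ℝ 2 β {x : E3 | x ≠ 0})
    (hαhom : ∀ c : ℝ, 0 < c → ∀ x : E3, x ≠ 0 → α (c • x) = α x)
    (hβhom : ∀ c : ℝ, 0 < c → ∀ x : E3, x ≠ 0 → β (c • x) = β x)
    (q : ℝ) (hq₁ : 1 / 2 < q) (hq₂ : q < 1) :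
    ∃ gb πb : E3 → Matrix (Fin 3) (Fin 3) ℝ,
      (∀ i j, ContDiff ℝ 2 fun x => gb x i j) ∧
      (∀ x, (gb x).PosDef) ∧ (∀ x, (gb x).IsSymm) ∧
      (∀ i j, ContDiff ℝ 1 fun x => πb x i j) ∧ (∀ x, (πb x).IsSymm) ∧
      -- the vacuum constraint equations hold everywhere on ℝ³
      (∀ x, hamiltonian gb πb x = 0) ∧
      (∀ x j, divT gb πb j x = 0) ∧
      -- the prescribed asymptotics, outside a compact set
      ∃ (A : ℝ) (B : Fin 3 → ℝ) (ρ₂ : ℝ), 0 < ρ₂ ∧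
        (∀ i j, IsO2
          (fun x => gb x i j - ((1 + A / ‖x‖) * kron i j
            + (α x / ‖x‖) * (x i * x j / ‖x‖ ^ 2 - kron i j / 2))) (1 + q) ρ₂) ∧
        (∀ i j, IsO1
          (fun x => πb x i j - (β x * (x i * x j) / ‖x‖ ^ 4 + (1 / ‖x‖ ^ 3) *
            (-(B i) * x j - B j * x i + (∑ l, B l * x l) * kron i j))) (2 + q) ρ₂) := by
  have hq : 0 < q := by linarith
  obtain ⟨G₀, hG, hGs, hGe, hGd⟩ := exists_metric_data hα hαhom (-(3 + q))
  obtain ⟨P₀, hP, hPs, hPe, hPd⟩ := exists_momentum_data hβ hβhom (-(3 + q))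
  obtain ⟨l, hl, v, X, s, hv, hX, ⟨c, hvO⟩, hXO, hconf, hs, hs1, hnear, hham, hdiv⟩ :=
    exists_vacuum_solution hq hq₂ hG hGs hGd hP hPd
  choose B hXB using hXO
  obtain ⟨η, hη, hηe⟩ := exists_isSymbol_inv_norm
  have hvη := isSymbol_sub_inv_norm hη hηe hv hvO
  have hXη := fun i => isSymbol_sub_inv_norm hη hηe (hX i) (hXB i)
  have hv1 := isSymbol_of_sub_inv_norm hq hη hvη
  have hX1 := fun i => isSymbol_of_sub_inv_norm hq hη (hXη i)
  have hspos : ∀ x, 0 < s x := fun x => by linarith [(abs_lt.1 (hs1 x)).1]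
  have hGk : ∀ i j, IsSymbol 2 (fun x => invDensity l G₀ v i j x - kron i j) (-1) := fun i j =>
    (((hG i j).add (hv1.const_mul (kron i j))).const_mul l).congr fun x => by
      simp only [invDensity, add_sub_cancel_left]
  have hXd : ∀ i k, IsSymbol 1 (pd (X i) k) (-2) := fun i k =>
    ((hX1 i).derivative k).mono (by norm_num)
  have hp : ∀ i j, IsSymbol 1 (momDensity l P₀ X i j) (-2) := fun i j =>
    ((((hP i j).add (hXd j i)).add (hXd i j)).sub
      ((IsSymbol.sum fun k _ => hXd k k).const_mul (kron i j))).const_mul l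
  have hps : ∀ i j, momDensity l P₀ X i j = momDensity l P₀ X j i := fun i j => by
    funext x
    simp only [momDensity, hPs i j, kron_comm i j]
    ring
  set G := invDensity l G₀ v with hGdef
  set p := momDensity l P₀ X with hpdef
  have hdil : ContDiff ℝ 2 fun x : E3 => l • x := by fun_prop
  have hρ : 2 / l < 2 / l + 1 := by linarith
  have hρ1 : 1 ≤ 2 / l + 1 := by
    have : 0 < 2 / l := by positivity
    linarith
  refine ⟨fun x => metric s G (l • x), fun x => l • momentum s G p (l • x),
    fun i j => (hconf.contDiff_metric i j).comp hdil,
    fun x => hconf.posDef_metric (hspos _) fun i j => hnear i j _,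
    fun x => Matrix.IsSymm.ext fun i j => hconf.metric_symm _ j i, fun i j => ?_, fun x => ?_,
    fun x => by rw [hamiltonian_comp_smul, hham, mul_zero],
    fun x j => by rw [divT_comp_smul, hdiv, mul_zero],
    c / 2, B, 2 / l + 1, by positivity, fun i j => ?_, fun i j => ?_⟩
  · have h : IsSymbol 1 (fun x => momentum s G p x i j) (-2) :=
      (((hconf.isSymbol_momentum_sub hs hspos hGk hp i j).mono (t := -2) (by norm_num)).add
        (hp i j)).congr fun x => by ring
    exact contDiff_const.mul (h.contDiff.comp (hdil.of_le (by norm_num)))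
  · refine Matrix.IsSymm.ext fun i j => ?_
    change l * momentum s G p (l • x) j i = l * momentum s G p (l • x) i j
    congr 1
    simp only [momentum, VacuumData.lower]
    rw [Finset.sum_comm]
    exact Finset.sum_congr rfl fun a _ => Finset.sum_congr rfl fun b _ => by rw [hps b a]; ring
  · have h := (((hconf.isSymbol_metric_sub hs hspos hGk i j).mono (t := -(1 + q))
      (by linarith)).add (hvη.const_mul (l / 2 * kron i j))).comp_smul hl
    refine h.isO2 hρ1 hρ fun x hx => ?_
    rw [metric_expansion_eq hl hαhom hGe hηe i j hx (c := c)]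
    ring
  · have hW : ∀ i k, IsSymbol 1 (pd (fun y => X i y - B i * η y) k) (-(2 + q)) := fun i k =>
      ((hXη i).derivative k).mono (by linarith)
    have h := ((((hconf.isSymbol_momentum_sub hs hspos hGk hp i j).mono (t := -(2 + q))
      (by linarith)).const_mul l).add ((((hW j i).add (hW i j)).sub
        ((IsSymbol.sum fun k (_ : k ∈ Finset.univ) => hW k k).const_mul (kron i j))).const_mul
          (l ^ 2))).comp_smul hl
    refine h.isO1 hρ1 hρ fun x hx => ?_
    have e := momentum_expansion_eq (B := B) hl hβhom hPe hηe hη.1 (fun i => (hX1 i).1) i j hx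
    simp only [Matrix.smul_apply, smul_eq_mul]
    linear_combination e
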